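/- Let M(X) denote the number of SL₃(ℤ)-equivalence classes of integral ternary cubic forms f with Δ(f) ≠ 0 and height H(f) < X that are strongly irreducible but not totally irreducible. Then lim_{X→∞} M(X)/X^{5/6} = 0. -/

import Mathlib

open MvPolynomial

/-- The action of a 3×3 matrix on ternary forms: `(γ·f)(x,y,z) = f((x,y,z)·γ)`. -/
noncomputable def actGL {R : Type*} [CommRing R] (γ : Matrix (Fin 3) (Fin 3) R)
    (f : MvPolynomial (Fin 3) R) : MvPolynomial (Fin 3) R :=
  bind₁ (fun j => ∑ i : Fin 3, C (γ i j) * X i) f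

/-- The Hessian of a ternary form: the determinant of the matrix of second partials. -/
noncomputable def hess {R : Type*} [CommRing R] (f : MvPolynomial (Fin 3) R) :
    MvPolynomial (Fin 3) R :=
  Matrix.det (Matrix.of fun i j => pderiv i (pderiv j f))

/-- The exponent vectors of the ten monomials of a ternary cubic form. -/
def expo : Fin 10 → Fin 3 → ℕ :=
  ![![3,0,0], ![0,3,0], ![0,0,3], ![2,1,0], ![2,0,1],
    ![1,2,0], ![0,2,1], ![1,0,2], ![0,1,2], ![1,1,1]]

/-- The ternary cubic form with coefficient vector `c : Fin 10 → R`. -/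
noncomputable def cubic {R : Type*} [CommRing R] (c : Fin 10 → R) : MvPolynomial (Fin 3) R :=
  ∑ k : Fin 10, C (c k) * ∏ i : Fin 3, X i ^ expo k i

/-- The coefficient vector of the Weierstrass cubic `x³ + A·x·z² + B·z³ − y²·z`. -/
noncomputable def wcoeffs {R : Type*} [CommRing R] (A B : R) : Fin 10 → R :=
  ![1, 0, B, 0, 0, 0, -1, A, 0, 0]

/-- The generic ternary cubic form, whose coefficients are the 10 indeterminates. -/
noncomputable def genCubic (R : Type*) [CommRing R] :
    MvPolynomial (Fin 3) (MvPolynomial (Fin 10) R) :=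
  cubic (fun k => X k)

/-- `P` and `Q` are the invariants `I` and `J`: they are homogeneous of degrees 4 and 6
in the ten coefficients, they satisfy the identity
`H(H(f)) = 12288·I(f)²·f + 512·J(f)·H(f)` (stated for the generic ternary cubic form,
hence for every ternary cubic form over every commutative `R`-algebra), and they are
normalized so that `x³ + A·x·z² + B·z³ − y²·z` has `I = −3A` and `J = −27B`. -/
def IsInvariantPair (R : Type*) [CommRing R] (P Q : MvPolynomial (Fin 10) R) : Prop :=
  P.IsHomogeneous 4 ∧ Q.IsHomogeneous 6 ∧
  hess (hess (genCubic R)) =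
    12288 * C P ^ 2 * genCubic R + 512 * C Q * hess (genCubic R) ∧
  ∀ A B : R, aeval (wcoeffs A B) P = -3 * A ∧ aeval (wcoeffs A B) Q = -27 * B

/-- The invariant `I` of the integral ternary cubic form with coefficients `c`,
where `P` is the degree-4 invariant polynomial. -/
noncomputable def Iinv (P : MvPolynomial (Fin 10) ℚ) (c : Fin 10 → ℤ) : ℚ :=
  aeval (fun k => (c k : ℚ)) P

/-- The invariant `J` of the integral ternary cubic form with coefficients `c`,
where `Q` is the degree-6 invariant polynomial. -/
noncomputable def Jinv (Q : MvPolynomial (Fin 10) ℚ) (c : Fin 10 → ℤ) : ℚ :=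
  aeval (fun k => (c k : ℚ)) Q

/-- The discriminant `Δ = (4I³ − J²)/27` of the integral ternary cubic form `c`. -/
noncomputable def Δinv (P Q : MvPolynomial (Fin 10) ℚ) (c : Fin 10 → ℤ) : ℚ :=
  (4 * Iinv P c ^ 3 - Jinv Q c ^ 2) / 27

/-- The height `H = max(|I|³, J²/4)` of the integral ternary cubic form `c`. -/
noncomputable def Hinv (P Q : MvPolynomial (Fin 10) ℚ) (c : Fin 10 → ℤ) : ℚ :=
  max (|Iinv P c| ^ 3) (Jinv Q c ^ 2 / 4)

/-- An integral ternary cubic form is strongly irreducible if `f` and its Hessian have no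
common nontrivial rational zero. -/
def StronglyIrred (c : Fin 10 → ℤ) : Prop :=
  ¬ ∃ v : Fin 3 → ℚ, v ≠ 0 ∧ eval v (cubic fun k => (c k : ℚ)) = 0 ∧
      eval v (hess (cubic fun k => (c k : ℚ))) = 0

/-- The `SL₃(ℤ)`-orbit (equivalence class) of the integral ternary cubic form `c`. -/
noncomputable def orbitZ (c : Fin 10 → ℤ) : Set (Fin 10 → ℤ) :=
  {c' | ∃ γ : Matrix.SpecialLinearGroup (Fin 3) ℤ,
    actGL (γ : Matrix (Fin 3) (Fin 3) ℤ) (cubic c) = cubic c'}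

/-- `ζ(2)`. -/
noncomputable def zeta2 : ℝ := ∑' n : ℕ, (1 : ℝ) / (n + 1) ^ 2

/-- `ζ(3)`. -/
noncomputable def zeta3 : ℝ := ∑' n : ℕ, (1 : ℝ) / (n + 1) ^ 3

/-- The elliptic curve `y² = x³ − (I(f)/3)x − (J(f)/27)` attached to the integral ternary
cubic form with coefficients `c`. -/
noncomputable def Ecurve (P Q : MvPolynomial (Fin 10) ℚ) (c : Fin 10 → ℤ) :
    WeierstrassCurve ℚ :=
  ⟨0, 0, 0, -(Iinv P c / 3), -(Jinv Q c / 27)⟩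

/-- An integral ternary cubic form is totally irreducible if it is strongly irreducible,
`Δ(f) ≠ 0`, and the elliptic curve `y² = x³ − (I(f)/3)x − (J(f)/27)` over `ℚ` has no
rational point of order 3. -/
def TotallyIrred (P Q : MvPolynomial (Fin 10) ℚ) (c : Fin 10 → ℤ) : Prop :=
  StronglyIrred c ∧ Δinv P Q c ≠ 0 ∧
    ∀ p : (Ecurve P Q c).toAffine.Point, 3 • p = 0 → p = 0

/-- The number of `SL₃(ℤ)`-equivalence classes of integral ternary cubic forms with
`Δ ≠ 0` and height `< X` that are strongly irreducible but not totally irreducible. -/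
noncomputable def Mcount (P Q : MvPolynomial (Fin 10) ℚ) (X : ℝ) : ℕ :=
  Set.ncard {T : Set (Fin 10 → ℤ) | ∃ c : Fin 10 → ℤ, StronglyIrred c ∧
    ¬ TotallyIrred P Q c ∧ Δinv P Q c ≠ 0 ∧ (Hinv P Q c : ℝ) < X ∧ T = orbitZ c}

/-! ## Basic algebra of ternary cubic forms -/

/-- The value of the cubic form with coefficient vector `c` at `v`. -/
def ev {R : Type*} [CommRing R] (c : Fin 10 → R) (v : Fin 3 → R) : R :=
  c 0 * v 0 ^ 3 + c 1 * v 1 ^ 3 + c 2 * v 2 ^ 3 + c 3 * (v 0 ^ 2 * v 1) + c 4 * (v 0 ^ 2 * v 2)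
    + c 5 * (v 0 * v 1 ^ 2) + c 6 * (v 1 ^ 2 * v 2) + c 7 * (v 0 * v 2 ^ 2)
    + c 8 * (v 1 * v 2 ^ 2) + c 9 * (v 0 * v 1 * v 2)

/-- The gradient of the cubic form at `u`, paired with `w`. -/
def dv {R : Type*} [CommRing R] (c : Fin 10 → R) (u w : Fin 3 → R) : R :=
  c 0 * (3 * u 0 ^ 2 * w 0) + c 1 * (3 * u 1 ^ 2 * w 1) + c 2 * (3 * u 2 ^ 2 * w 2)
    + c 3 * (2 * u 0 * u 1 * w 0 + u 0 ^ 2 * w 1) + c 4 * (2 * u 0 * u 2 * w 0 + u 0 ^ 2 * w 2)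
    + c 5 * (w 0 * u 1 ^ 2 + 2 * u 0 * u 1 * w 1) + c 6 * (2 * u 1 * u 2 * w 1 + u 1 ^ 2 * w 2)
    + c 7 * (w 0 * u 2 ^ 2 + 2 * u 0 * u 2 * w 2) + c 8 * (w 1 * u 2 ^ 2 + 2 * u 1 * u 2 * w 2)
    + c 9 * (w 0 * u 1 * u 2 + u 0 * w 1 * u 2 + u 0 * u 1 * w 2)

/-- The full polarization of the cubic form. -/
def tv {R : Type*} [CommRing R] (c : Fin 10 → R) (u v w : Fin 3 → R) : R :=
  c 0 * (6 * u 0 * v 0 * w 0) + c 1 * (6 * u 1 * v 1 * w 1) + c 2 * (6 * u 2 * v 2 * w 2)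
    + c 3 * (2 * (u 0 * v 0 * w 1 + u 0 * v 1 * w 0 + u 1 * v 0 * w 0))
    + c 4 * (2 * (u 0 * v 0 * w 2 + u 0 * v 2 * w 0 + u 2 * v 0 * w 0))
    + c 5 * (2 * (u 1 * v 1 * w 0 + u 1 * v 0 * w 1 + u 0 * v 1 * w 1))
    + c 6 * (2 * (u 1 * v 1 * w 2 + u 1 * v 2 * w 1 + u 2 * v 1 * w 1))
    + c 7 * (2 * (u 2 * v 2 * w 0 + u 2 * v 0 * w 2 + u 0 * v 2 * w 2))
    + c 8 * (2 * (u 2 * v 2 * w 1 + u 2 * v 1 * w 2 + u 1 * v 2 * w 2))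
    + c 9 * (u 0 * v 1 * w 2 + u 0 * v 2 * w 1 + u 1 * v 0 * w 2 + u 1 * v 2 * w 0
        + u 2 * v 0 * w 1 + u 2 * v 1 * w 0)

/-- The action on coefficient vectors. -/
def act {R : Type*} [CommRing R] (g : Matrix (Fin 3) (Fin 3) R) (c : Fin 10 → R) : Fin 10 → R :=
  ![ev c (g 0), ev c (g 1), ev c (g 2), dv c (g 0) (g 1), dv c (g 0) (g 2), dv c (g 1) (g 0),
    dv c (g 1) (g 2), dv c (g 2) (g 0), dv c (g 2) (g 1), tv c (g 0) (g 1) (g 2)]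

/-- The coefficient vector of the Hessian. -/
def hc {R : Type*} [CommRing R] (c : Fin 10 → R) : Fin 10 → R :=
  ![24 * c 0 * c 5 * c 7 - 6 * c 0 * c 9 * c 9 - 8 * c 3 * c 3 * c 7 + 8 * c 3 * c 4 * c 9 - 8 * c 4 * c 4 * c 5,
    24 * c 1 * c 3 * c 8 - 6 * c 1 * c 9 * c 9 - 8 * c 3 * c 6 * c 6 - 8 * c 5 * c 5 * c 8 + 8 * c 5 * c 6 * c 9,
    24 * c 2 * c 4 * c 6 - 6 * c 2 * c 9 * c 9 - 8 * c 4 * c 8 * c 8 - 8 * c 6 * c 7 * c 7 + 8 * c 7 * c 8 * c 9,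
    72 * c 0 * c 1 * c 7 + 24 * c 0 * c 5 * c 8 - 24 * c 0 * c 6 * c 9 - 24 * c 1 * c 4 * c 4 - 8 * c 3 * c 3 * c 8 + 16 * c 3 * c 4 * c 6 - 8 * c 3 * c 5 * c 7 + 2 * c 3 * c 9 * c 9,
    72 * c 0 * c 2 * c 5 + 24 * c 0 * c 6 * c 7 - 24 * c 0 * c 8 * c 9 - 24 * c 2 * c 3 * c 3 + 16 * c 3 * c 4 * c 8 - 8 * c 4 * c 4 * c 6 - 8 * c 4 * c 5 * c 7 + 2 * c 4 * c 9 * c 9,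
    72 * c 0 * c 1 * c 8 - 24 * c 0 * c 6 * c 6 + 24 * c 1 * c 3 * c 7 - 24 * c 1 * c 4 * c 9 - 8 * c 3 * c 5 * c 8 + 16 * c 4 * c 5 * c 6 - 8 * c 5 * c 5 * c 7 + 2 * c 5 * c 9 * c 9,
    72 * c 1 * c 2 * c 3 + 24 * c 1 * c 4 * c 8 - 24 * c 1 * c 7 * c 9 - 24 * c 2 * c 5 * c 5 - 8 * c 3 * c 6 * c 8 - 8 * c 4 * c 6 * c 6 + 16 * c 5 * c 6 * c 7 + 2 * c 6 * c 9 * c 9,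
    72 * c 0 * c 2 * c 6 - 24 * c 0 * c 8 * c 8 - 24 * c 2 * c 3 * c 9 + 24 * c 2 * c 4 * c 5 + 16 * c 3 * c 7 * c 8 - 8 * c 4 * c 6 * c 7 - 8 * c 5 * c 7 * c 7 + 2 * c 7 * c 9 * c 9,
    72 * c 1 * c 2 * c 4 - 24 * c 1 * c 7 * c 7 + 24 * c 2 * c 3 * c 6 - 24 * c 2 * c 5 * c 9 - 8 * c 3 * c 8 * c 8 - 8 * c 4 * c 6 * c 8 + 16 * c 5 * c 7 * c 8 + 2 * c 8 * c 9 * c 9,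
    216 * c 0 * c 1 * c 2 - 24 * c 0 * c 6 * c 8 - 24 * c 1 * c 4 * c 7 - 24 * c 2 * c 3 * c 5 + 24 * c 3 * c 6 * c 7 - 8 * c 3 * c 8 * c 9 + 24 * c 4 * c 5 * c 8 - 8 * c 4 * c 6 * c 9 - 8 * c 5 * c 7 * c 9 + 2 * c 9 * c 9 * c 9]

theorem cubic_eq_ev {R : Type*} [CommRing R] (c : Fin 10 → R) :
    cubic c = ev (fun k => C (c k)) X := by
  simp [cubic, ev, Fin.sum_univ_succ, Fin.prod_univ_succ, expo]
  ring

theorem ev_act {R : Type*} [CommRing R] (g : Matrix (Fin 3) (Fin 3) R) (c : Fin 10 → R)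
    (v : Fin 3 → R) : ev (act g c) v = ev c (fun j => ∑ i, g i j * v i) := by
  simp [ev, act, dv, tv, Fin.sum_univ_succ]
  ring

theorem map_ev {R S : Type*} [CommRing R] [CommRing S] (φ : R →+* S) (c : Fin 10 → R)
    (v : Fin 3 → R) : φ (ev c v) = ev (fun k => φ (c k)) (fun i => φ (v i)) := by
  simp [ev]

theorem map_dv {R S : Type*} [CommRing R] [CommRing S] (φ : R →+* S) (c : Fin 10 → R)
    (v w : Fin 3 → R) :
    φ (dv c v w) = dv (fun k => φ (c k)) (fun i => φ (v i)) (fun i => φ (w i)) := by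
  simp only [dv, map_add, map_mul, map_pow, map_ofNat]

theorem map_tv {R S : Type*} [CommRing R] [CommRing S] (φ : R →+* S) (c : Fin 10 → R)
    (u v w : Fin 3 → R) :
    φ (tv c u v w) = tv (fun k => φ (c k)) (fun i => φ (u i)) (fun i => φ (v i))
      (fun i => φ (w i)) := by
  simp only [tv, map_add, map_mul, map_pow, map_ofNat]

theorem map_act {R S : Type*} [CommRing R] [CommRing S] (φ : R →+* S) (c : Fin 10 → R)
    (g : Matrix (Fin 3) (Fin 3) R) (k : Fin 10) :
    φ (act g c k) = act (g.map φ) (fun k => φ (c k)) k := by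
  have h1 := fun v => map_ev φ c v
  have h2 := fun u v => map_dv φ c u v
  have h3 := fun u v w => map_tv φ c u v w
  unfold act
  fin_cases k
  · exact h1 _
  · exact h1 _
  · exact h1 _
  · exact h2 _ _
  · exact h2 _ _
  · exact h2 _ _
  · exact h2 _ _
  · exact h2 _ _
  · exact h2 _ _
  · exact h3 _ _ _

theorem map_hc {R S : Type*} [CommRing R] [CommRing S] (φ : R →+* S) (c : Fin 10 → R)
    (k : Fin 10) : φ (hc c k) = hc (fun k => φ (c k)) k := by
  fin_cases k <;> simp [hc, map_ofNat]

theorem actGL_cubic {R : Type*} [CommRing R] (g : Matrix (Fin 3) (Fin 3) R) (c : Fin 10 → R) :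
    actGL g (cubic c) = cubic (act g c) := by
  have h := ev_act (R := MvPolynomial (Fin 3) R) (g.map C) (fun k => C (c k)) X
  rw [cubic_eq_ev (act g c)]
  have h2 : (fun k => C (act g c k) : Fin 10 → MvPolynomial (Fin 3) R)
      = act (g.map C) (fun k => C (c k)) := by
    funext k; exact map_act C c g k
  rw [h2, h, cubic_eq_ev, actGL, ← AlgHom.coe_toRingHom, map_ev]
  simp

/-- The exponent vectors as finitely supported functions. -/
noncomputable def expoF (k : Fin 10) : Fin 3 →₀ ℕ := Finsupp.equivFunOnFinite.symm (expo k)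

theorem expoF_inj {k l : Fin 10} (h : expoF k = expoF l) : k = l := by
  have h2 : expo k = expo l := Finsupp.equivFunOnFinite.symm.injective h
  clear h
  revert h2; revert k l
  decide

theorem coeff_cubic {R : Type*} [CommRing R] (c : Fin 10 → R) (k : Fin 10) :
    coeff (expoF k) (cubic c) = c k := by
  have h : ∀ l : Fin 10, (C (c l) * ∏ i : Fin 3, X i ^ expo l i : MvPolynomial (Fin 3) R)
      = monomial (expoF l) (c l) := by
    intro l
    rw [monomial_eq]
    congr 1
    rw [Finsupp.prod_fintype _ _ (by simp)]
    simp [expoF]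
  rw [cubic, Finset.sum_congr rfl (fun l _ => h l), coeff_sum]
  simp only [coeff_monomial]
  rw [Finset.sum_eq_single k]
  · simp
  · intro l _ hl
    rw [if_neg]
    intro h'
    exact hl (expoF_inj h')
  · simp

theorem cubic_inj {R : Type*} [CommRing R] {c d : Fin 10 → R} (h : cubic c = cubic d) : c = d := by
  funext k
  rw [← coeff_cubic c k, h, coeff_cubic]

theorem act_mul {R : Type*} [CommRing R] (g h : Matrix (Fin 3) (Fin 3) R) (c : Fin 10 → R) :
    act g (act h c) = act (g * h) c := by
  apply cubic_inj
  rw [← actGL_cubic, ← actGL_cubic, ← actGL_cubic]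
  unfold actGL
  rw [bind₁_bind₁]
  congr 2
  funext j
  simp [Matrix.mul_apply, Fin.sum_univ_succ]
  ring

theorem act_one {R : Type*} [CommRing R] (c : Fin 10 → R) : act 1 c = c := by
  funext k
  fin_cases k <;> simp [act, ev, dv, tv]

theorem act_smul {R : Type*} [CommRing R] (g : Matrix (Fin 3) (Fin 3) R) (t : R)
    (c : Fin 10 → R) : act g (t • c) = t • act g c := by
  funext k
  fin_cases k <;> simp [act, ev, dv, tv] <;> ring

theorem act_add {R : Type*} [CommRing R] (g : Matrix (Fin 3) (Fin 3) R)
    (c d : Fin 10 → R) : act g (c + d) = act g c + act g d := by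
  funext k
  fin_cases k <;> simp [act, ev, dv, tv] <;> ring

theorem act_scalar {R : Type*} [CommRing R] (t : R) (c : Fin 10 → R) :
    act (t • (1 : Matrix (Fin 3) (Fin 3) R)) c = t ^ 3 • c := by
  funext k
  fin_cases k <;> simp [act, ev, dv, tv] <;> ring

theorem hc_smul {R : Type*} [CommRing R] (t : R) (c : Fin 10 → R) :
    hc (t • c) = t ^ 3 • hc c := by
  funext k
  fin_cases k <;> simp [hc] <;> ring

theorem pderiv_ev {R : Type*} [CommRing R] (c : Fin 10 → R) (i : Fin 3) :
    pderiv i (ev (fun k => C (c k)) X) =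
      dv (fun k => C (c k)) (X : Fin 3 → MvPolynomial (Fin 3) R) (Pi.single i 1) := by
  simp only [ev, dv, map_add, Derivation.leibniz, Derivation.leibniz_pow, pderiv_C, pderiv_X,
    smul_eq_mul, mul_zero, add_zero, nsmul_eq_mul]
  push_cast
  fin_cases i <;> simp <;> ring

theorem pderiv_dv {R : Type*} [CommRing R] (c : Fin 10 → R) (i j : Fin 3) :
    pderiv i (dv (fun k => C (c k)) (X : Fin 3 → MvPolynomial (Fin 3) R) (Pi.single j 1)) =
      tv (fun k => C (c k)) (X : Fin 3 → MvPolynomial (Fin 3) R) (Pi.single j 1)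
        (Pi.single i 1) := by
  have h3 : (pderiv i : Derivation R _ _) (3 : MvPolynomial (Fin 3) R) = 0 :=
    Derivation.map_natCast _ 3
  have h2 : (pderiv i : Derivation R _ _) (2 : MvPolynomial (Fin 3) R) = 0 :=
    Derivation.map_natCast _ 2
  have hs : ∀ l, (pderiv i : Derivation R _ _) ((Pi.single j 1 : Fin 3 → MvPolynomial (Fin 3) R) l)
      = 0 := by
    intro l
    rw [Pi.single_apply]; split_ifs <;> simp
  simp only [dv, tv, map_add, Derivation.leibniz, Derivation.leibniz_pow, pderiv_C, pderiv_X,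
    smul_eq_mul, mul_zero, add_zero, nsmul_eq_mul, h2, h3, hs]
  push_cast
  generalize (Pi.single i 1 : Fin 3 → MvPolynomial (Fin 3) R) = e
  generalize (Pi.single j 1 : Fin 3 → MvPolynomial (Fin 3) R) = e
  ring

theorem hess_cubic {R : Type*} [CommRing R] (c : Fin 10 → R) :
    hess (cubic c) = cubic (hc c) := by
  rw [hess, Matrix.det_fin_three, cubic_eq_ev, cubic_eq_ev]
  simp only [Matrix.of_apply, pderiv_ev, pderiv_dv]
  rw [show (fun k => C (hc c k) : Fin 10 → MvPolynomial (Fin 3) R) = hc (fun k => C (c k)) from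
    funext fun k => map_hc C c k]
  generalize (fun k => C (c k) : Fin 10 → MvPolynomial (Fin 3) R) = d
  simp [ev, hc, tv]
  ring

theorem pderiv_actGL {R : Type*} [CommRing R] (g : Matrix (Fin 3) (Fin 3) R)
    (f : MvPolynomial (Fin 3) R) (i : Fin 3) :
    pderiv i (actGL g f) = ∑ j, C (g i j) * actGL g (pderiv j f) := by
  unfold actGL
  induction f using MvPolynomial.induction_on with
  | C a => simp
  | add p q hp hq => simp [hp, hq, mul_add, Finset.sum_add_distrib]
  | mul_X p k hp =>
    simp only [map_mul, Derivation.leibniz, smul_eq_mul, map_add, hp, bind₁_X_right, mul_add,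
      Finset.sum_add_distrib]
    congr 1
    · fin_cases k <;> fin_cases i <;> simp [Fin.sum_univ_succ, pderiv_X, Pi.single_apply] <;> ring
    · rw [Finset.mul_sum]
      refine Finset.sum_congr rfl fun j _ => ?_
      ring

theorem hess_actGL {R : Type*} [CommRing R] (g : Matrix (Fin 3) (Fin 3) R)
    (f : MvPolynomial (Fin 3) R) :
    hess (actGL g f) = C (g.det ^ 2) * actGL g (hess f) := by
  have hM : (Matrix.of fun i j => pderiv i (pderiv j (actGL g f)))
      = (g.map C) * ((Matrix.of fun i j => pderiv i (pderiv j f)).map (bind₁ (fun j => ∑ i : Fin 3, C (g i j) * X i))) * (g.map C).transpose := by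
    ext1 i j
    have hp : ∀ k l : Fin 3, (bind₁ (fun j => ∑ i : Fin 3, C (g i j) * X i))
        (pderiv k (pderiv l f)) = actGL g (pderiv k (pderiv l f)) := fun _ _ => rfl
    simp only [Matrix.of_apply, pderiv_actGL, map_sum, Matrix.mul_apply, Matrix.map_apply,
      Matrix.transpose_apply, Derivation.leibniz, pderiv_C, smul_zero, add_zero, smul_eq_mul, hp,
      mul_zero]
    refine Finset.sum_congr rfl fun k _ => ?_
    rw [Finset.sum_mul, Finset.mul_sum]
    refine Finset.sum_congr rfl fun l _ => ?_
    ring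
  rw [hess, hM, Matrix.det_mul, Matrix.det_mul, Matrix.det_transpose]
  have h1 : (g.map (C : R →+* MvPolynomial (Fin 3) R)).det = C g.det := by
    rw [RingHom.map_det]; rfl
  have h2 : ((Matrix.of fun i j => pderiv i (pderiv j f)).map (bind₁ (fun j => ∑ i : Fin 3, C (g i j) * X i))).det = actGL g (hess f) := by
    rw [actGL, hess, ← AlgHom.coe_toRingHom, RingHom.map_det]; rfl
  have h1' : (g.map (⇑(C : R →+* MvPolynomial (Fin 3) R))).det = C g.det := h1
  rw [h1', h2, map_pow]
  ring

theorem C_mul_cubic {R : Type*} [CommRing R] (t : R) (c : Fin 10 → R) :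
    C t * cubic c = cubic (t • c) := by
  simp [cubic, Finset.mul_sum, mul_assoc]

theorem cubic_add {R : Type*} [CommRing R] (c d : Fin 10 → R) :
    cubic c + cubic d = cubic (c + d) := by
  simp [cubic, ← Finset.sum_add_distrib, add_mul]

theorem hc_act {R : Type*} [CommRing R] (g : Matrix (Fin 3) (Fin 3) R) (c : Fin 10 → R) :
    hc (act g c) = g.det ^ 2 • act g (hc c) := by
  apply cubic_inj
  rw [← hess_cubic, ← actGL_cubic, hess_actGL, hess_cubic, actGL_cubic, C_mul_cubic]

/-! ## The invariants -/

theorem hc_hc_generic {P Q : MvPolynomial (Fin 10) ℚ} (hPQ : IsInvariantPair ℚ P Q) :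
    hc (hc (X : Fin 10 → MvPolynomial (Fin 10) ℚ)) =
      (12288 * P ^ 2) • (X : Fin 10 → MvPolynomial (Fin 10) ℚ) + (512 * Q) • hc X := by
  obtain ⟨-, -, h, -⟩ := hPQ
  unfold genCubic at h
  apply cubic_inj
  rw [← hess_cubic, ← hess_cubic, ← cubic_add, ← C_mul_cubic, ← C_mul_cubic, ← hess_cubic]
  refine h.trans ?_
  simp only [map_mul, map_pow, map_ofNat]

theorem hc_hc_eq {P Q : MvPolynomial (Fin 10) ℚ} (hPQ : IsInvariantPair ℚ P Q)
    {S : Type*} [CommRing S] [Algebra ℚ S] (c : Fin 10 → S) :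
    hc (hc c) = (12288 * aeval c P ^ 2) • c + (512 * aeval c Q) • hc c := by
  funext k
  have h := congrArg (fun f => (aeval c : MvPolynomial (Fin 10) ℚ →ₐ[ℚ] S).toRingHom (f k))
    (hc_hc_generic hPQ)
  simp only [map_hc, Pi.add_apply, Pi.smul_apply, smul_eq_mul, map_add, map_mul, map_pow,
    map_ofNat] at h
  have e : (fun i => (aeval c : MvPolynomial (Fin 10) ℚ →ₐ[ℚ] S).toRingHom (X i)) = c := by
    funext i
    exact aeval_X c i
  have e2 : (fun k => hc (fun i => (aeval c : MvPolynomial (Fin 10) ℚ →ₐ[ℚ] S).toRingHom (X i)) k)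
      = hc c := by rw [e]
  rw [e2] at h
  rw [e] at h
  have e3 := aeval_X (R := ℚ) c k
  simpa using h

theorem act_adj {R : Type*} [CommRing R] (g : Matrix (Fin 3) (Fin 3) R) (c : Fin 10 → R) :
    act g.adjugate (act g c) = g.det ^ 3 • c := by
  rw [act_mul, Matrix.adjugate_mul, act_scalar]

theorem inv_act_domain {P Q : MvPolynomial (Fin 10) ℚ} (hPQ : IsInvariantPair ℚ P Q)
    {S : Type*} [CommRing S] [IsDomain S] [Algebra ℚ S] (c : Fin 10 → S)
    (g : Matrix (Fin 3) (Fin 3) S) (hd : g.det ≠ 0) (hD : c 0 * hc c 5 - c 5 * hc c 0 ≠ 0)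
    (hc0 : c 0 ≠ 0) :
    aeval (act g c) P ^ 2 = (g.det ^ 4 * aeval c P) ^ 2 ∧
    aeval (act g c) Q = g.det ^ 6 * aeval c Q := by
  have h1 := hc_hc_eq hPQ (act g c)
  have h2 : hc (hc (act g c)) = g.det ^ 8 • act g (hc (hc c)) := by
    rw [hc_act, hc_smul, hc_act, smul_smul]; congr 1; ring
  rw [h2, hc_hc_eq hPQ c, hc_act, act_add, act_smul, act_smul] at h1
  generalize aeval (act g c) P = p' at *
  generalize aeval (act g c) Q = q' at *
  generalize aeval c P = p at *
  generalize aeval c Q = q at *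
  have h3 : act g ((12288 * (p' ^ 2 - (g.det ^ 4 * p) ^ 2)) • c
      + (512 * g.det ^ 2 * (q' - g.det ^ 6 * q)) • hc c) = 0 := by
    rw [act_add, act_smul, act_smul]
    funext k
    have := congrFun h1 k
    simp only [Pi.add_apply, Pi.smul_apply, smul_eq_mul, Pi.zero_apply] at this ⊢
    linear_combination -this
  have h4 := act_adj g ((12288 * (p' ^ 2 - (g.det ^ 4 * p) ^ 2)) • c
      + (512 * g.det ^ 2 * (q' - g.det ^ 6 * q)) • hc c)
  rw [h3] at h4
  have h5 : act g.adjugate (0 : Fin 10 → S) = 0 := by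
    have := act_smul g.adjugate (0 : S) 0
    simpa using this
  rw [h5] at h4
  have h6 := (smul_eq_zero.mp h4.symm).resolve_left (pow_ne_zero _ hd)
  have e0 := congrFun h6 0
  have e5 := congrFun h6 5
  simp only [Pi.add_apply, Pi.smul_apply, smul_eq_mul, Pi.zero_apply] at e0 e5
  have hch : CharZero S := algebraRat.charZero S
  have h7 : (512 * g.det ^ 2 * (q' - g.det ^ 6 * q)) * (c 0 * hc c 5 - c 5 * hc c 0) = 0 := by
    linear_combination c 0 * e5 - c 5 * e0
  have h8 : q' - g.det ^ 6 * q = 0 := by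
    rcases mul_eq_zero.mp h7 with h | h
    · rcases mul_eq_zero.mp h with h | h
      · exfalso
        rcases mul_eq_zero.mp h with h | h
        · norm_num at h
        · exact pow_ne_zero _ hd h
      · exact h
    · exact absurd h hD
  refine ⟨?_, sub_eq_zero.mp h8⟩
  rw [h8] at e0
  have h9 : (12288 * (p' ^ 2 - (g.det ^ 4 * p) ^ 2)) * c 0 = 0 := by linear_combination e0
  rcases mul_eq_zero.mp h9 with h | h
  · rcases mul_eq_zero.mp h with h | h
    · norm_num at h
    · exact sub_eq_zero.mp h
  · exact absurd h hc0

/-- Value of an integral polynomial in ten variables at a point of a commutative ring. -/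
noncomputable def pv {K : Type*} [CommRing K] (P : MvPolynomial (Fin 10) ℤ) (c : Fin 10 → K) : K :=
  eval₂ (Int.castRingHom K) c P

theorem map_pv {K L : Type*} [CommRing K] [CommRing L] (φ : K →+* L)
    (P : MvPolynomial (Fin 10) ℤ) (c : Fin 10 → K) :
    φ (pv P c) = pv P (fun k => φ (c k)) := by
  unfold pv
  rw [hom_eval₂]
  congr 1
  exact RingHom.ext_int _ _

theorem exists_int_mul (P : MvPolynomial (Fin 10) ℚ) :
    ∃ (N : ℕ) (P0 : MvPolynomial (Fin 10) ℤ), 0 < N ∧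
      (N : MvPolynomial (Fin 10) ℚ) * P = map (Int.castRingHom ℚ) P0 := by
  induction P using MvPolynomial.induction_on with
  | C a =>
    refine ⟨a.den, C a.num, a.den_pos, ?_⟩
    rw [map_C, ← map_natCast (C : ℚ →+* MvPolynomial (Fin 10) ℚ), ← map_mul]
    congr 1
    exact Rat.den_mul_eq_num a
  | add p q hp hq =>
    obtain ⟨N, P0, hN, h⟩ := hp
    obtain ⟨N', P0', hN', h'⟩ := hq
    refine ⟨N * N', N' * P0 + N * P0', by positivity, ?_⟩
    rw [map_add, map_mul, map_mul, ← h, ← h', map_natCast, map_natCast]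
    push_cast
    ring
  | mul_X p k hp =>
    obtain ⟨N, P0, hN, h⟩ := hp
    refine ⟨N, P0 * X k, hN, ?_⟩
    rw [map_mul, ← h, map_X]
    ring

theorem pv_eq_of_map {P : MvPolynomial (Fin 10) ℚ} {N : ℕ} {P0 : MvPolynomial (Fin 10) ℤ}
    (h : (N : MvPolynomial (Fin 10) ℚ) * P = map (Int.castRingHom ℚ) P0)
    {S : Type*} [CommRing S] [Algebra ℚ S] (c : Fin 10 → S) :
    pv P0 c = N * aeval c P := by
  have h2 := congrArg (aeval c : MvPolynomial (Fin 10) ℚ →ₐ[ℚ] S) h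
  rw [map_mul, map_natCast, aeval_def, aeval_def, eval₂_map] at h2
  rw [aeval_def, h2, pv]
  congr 1
  exact RingHom.ext_int _ _

theorem pv_smul {n : ℕ} {P : MvPolynomial (Fin 10) ℤ} (hP : P.IsHomogeneous n)
    {K : Type*} [CommRing K] (t : K) (c : Fin 10 → K) : pv P (t • c) = t ^ n * pv P c := by
  unfold pv
  rw [eval₂_eq', eval₂_eq', Finset.mul_sum]
  refine Finset.sum_congr rfl fun d hd => ?_
  have h1 := hP (mem_support_iff.mp hd)
  have h2 : ∑ i, d i = n := by
    rw [← h1, Finsupp.weight_apply, Finsupp.sum_fintype _ _ (by simp)]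
    simp
  simp only [Pi.smul_apply, smul_eq_mul, mul_pow, Finset.prod_mul_distrib, Finset.prod_pow_eq_pow_sum,
    h2]
  ring

theorem homog_of_map {n N : ℕ} {P : MvPolynomial (Fin 10) ℚ} {P0 : MvPolynomial (Fin 10) ℤ}
    (hP : P.IsHomogeneous n)
    (h : (N : MvPolynomial (Fin 10) ℚ) * P = map (Int.castRingHom ℚ) P0) : P0.IsHomogeneous n := by
  have h1 : (map (Int.castRingHom ℚ) P0).IsHomogeneous n := by
    rw [← h, ← map_natCast (C : ℚ →+* MvPolynomial (Fin 10) ℚ)]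
    exact hP.C_mul _
  exact h1.of_map (Int.castRingHom ℚ).injective_int

/-- Integral polynomials that are `N` times the two invariants. -/
structure InvData (P Q : MvPolynomial (Fin 10) ℚ) where
  /-- the common multiple -/
  N : ℕ
  /-- `N * I` -/
  P0 : MvPolynomial (Fin 10) ℤ
  /-- `N * J` -/
  Q0 : MvPolynomial (Fin 10) ℤ
  hN : 0 < N
  hP : ∀ (S : Type) [CommRing S] [Algebra ℚ S] (c : Fin 10 → S), pv P0 c = N * aeval c P
  hQ : ∀ (S : Type) [CommRing S] [Algebra ℚ S] (c : Fin 10 → S), pv Q0 c = N * aeval c Q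
  P_act : ∀ (K : Type) [CommRing K] (g : Matrix (Fin 3) (Fin 3) K) (c : Fin 10 → K),
    pv P0 (act g c) = g.det ^ 4 * pv P0 c
  Q_act : ∀ (K : Type) [CommRing K] (g : Matrix (Fin 3) (Fin 3) K) (c : Fin 10 → K),
    pv Q0 (act g c) = g.det ^ 6 * pv Q0 c
  P_smul : ∀ (K : Type) [CommRing K] (t : K) (c : Fin 10 → K), pv P0 (t • c) = t ^ 4 * pv P0 c
  Q_smul : ∀ (K : Type) [CommRing K] (t : K) (c : Fin 10 → K), pv Q0 (t • c) = t ^ 6 * pv Q0 c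
  P_w : ∀ (K : Type) [CommRing K] (A B : K), pv P0 (wcoeffs A B) = -3 * N * A
  Q_w : ∀ (K : Type) [CommRing K] (A B : K), pv Q0 (wcoeffs A B) = -27 * N * B
  hh : ∀ (S : Type) [CommRing S] [Algebra ℚ S] (c : Fin 10 → S),
    hc (hc c) = (12288 * aeval c P ^ 2) • c + (512 * aeval c Q) • hc c

theorem map_wcoeffs {K L : Type*} [CommRing K] [CommRing L] (φ : K →+* L) (A B : K) :
    (fun k => φ (wcoeffs A B k)) = wcoeffs (φ A) (φ B) := by
  funext k
  fin_cases k <;> simp [wcoeffs]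

theorem hc5_w : (wcoeffs (1 : ℚ) 0) 0 * hc (wcoeffs (1 : ℚ) 0) 5
    - (wcoeffs (1 : ℚ) 0) 5 * hc (wcoeffs (1 : ℚ) 0) 0 = -24 := by
  simp [wcoeffs, hc]

/-- The index type of the generic variables. -/
abbrev GIx := Fin 10 ⊕ (Fin 3 × Fin 3)

/-- The generic coefficient vector. -/
noncomputable def genC (R : Type) [CommRing R] : Fin 10 → MvPolynomial GIx R :=
  fun k => X (Sum.inl k)

/-- The generic matrix. -/
noncomputable def genG (R : Type) [CommRing R] : Matrix (Fin 3) (Fin 3) (MvPolynomial GIx R) :=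
  Matrix.of fun i j => X (Sum.inr (i, j))

theorem inv_act_generic {P Q : MvPolynomial (Fin 10) ℚ} (hPQ : IsInvariantPair ℚ P Q) :
    aeval (act (genG ℚ) (genC ℚ)) P
      = (genG ℚ).det ^ 4
        * aeval (genC ℚ) P ∧
    aeval (act (genG ℚ) (genC ℚ)) Q
      = (genG ℚ).det ^ 6
        * aeval (genC ℚ) Q := by
  set c : Fin 10 → MvPolynomial GIx ℚ := genC ℚ with hcdef
  set g : Matrix (Fin 3) (Fin 3) (MvPolynomial GIx ℚ) := genG ℚ with hgdef
  let φ : MvPolynomial GIx ℚ →ₐ[ℚ] ℚ :=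
    aeval (Sum.elim (wcoeffs (1 : ℚ) 0) (fun ij => (1 : Matrix (Fin 3) (Fin 3) ℚ) ij.1 ij.2))
  have hφc : ∀ k, φ (c k) = wcoeffs (1 : ℚ) 0 k := fun k => by simp [φ, c, genC]
  have hφc' : (fun k => φ.toRingHom (c k)) = wcoeffs (1 : ℚ) 0 := funext hφc
  have hφg : g.map φ.toRingHom = 1 := by
    ext1 i j
    simp [φ, g, genG]
  have hφd : φ.toRingHom g.det = 1 := by
    rw [RingHom.map_det]
    have : φ.toRingHom.mapMatrix g = 1 := hφg
    rw [this, Matrix.det_one]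
  have hd : g.det ≠ 0 := by
    intro h; rw [h] at hφd; simp at hφd
  have hD : c 0 * hc c 5 - c 5 * hc c 0 ≠ 0 := by
    intro h
    have h2 := congrArg φ.toRingHom h
    rw [map_sub, map_mul, map_mul, map_hc, map_hc, hφc', map_zero] at h2
    have h3 : φ.toRingHom (c 0) = wcoeffs (1 : ℚ) 0 0 := hφc 0
    have h4 : φ.toRingHom (c 5) = wcoeffs (1 : ℚ) 0 5 := hφc 5
    rw [h3, h4, hc5_w] at h2
    norm_num at h2
  have hc0 : c 0 ≠ 0 := X_ne_zero _
  obtain ⟨h1, h2⟩ := inv_act_domain hPQ c g hd hD hc0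
  refine ⟨?_, h2⟩
  rcases sq_eq_sq_iff_eq_or_eq_neg.mp h1 with h | h
  · exact h
  · exfalso
    have hv : ∀ x : Fin 10 → MvPolynomial GIx ℚ, φ.toRingHom (aeval x P)
        = aeval (fun k => φ.toRingHom (x k)) P := by
      intro x
      have := comp_aeval_apply (R := ℚ) x φ P
      exact this
    have h3 := congrArg φ.toRingHom h
    rw [map_neg, map_mul, map_pow, hφd, hv, hv, hφc'] at h3
    have e : (fun k => φ.toRingHom (act g c k)) = wcoeffs (1 : ℚ) 0 := by
      funext k
      rw [map_act, hφc', hφg, act_one]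
    rw [e, (hPQ.2.2.2 1 0).1] at h3
    norm_num at h3

theorem pv_act_of {P : MvPolynomial (Fin 10) ℚ} {N : ℕ} {P0 : MvPolynomial (Fin 10) ℤ}
    (h : (N : MvPolynomial (Fin 10) ℚ) * P = map (Int.castRingHom ℚ) P0) (n : ℕ)
    (hg : aeval (act (genG ℚ) (genC ℚ)) P
      = (genG ℚ).det ^ n
        * aeval (genC ℚ) P)
    {K : Type*} [CommRing K] (g : Matrix (Fin 3) (Fin 3) K) (c : Fin 10 → K) :
    pv P0 (act g c) = g.det ^ n * pv P0 c := by
  have h1 : pv P0 (act (genG ℤ) (genC ℤ))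
      = (genG ℤ).det ^ n
        * pv P0 (genC ℤ) := by
    apply map_injective (Int.castRingHom ℚ) (Int.castRingHom ℚ).injective_int
    have e1 := pv_eq_of_map h (act (genG ℚ) (genC ℚ))
    have e2 := pv_eq_of_map h (genC ℚ)
    have e4 : (fun k => map (Int.castRingHom ℚ) (genC ℤ k)) = genC ℚ := by
      funext k; simp [genC]
    have e3 : (genG ℤ).map (map (Int.castRingHom ℚ)) = genG ℚ := by
      ext1 i j
      simp [genG]
    rw [map_mul, map_pow, map_pv, map_pv, RingHom.map_det, RingHom.mapMatrix_apply, e3]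
    simp only [map_act]
    rw [e3, e4, e1, e2, hg]
    ring
  have h2 := congrArg (eval₂Hom (Int.castRingHom K) (Sum.elim c (fun ij => g ij.1 ij.2))) h1
  have e4 : (fun k => eval₂Hom (Int.castRingHom K) (Sum.elim c (fun ij => g ij.1 ij.2))
      (genC ℤ k)) = c := by
    funext k; simp [genC]
  have e3 : (genG ℤ).map (eval₂Hom (Int.castRingHom K) (Sum.elim c (fun ij => g ij.1 ij.2)))
        = g := by
    ext1 i j
    simp [genG]
  rw [map_mul, map_pow, map_pv, map_pv, RingHom.map_det, RingHom.mapMatrix_apply, e3] at h2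
  simp only [map_act] at h2
  rw [e3, e4] at h2
  exact h2

theorem pv_w_of (P0 : MvPolynomial (Fin 10) ℤ) (a b : ℤ)
    (h : ∀ A B : ℚ, pv P0 (wcoeffs A B) = a * A + b * B) 
    {K : Type*} [CommRing K] (A B : K) : pv P0 (wcoeffs A B) = a * A + b * B := by
  have h1 : pv P0 (wcoeffs (X 0) (X 1) : Fin 10 → MvPolynomial (Fin 2) ℤ)
      = (a : MvPolynomial (Fin 2) ℤ) * X 0 + (b : MvPolynomial (Fin 2) ℤ) * X 1 := by
    apply MvPolynomial.funext
    intro x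
    rw [map_pv, map_wcoeffs]
    simp only [map_add, map_mul, eval_X, map_intCast]
    have h2 := h (x 0) (x 1)
    have h3 := map_pv (Int.castRingHom ℚ) P0 (wcoeffs (x 0) (x 1))
    rw [map_wcoeffs] at h3
    simp only [eq_intCast] at h3
    rw [h2] at h3
    exact_mod_cast h3
  have h2 := congrArg (eval₂Hom (Int.castRingHom K) ![A, B]) h1
  rw [map_pv, map_wcoeffs, map_add, map_mul, map_mul, map_intCast, map_intCast, eval₂Hom_X',
    eval₂Hom_X'] at h2
  simpa using h2

theorem exists_invData {P Q : MvPolynomial (Fin 10) ℚ} (hPQ : IsInvariantPair ℚ P Q) :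
    Nonempty (InvData P Q) := by
  obtain ⟨N1, P1, hN1, h1⟩ := exists_int_mul P
  obtain ⟨N2, Q1, hN2, h2⟩ := exists_int_mul Q
  have hP : ((N1 * N2 : ℕ) : MvPolynomial (Fin 10) ℚ) * P = map (Int.castRingHom ℚ) ((N2 : MvPolynomial (Fin 10) ℤ) * P1) := by
    rw [map_mul, ← h1, map_natCast]; push_cast; ring
  have hQ : ((N1 * N2 : ℕ) : MvPolynomial (Fin 10) ℚ) * Q = map (Int.castRingHom ℚ) ((N1 : MvPolynomial (Fin 10) ℤ) * Q1) := by
    rw [map_mul, ← h2, map_natCast]; push_cast; ring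
  obtain ⟨g1, g2⟩ := inv_act_generic hPQ
  refine ⟨⟨N1 * N2, N2 * P1, N1 * Q1, by positivity, fun S _ _ c => pv_eq_of_map hP c,
    fun S _ _ c => pv_eq_of_map hQ c, fun K _ g c => pv_act_of hP 4 g1 g c,
    fun K _ g c => pv_act_of hQ 6 g2 g c, fun K _ t c => pv_smul (homog_of_map hPQ.1 hP) t c,
    fun K _ t c => pv_smul (homog_of_map hPQ.2.1 hQ) t c, ?_, ?_, fun S _ _ c => hc_hc_eq hPQ c⟩⟩
  · intro K _ A B
    have := pv_w_of (N2 * P1) (-3 * (N1 * N2 : ℕ)) 0 (fun A B => by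
      rw [pv_eq_of_map hP, (hPQ.2.2.2 A B).1]; push_cast; ring) A B
    rw [this]; push_cast; ring
  · intro K _ A B
    have := pv_w_of (N1 * Q1) 0 (-27 * (N1 * N2 : ℕ)) (fun A B => by
      rw [pv_eq_of_map hQ, (hPQ.2.2.2 A B).2]; push_cast; ring) A B
    rw [this]; push_cast; ring

/-! ## The null cone -/

/-- The variable `x` does not occur. -/
def NoX {R : Type*} [CommRing R] (h : Fin 10 → R) : Prop :=
  h 0 = 0 ∧ h 3 = 0 ∧ h 4 = 0 ∧ h 5 = 0 ∧ h 7 = 0 ∧ h 9 = 0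

/-- The variable `z` does not occur. -/
def NoZ {R : Type*} [CommRing R] (h : Fin 10 → R) : Prop :=
  h 2 = 0 ∧ h 4 = 0 ∧ h 6 = 0 ∧ h 7 = 0 ∧ h 8 = 0 ∧ h 9 = 0

theorem NoX.act {R : Type*} [CommRing R] {h : Fin 10 → R} (hh : NoX h)
    (g : Matrix (Fin 3) (Fin 3) R) (h1 : g 0 1 = 0) (h2 : g 0 2 = 0) : NoX (act g h) := by
  obtain ⟨e0, e3, e4, e5, e7, e9⟩ := hh
  refine ⟨?_, ?_, ?_, ?_, ?_, ?_⟩ <;>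
  simp [_root_.act, ev, dv, tv, e0, e3, e4, e5, e7, e9, h1, h2]

/-- Lower triangular unipotent matrices. -/
def mU {R : Type*} [CommRing R] (k k' k'' : R) : Matrix (Fin 3) (Fin 3) R :=
  !![1, 0, 0; k, 1, 0; k', k'', 1]

/-- The swap of the last two coordinates (with a sign). -/
def mS (R : Type*) [CommRing R] : Matrix (Fin 3) (Fin 3) R :=
  !![1, 0, 0; 0, 0, 1; 0, -1, 0]

/-- A cyclic permutation. -/
def mC (R : Type*) [CommRing R] : Matrix (Fin 3) (Fin 3) R :=
  !![0, 0, 1; 1, 0, 0; 0, 1, 0]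

theorem det_mU {R : Type*} [CommRing R] (k k' k'' : R) : (mU k k' k'').det = 1 := by
  simp [mU, Matrix.det_fin_three]

theorem det_mS (R : Type*) [CommRing R] : (mS R).det = 1 := by
  simp [mS, Matrix.det_fin_three]

theorem det_mC (R : Type*) [CommRing R] : (mC R).det = 1 := by
  simp [mC, Matrix.det_fin_three]

theorem act_mU {R : Type*} [CommRing R] (k k' k'' : R) (c : Fin 10 → R) :
    act (mU k k' k'') c = ![c 0,
      c 1 + c 0 * k ^ 3 + c 3 * k ^ 2 + c 5 * k,
      c 2 + c 0 * k' ^ 3 + c 1 * k'' ^ 3 + c 3 * k' ^ 2 * k'' + c 4 * k' ^ 2 + c 5 * k' * k'' ^ 2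
        + c 6 * k'' ^ 2 + c 7 * k' + c 8 * k'' + c 9 * k' * k'',
      c 3 + 3 * c 0 * k,
      c 4 + 3 * c 0 * k' + c 3 * k'',
      c 5 + 3 * c 0 * k ^ 2 + 2 * c 3 * k,
      c 6 + 3 * c 0 * k ^ 2 * k' + 3 * c 1 * k'' + c 3 * (2 * k * k' + k ^ 2 * k'') + c 4 * k ^ 2
        + c 5 * (k' + 2 * k * k'') + c 9 * k,
      c 7 + 3 * c 0 * k' ^ 2 + 2 * c 3 * k' * k'' + 2 * c 4 * k' + c 5 * k'' ^ 2 + c 9 * k'',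
      c 8 + 3 * c 0 * k' ^ 2 * k + 3 * c 1 * k'' ^ 2 + c 3 * (2 * k' * k'' * k + k' ^ 2)
        + 2 * c 4 * k' * k + c 5 * (k * k'' ^ 2 + 2 * k' * k'') + 2 * c 6 * k'' + c 7 * k
        + c 9 * (k * k'' + k'),
      c 9 + 6 * c 0 * k * k' + 2 * c 3 * (k' + k * k'') + 2 * c 4 * k + 2 * c 5 * k''] := by
  funext i
  fin_cases i <;> simp [act, ev, dv, tv, mU] <;> ring

theorem act_mS {R : Type*} [CommRing R] (c : Fin 10 → R) :
    act (mS R) c = ![c 0, c 2, - c 1, c 4, - c 3, c 7, -c 8, c 5, c 6, - c 9] := by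
  funext i
  fin_cases i <;> simp [act, ev, dv, tv, mS] <;> ring

theorem act_mC {R : Type*} [CommRing R] (c : Fin 10 → R) :
    act (mC R) c = ![c 2, c 0, c 1, c 7, c 8, c 4, c 3, c 6, c 5, c 9] := by
  funext i
  fin_cases i <;> simp [act, ev, dv, tv, mC]

section
variable {K : Type*} [Field K] [CharZero K]

/-- If `q = c5 y² + c9 yz + c7 z²` is degenerate, move it to a multiple of `y²`. -/
theorem exists_rot (c : Fin 10 → K) (h : 4 * c 5 * c 7 = c 9 ^ 2) (h3 : c 3 = 0) (h4 : c 4 = 0) :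
    ∃ g : Matrix (Fin 3) (Fin 3) K, g.det = 1 ∧ g 0 1 = 0 ∧ g 0 2 = 0 ∧ act g c 0 = c 0 ∧
      act g c 3 = 0 ∧ act g c 4 = 0 ∧ act g c 7 = 0 ∧ act g c 9 = 0 := by
  by_cases h5 : c 5 = 0
  · have h9 : c 9 = 0 := by rw [h5] at h; simpa using h.symm
    refine ⟨mS K, det_mS K, by simp [mS], by simp [mS], ?_⟩
    rw [act_mS]
    simp [h3, h4, h5, h9]
  · refine ⟨mU 0 0 (-(c 9 / (2 * c 5))), det_mU _ _ _, by simp [mU], by simp [mU], ?_⟩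
    rw [act_mU]
    simp [h3, h4]
    constructor
    · field_simp
      linear_combination h
    · field_simp
      ring

theorem exists_noZ_of_c0 (c : Fin 10 → K) (h0 : c 0 ≠ 0) (hX : NoX (hc c)) :
    ∃ g : Matrix (Fin 3) (Fin 3) K, g.det = 1 ∧ NoZ (act g c) := by
  -- first kill `c 3` and `c 4`
  obtain ⟨d, g1, hg1, hd, d0, d3, d4, dX⟩ : ∃ (d : Fin 10 → K) (g : Matrix (Fin 3) (Fin 3) K),
      g.det = 1 ∧ act g c = d ∧ d 0 ≠ 0 ∧ d 3 = 0 ∧ d 4 = 0 ∧ NoX (hc d) := by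
    refine ⟨_, mU (-(c 3 / (3 * c 0))) (-(c 4 / (3 * c 0))) 0, det_mU _ _ _, rfl, ?_, ?_, ?_, ?_⟩
    · rw [act_mU]; simpa using h0
    · rw [act_mU]; simp; field_simp; ring
    · rw [act_mU]; simp; field_simp; ring
    · rw [hc_act, det_mU, one_pow, one_smul]
      exact hX.act _ (by simp [mU]) (by simp [mU])
  obtain ⟨e, g2, hg2, he, e0, e3, e4, e7, e9, eX⟩ : ∃ (e : Fin 10 → K)
      (g : Matrix (Fin 3) (Fin 3) K),
      g.det = 1 ∧ act g d = e ∧ e 0 ≠ 0 ∧ e 3 = 0 ∧ e 4 = 0 ∧ e 7 = 0 ∧ e 9 = 0 ∧ NoX (hc e) := by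
    have hq : 4 * d 5 * d 7 = d 9 ^ 2 := by
      have h := dX.1
      simp [hc, d3, d4] at h
      have : d 0 * (4 * d 5 * d 7 - d 9 ^ 2) = 0 := by linear_combination h / 6
      exact sub_eq_zero.mp ((mul_eq_zero.mp this).resolve_left d0)
    obtain ⟨g, hg, h1, h2, e0, e3, e4, e7, e9⟩ := exists_rot d hq d3 d4
    refine ⟨_, g, hg, rfl, by rwa [e0], e3, e4, e7, e9, ?_⟩
    rw [hc_act, hg, one_pow, one_smul]
    exact dX.act _ h1 h2
  obtain ⟨g3, hg3, hZ⟩ : ∃ g : Matrix (Fin 3) (Fin 3) K, g.det = 1 ∧ NoZ (act g e) := by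
    obtain ⟨x0, x3, x4, x5, x7, x9⟩ := eX
    simp [hc, e3, e4, e7, e9, e0] at x3 x4 x5 x7 x9
    by_cases e5 : e 5 = 0
    · have y5 : 3 * e 1 * e 8 = e 6 ^ 2 := by
        have : e 0 * (3 * e 1 * e 8 - e 6 ^ 2) = 0 := by linear_combination x5 / 24
        exact sub_eq_zero.mp ((mul_eq_zero.mp this).resolve_left e0)
      have y7 : 3 * e 2 * e 6 = e 8 ^ 2 := by
        have : e 0 * (3 * e 2 * e 6 - e 8 ^ 2) = 0 := by linear_combination x7 / 24
        exact sub_eq_zero.mp ((mul_eq_zero.mp this).resolve_left e0)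
      have y9 : 9 * e 1 * e 2 = e 6 * e 8 := by
        have : e 0 * (9 * e 1 * e 2 - e 6 * e 8) = 0 := by linear_combination x9 / 24
        exact sub_eq_zero.mp ((mul_eq_zero.mp this).resolve_left e0)
      by_cases e1 : e 1 = 0
      · have z6 : e 6 = 0 := by rw [e1] at y5; simpa using y5.symm
        have z8 : e 8 = 0 := by rw [z6] at y7; simpa using y7.symm
        refine ⟨mS K, det_mS K, ?_⟩
        rw [act_mS]
        simp [NoZ, e1, z6, z8, e3, e5, e9]
      · refine ⟨mU 0 0 (-(e 6 / (3 * e 1))), det_mU _ _ _, ?_⟩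
        rw [act_mU]
        simp [NoZ, e3, e4, e5, e7, e9]
        refine ⟨?_, ?_, ?_⟩
        · field_simp
          linear_combination 3 * e 1 * y9 - 2 * e 6 * y5
        · field_simp; ring
        · field_simp; linear_combination y5
    · have z2 : e 2 = 0 := by simpa [e5] using x4
      have z8 : e 8 = 0 := by simpa [e5] using x3
      have z6 : e 6 = 0 := by simpa [z8, e0] using x5
      refine ⟨1, Matrix.det_one, ?_⟩
      rw [act_one]
      exact ⟨z2, e4, z6, e7, z8, e9⟩
  refine ⟨g3 * (g2 * g1), by simp [hg1, hg2, hg3], ?_⟩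
  rw [← act_mul, ← act_mul, hd, he]
  exact hZ

theorem exists_row (v : Fin 3 → K) (hv : v ≠ 0) :
    ∃ g : Matrix (Fin 3) (Fin 3) K, g.det = 1 ∧ g 0 = v := by
  have hv' : v = ![v 0, v 1, v 2] := by
    funext i; fin_cases i <;> rfl
  by_cases h0 : v 0 = 0
  · by_cases h1 : v 1 = 0
    · have h2 : v 2 ≠ 0 := by
        intro h2
        apply hv
        funext i; fin_cases i <;> simp [h0, h1, h2]
      refine ⟨!![v 0, v 1, v 2; 0, 1, 0; -(1 / v 2), 0, 0], ?_, ?_⟩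
      · simp [Matrix.det_fin_three, h2]
      · conv_rhs => rw [hv']
        rfl
    · refine ⟨!![v 0, v 1, v 2; -(1 / v 1), 0, 0; 0, 0, 1], ?_, ?_⟩
      · simp [Matrix.det_fin_three, h1]
      · conv_rhs => rw [hv']
        rfl
  · refine ⟨!![v 0, v 1, v 2; 0, 1 / v 0, 0; 0, 0, 1], ?_, ?_⟩
    · simp [Matrix.det_fin_three, h0]
    · conv_rhs => rw [hv']
      rfl

theorem exists_ev_ne (c : Fin 10 → K) (h : c ≠ 0) : ∃ v : Fin 3 → K, ev c v ≠ 0 := by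
  by_contra! hv
  apply h
  apply cubic_inj
  apply MvPolynomial.funext
  intro x
  rw [cubic_eq_ev, cubic_eq_ev, map_ev, map_ev]
  simp only [eval_C, eval_X]
  rw [hv x]
  simp [ev]

theorem exists_noZ_of_hc (c : Fin 10 → K) (h : hc c = 0) :
    ∃ g : Matrix (Fin 3) (Fin 3) K, g.det = 1 ∧ NoZ (act g c) := by
  by_cases h0 : c = 0
  · refine ⟨1, Matrix.det_one, ?_⟩
    rw [act_one, h0]
    simp [NoZ]
  obtain ⟨v, hv⟩ := exists_ev_ne c h0
  have hv0 : v ≠ 0 := by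
    rintro rfl
    simp [ev] at hv
  obtain ⟨g, hg, hgv⟩ := exists_row v hv0
  obtain ⟨g', hg', hZ⟩ := exists_noZ_of_c0 (act g c) (by
    show ev c (g 0) ≠ 0
    rwa [hgv]) (by
    rw [hc_act, h]
    have : act g (0 : Fin 10 → K) = 0 := by simpa using act_smul g (0 : K) 0
    rw [this]
    simp [NoX])
  refine ⟨g' * g, by simp [hg, hg'], ?_⟩
  rw [← act_mul]
  exact hZ

/-- The three types of unstable normal forms. -/
def UForm (c : Fin 10 → K) : Prop :=
  NoZ c ∨ (c 0 = 0 ∧ c 2 = 0 ∧ c 4 = 0 ∧ c 5 = 0 ∧ c 7 = 0 ∧ c 8 = 0 ∧ c 9 = 0) ∨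
    (c 0 = 0 ∧ c 3 = 0 ∧ c 4 = 0 ∧ c 7 = 0 ∧ c 9 = 0)

theorem exists_uform_of_noX (c : Fin 10 → K) (hX : NoX (hc c)) :
    ∃ g : Matrix (Fin 3) (Fin 3) K, g.det = 1 ∧ UForm (act g c) := by
  by_cases h0 : c 0 = 0
  · by_cases h34 : c 3 = 0 ∧ c 4 = 0
    · obtain ⟨h3, h4⟩ := h34
      have hq : 4 * c 5 * c 7 = c 9 ^ 2 := by
        obtain ⟨x0, x3, x4, x5, x7, x9⟩ := hX
        simp [hc, h3, h4, h0] at x5 x7 x9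
        by_contra hne
        have hne' : 4 * c 5 * c 7 - c 9 ^ 2 ≠ 0 := sub_ne_zero.mpr hne
        have y5 : c 5 = 0 := by
          have : (4 * c 5 * c 7 - c 9 ^ 2) * c 5 = 0 := by linear_combination - x5 / 2
          exact (mul_eq_zero.mp this).resolve_left hne'
        have y9 : c 9 = 0 := by
          have : (4 * c 5 * c 7 - c 9 ^ 2) * c 9 = 0 := by linear_combination - x9 / 2
          exact (mul_eq_zero.mp this).resolve_left hne'
        apply hne
        rw [y5, y9]; ring
      obtain ⟨g, hg, h1, h2, e0, e3, e4, e7, e9⟩ := exists_rot c hq h3 h4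
      exact ⟨g, hg, Or.inr (Or.inr ⟨by rw [e0, h0], e3, e4, e7, e9⟩)⟩
    · obtain ⟨d, g1, hg1, hd, d0, d3, d4, dX⟩ : ∃ (d : Fin 10 → K) (g : Matrix (Fin 3) (Fin 3) K),
          g.det = 1 ∧ act g c = d ∧ d 0 = 0 ∧ d 3 ≠ 0 ∧ d 4 = 0 ∧ NoX (hc d) := by
        by_cases h3 : c 3 = 0
        · have h4 : c 4 ≠ 0 := fun h4 => h34 ⟨h3, h4⟩
          refine ⟨_, mS K, det_mS K, rfl, ?_, ?_, ?_, ?_⟩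
          · rw [act_mS]; simpa using h0
          · rw [act_mS]; simpa using h4
          · rw [act_mS]; simpa using h3
          · rw [hc_act, det_mS, one_pow, one_smul]
            exact hX.act _ (by simp [mS]) (by simp [mS])
        · refine ⟨_, mU 0 0 (-(c 4 / c 3)), det_mU _ _ _, rfl, ?_, ?_, ?_, ?_⟩
          · rw [act_mU]; simpa using h0
          · rw [act_mU]; simpa using h3
          · rw [act_mU]; simp; field_simp; ring
          · rw [hc_act, det_mU, one_pow, one_smul]
            exact hX.act _ (by simp [mU]) (by simp [mU])
      obtain ⟨e, g2, hg2, he, e0, e3, e4, e5, e9, eX⟩ : ∃ (e : Fin 10 → K)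
          (g : Matrix (Fin 3) (Fin 3) K), g.det = 1 ∧ act g d = e ∧ e 0 = 0 ∧ e 3 ≠ 0 ∧ e 4 = 0 ∧
          e 5 = 0 ∧ e 9 = 0 ∧ NoX (hc e) := by
        refine ⟨_, mU (-(d 5 / (2 * d 3))) (-(d 9 / (2 * d 3))) 0, det_mU _ _ _, rfl,
          ?_, ?_, ?_, ?_, ?_, ?_⟩
        · rw [act_mU]; simpa using d0
        · rw [act_mU]; simpa [d0] using d3
        · rw [act_mU]; simp [d0, d4]
        · rw [act_mU]; simp [d0]; field_simp; ring
        · rw [act_mU]; simp [d0, d4]; field_simp; ring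
        · rw [hc_act, det_mU, one_pow, one_smul]
          exact dX.act _ (by simp [mU]) (by simp [mU])
      refine ⟨g2 * g1, by simp [hg1, hg2], ?_⟩
      rw [← act_mul, hd, he]
      obtain ⟨x0, x3, x4, x5, x7, x9⟩ := eX
      simp [hc, e0, e3, e4, e5, e9] at x0 x3 x4
      refine Or.inr (Or.inl ⟨e0, ?_, e4, e5, ?_, ?_, e9⟩)
      · simpa [e3] using x4
      · simpa [e3] using x0
      · simpa [e3] using x3
  · obtain ⟨g, hg, hZ⟩ := exists_noZ_of_c0 c h0 hX
    exact ⟨g, hg, Or.inl hZ⟩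

theorem exists_uform (c : Fin 10 → K) (h : hc (hc c) = 0) :
    ∃ g : Matrix (Fin 3) (Fin 3) K, g.det = 1 ∧ UForm (act g c) := by
  obtain ⟨g, hg, hZ⟩ := exists_noZ_of_hc (hc c) h
  obtain ⟨g', hg', hU⟩ := exists_uform_of_noX (act (mC K * g) c) (by
    rw [hc_act, ← act_mul, act_mC]
    obtain ⟨z2, z4, z6, z7, z8, z9⟩ := hZ
    simp [NoX, det_mC, hg, z2, z4, z6, z7, z8, z9])
  refine ⟨g' * (mC K * g), by simp [hg, hg', det_mC], ?_⟩
  rw [← act_mul]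
  exact hU

end

/-! ## Real reduction -/

/-- Diagonal matrices. -/
def mD {R : Type*} [CommRing R] (a b c : R) : Matrix (Fin 3) (Fin 3) R :=
  !![a, 0, 0; 0, b, 0; 0, 0, c]

theorem det_mD {R : Type*} [CommRing R] (a b c : R) : (mD a b c).det = a * b * c := by
  simp [mD, Matrix.det_fin_three]

theorem act_mD {R : Type*} [CommRing R] (r s t : R) (c : Fin 10 → R) :
    act (mD r s t) c = ![c 0 * r ^ 3, c 1 * s ^ 3, c 2 * t ^ 3, c 3 * (r ^ 2 * s),
      c 4 * (r ^ 2 * t), c 5 * (r * s ^ 2), c 6 * (s ^ 2 * t), c 7 * (r * t ^ 2),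
      c 8 * (s * t ^ 2), c 9 * (r * s * t)] := by
  funext i
  fin_cases i <;> simp [act, ev, dv, tv, mD] <;> ring

theorem unst_of_scale (c : Fin 10 → ℝ)
    (h : ∀ s : ℝ, 0 < s → s < 1 → ∃ g : Matrix (Fin 3) (Fin 3) ℝ, g.det = 1 ∧
      ∀ k, |act g c k| ≤ s * |c k|) (ε : ℝ) (hε : 0 < ε) :
    ∃ g : Matrix (Fin 3) (Fin 3) ℝ, g.det = 1 ∧ ‖act g c‖ < ε := by
  obtain ⟨s, hs0, hs1, hs⟩ : ∃ s : ℝ, 0 < s ∧ s < 1 ∧ s * ‖c‖ < ε := by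
    refine ⟨min (1 / 2) (ε / (2 * (‖c‖ + 1))), by positivity, ?_, ?_⟩
    · exact (min_le_left _ _).trans_lt (by norm_num)
    · calc min (1 / 2) (ε / (2 * (‖c‖ + 1))) * ‖c‖ ≤ ε / (2 * (‖c‖ + 1)) * ‖c‖ := by
            gcongr; exact min_le_right _ _
        _ < ε := by
            rw [div_mul_eq_mul_div, div_lt_iff₀ (by positivity)]
            nlinarith [norm_nonneg c]
  obtain ⟨g, hg, hk⟩ := h s hs0 hs1
  refine ⟨g, hg, lt_of_le_of_lt ?_ hs⟩
  rw [pi_norm_le_iff_of_nonneg (by positivity)]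
  intro k
  refine (hk k).trans ?_
  gcongr
  exact norm_le_pi_norm c k

theorem unst_of_uform (c : Fin 10 → ℝ) (h : UForm c) (ε : ℝ) (hε : 0 < ε) :
    ∃ g : Matrix (Fin 3) (Fin 3) ℝ, g.det = 1 ∧ ‖act g c‖ < ε := by
  have key : ∀ (s x y : ℝ), 0 < s → 0 ≤ y → y ≤ s → |x * y| ≤ s * |x| := by
    intro s x y hs hy hys
    rw [abs_mul, abs_of_nonneg hy, mul_comm]
    gcongr
  have pw : ∀ (s : ℝ) (n : ℕ), 0 < s → s < 1 → s ^ (n + 1) ≤ s := by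
    intro s n h0 h1
    exact pow_le_of_le_one h0.le h1.le (by omega)
  rcases h with h | h | h
  · refine unst_of_scale c (fun s h0 h1 => ⟨mD s s (s⁻¹ ^ 2), ?_, ?_⟩) ε hε
    · rw [det_mD]; field_simp
    · obtain ⟨z2, z4, z6, z7, z8, z9⟩ := h
      intro k
      rw [act_mD]
      fin_cases k <;> simp only [Fin.zero_eta, Fin.mk_one, Fin.reduceFinMk, Matrix.cons_val, z2, z4, z6, z7, z8, z9, zero_mul, abs_zero, mul_zero, le_refl]
      · exact key _ _ _ h0 (by positivity) (pw s 2 h0 h1)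
      · exact key _ _ _ h0 (by positivity) (pw s 2 h0 h1)
      · exact key _ _ _ h0 (by positivity) ((by ring : s ^ 2 * s = s ^ 3).trans_le (pw s 2 h0 h1))
      · exact key _ _ _ h0 (by positivity) ((by ring : s * s ^ 2 = s ^ 3).trans_le (pw s 2 h0 h1))
  · refine unst_of_scale c (fun s h0 h1 => ⟨mD s⁻¹ (s ^ 3) (s⁻¹ ^ 2), ?_, ?_⟩) ε hε
    · rw [det_mD]; field_simp
    · obtain ⟨z0, z2, z4, z5, z7, z8, z9⟩ := h
      intro k
      rw [act_mD]
      fin_cases k <;> simp only [Fin.zero_eta, Fin.mk_one, Fin.reduceFinMk, Matrix.cons_val, z0, z2, z4, z5, z7, z8, z9, zero_mul, abs_zero, mul_zero, le_refl]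
      · exact key _ _ _ h0 (by positivity) ((by ring : (s ^ 3) ^ 3 = s ^ 9).trans_le (pw s 8 h0 h1))
      · exact key _ _ _ h0 (by positivity) (by field_simp; simp)
      · exact key _ _ _ h0 (by positivity)
          ((by field_simp : (s ^ 3) ^ 2 * s⁻¹ ^ 2 = s ^ 4).trans_le (pw s 3 h0 h1))
  · refine unst_of_scale c (fun s h0 h1 => ⟨mD (s⁻¹ ^ 3) (s ^ 2) s, ?_, ?_⟩) ε hε
    · rw [det_mD]; field_simp
    · obtain ⟨z0, z3, z4, z7, z9⟩ := h
      intro k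
      rw [act_mD]
      fin_cases k <;> simp only [Fin.zero_eta, Fin.mk_one, Fin.reduceFinMk, Matrix.cons_val, z0, z3, z4, z7, z9, zero_mul, abs_zero, mul_zero, le_refl]
      · exact key _ _ _ h0 (by positivity) ((by ring : (s ^ 2) ^ 3 = s ^ 6).trans_le (pw s 5 h0 h1))
      · exact key _ _ _ h0 (by positivity) (pw s 2 h0 h1)
      · exact key _ _ _ h0 (by positivity)
          ((by field_simp : s⁻¹ ^ 3 * (s ^ 2) ^ 2 = s).trans_le le_rfl)
      · exact key _ _ _ h0 (by positivity) ((by ring : (s ^ 2) ^ 2 * s = s ^ 5).trans_le (pw s 4 h0 h1))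
      · exact key _ _ _ h0 (by positivity) ((by ring : s ^ 2 * s ^ 2 = s ^ 4).trans_le (pw s 3 h0 h1))

theorem unst_of_inv_zero {P Q : MvPolynomial (Fin 10) ℚ} (D : InvData P Q) (c : Fin 10 → ℝ)
    (h1 : pv D.P0 c = 0) (h2 : pv D.Q0 c = 0) (ε : ℝ) (hε : 0 < ε) :
    ∃ g : Matrix (Fin 3) (Fin 3) ℝ, g.det = 1 ∧ ‖act g c‖ < ε := by
  have hN : (D.N : ℝ) ≠ 0 := by exact_mod_cast D.hN.ne'
  rw [D.hP ℝ c] at h1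
  rw [D.hQ ℝ c] at h2
  have h1' := (mul_eq_zero.mp h1).resolve_left hN
  have h2' := (mul_eq_zero.mp h2).resolve_left hN
  have h3 := D.hh ℝ c
  rw [h1', h2'] at h3
  obtain ⟨g, hg, hU⟩ := exists_uform c (by rw [h3]; simp)
  obtain ⟨g', hg', h⟩ := unst_of_uform _ hU ε hε
  refine ⟨g' * g, by simp [hg, hg'], ?_⟩
  rwa [← act_mul]

theorem continuous_act (g : Matrix (Fin 3) (Fin 3) ℝ) : Continuous (act g : (Fin 10 → ℝ) → _) := by
  let L : (Fin 10 → ℝ) →ₗ[ℝ] (Fin 10 → ℝ) :=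
    { toFun := act g, map_add' := act_add g, map_smul' := fun t c => act_smul g t c }
  exact L.continuous_of_finiteDimensional

theorem continuous_pv (P : MvPolynomial (Fin 10) ℤ) : Continuous (pv P : (Fin 10 → ℝ) → ℝ) := by
  have : (pv P : (Fin 10 → ℝ) → ℝ) = fun c => eval c (map (Int.castRingHom ℝ) P) := by
    funext c
    rw [pv, eval_map]
  rw [this]
  exact MvPolynomial.continuous_eval _

theorem real_reduction {P Q : MvPolynomial (Fin 10) ℚ} (D : InvData P Q) :
    ∃ C : ℝ, 0 < C ∧ ∀ (c : Fin 10 → ℝ) (Y : ℝ), 0 < Y → |pv D.P0 c| ≤ D.N * Y ^ 4 →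
      |pv D.Q0 c| ≤ D.N * Y ^ 6 →
      ∃ g : Matrix (Fin 3) (Fin 3) ℝ, g.det = 1 ∧ ‖act g c‖ ≤ C * Y := by
  let K : Set (Fin 10 → ℝ) := {f | ‖f‖ = 1 ∧ ∀ g : Matrix (Fin 3) (Fin 3) ℝ, g.det = 1 →
    1 / 2 ≤ ‖act g f‖}
  have hK : IsCompact K := by
    apply IsCompact.of_isClosed_subset (isCompact_sphere (0 : Fin 10 → ℝ) 1)
    · have : K = {f | ‖f‖ = 1} ∩ ⋂ (g : Matrix (Fin 3) (Fin 3) ℝ) (_ : g.det = 1),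
          {f | 1 / 2 ≤ ‖act g f‖} := by
        ext f; simp [K]
      rw [this]
      apply IsClosed.inter
      · exact isClosed_eq continuous_norm continuous_const
      · refine isClosed_iInter fun g => isClosed_iInter fun _ => ?_
        exact isClosed_le continuous_const (continuous_act g).norm
    · intro f hf
      simpa using hf.1
  let Φ : (Fin 10 → ℝ) → ℝ := fun f => |pv D.P0 f| ^ 3 + |pv D.Q0 f| ^ 2
  have hΦ : Continuous Φ := by
    have h1 := continuous_pv D.P0
    have h2 := continuous_pv D.Q0
    fun_prop
  obtain ⟨δ, hδ0, hδ⟩ : ∃ δ : ℝ, 0 < δ ∧ ∀ f ∈ K, δ ≤ Φ f := by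
    apply hK.exists_forall_le' hΦ.continuousOn
    intro f hf
    by_contra hle
    have h0 : Φ f = 0 := le_antisymm (not_lt.mp hle) (by positivity)
    have e1 : |pv D.P0 f| ^ 3 = 0 := by
      have a1 : 0 ≤ |pv D.P0 f| ^ 3 := by positivity
      have a2 : 0 ≤ |pv D.Q0 f| ^ 2 := by positivity
      simp only [Φ] at h0
      linarith
    have e2 : |pv D.Q0 f| ^ 2 = 0 := by
      simp only [Φ] at h0
      linarith
    obtain ⟨g, hg, hlt⟩ := unst_of_inv_zero D f (by simpa using e1) (by simpa using e2) (1 / 2)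
      (by norm_num)
    exact absurd (hf.2 g hg) (not_le.mpr hlt)
  have hN : (0 : ℝ) < D.N := by exact_mod_cast D.hN
  set E : ℝ := ((D.N : ℝ) ^ 3 + (D.N : ℝ) ^ 2) / δ with hE
  have hE0 : 0 < E := by positivity
  refine ⟨1 + E, by positivity, ?_⟩
  intro c Y hY hP hQ
  by_contra! hcon
  let S : Set ℝ := {r | ∃ g : Matrix (Fin 3) (Fin 3) ℝ, g.det = 1 ∧ r = ‖act g c‖}
  have hSne : S.Nonempty := ⟨_, 1, Matrix.det_one, rfl⟩
  have hSlb : (1 + E) * Y ≤ sInf S := by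
    apply le_csInf hSne
    rintro r ⟨g, hg, rfl⟩
    exact (hcon g hg).le
  have hSbdd : BddBelow S := ⟨0, by rintro r ⟨g, hg, rfl⟩; positivity⟩
  have hm : 0 < sInf S := lt_of_lt_of_le (by positivity) hSlb
  obtain ⟨r, ⟨g, hg, rfl⟩, hr⟩ := exists_lt_of_csInf_lt hSne (by linarith : sInf S < 2 * sInf S)
  set ρ := ‖act g c‖ with hρ
  have hρ1 : (1 + E) * Y < ρ := hcon g hg
  have hρ0 : 0 < ρ := lt_trans (by positivity) hρ1
  have hf : ρ⁻¹ • act g c ∈ K := by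
    refine ⟨?_, ?_⟩
    · rw [norm_smul, norm_inv, Real.norm_of_nonneg hρ0.le, ← hρ, inv_mul_cancel₀ hρ0.ne']
    · intro h hh
      rw [act_smul, act_mul, norm_smul, norm_inv, Real.norm_of_nonneg hρ0.le]
      have : sInf S ≤ ‖act (h * g) c‖ := csInf_le hSbdd ⟨h * g, by simp [hh, hg], rfl⟩
      rw [le_inv_mul_iff₀ hρ0]
      linarith
  have h1 := hδ _ hf
  simp only [Φ] at h1
  rw [D.P_smul, D.Q_smul, D.P_act, D.Q_act, hg, one_pow, one_pow, one_mul, one_mul, abs_mul, abs_mul,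
    abs_of_pos (by positivity : 0 < ρ⁻¹ ^ 4), abs_of_pos (by positivity : 0 < ρ⁻¹ ^ 6)] at h1
  have h2 : (ρ⁻¹ ^ 4 * |pv D.P0 c|) ^ 3 + (ρ⁻¹ ^ 6 * |pv D.Q0 c|) ^ 2 ≤
      (ρ⁻¹ ^ 4 * (D.N * Y ^ 4)) ^ 3 + (ρ⁻¹ ^ 6 * (D.N * Y ^ 6)) ^ 2 := by gcongr
  have h3 : (ρ⁻¹ ^ 4 * (D.N * Y ^ 4)) ^ 3 + (ρ⁻¹ ^ 6 * (D.N * Y ^ 6)) ^ 2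
      = (E * δ) * (Y / ρ) ^ 12 := by
    rw [hE, div_mul_cancel₀ _ hδ0.ne', div_eq_mul_inv]; ring
  have h4 : δ ≤ (E * δ) * (Y / ρ) ^ 12 := (h1.trans h2).trans_eq h3
  have h5 : Y / ρ ≤ (1 + E)⁻¹ := by
    rw [div_le_iff₀ hρ0, le_inv_mul_iff₀ (by positivity)]
    exact hρ1.le
  have h6 : (Y / ρ) ^ 12 ≤ (1 + E)⁻¹ := by
    calc (Y / ρ) ^ 12 ≤ ((1 + E)⁻¹) ^ 12 := by gcongr
      _ ≤ (1 + E)⁻¹ := pow_le_of_le_one (by positivity) (inv_le_one_of_one_le₀ (by linarith))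
        (by norm_num)
  have h7 : δ ≤ (E * δ) * (1 + E)⁻¹ := h4.trans (by gcongr)
  rw [← div_eq_mul_inv, le_div_iff₀ (by positivity)] at h7
  nlinarith

/-! ## Lattice reduction in dimension three -/

/-- The inner product on triples. -/
def ip {R : Type*} [CommRing R] (x y : Fin 3 → R) : R := x 0 * y 0 + x 1 * y 1 + x 2 * y 2

/-- The cross product of triples. -/
def cr {R : Type*} [CommRing R] (x y : Fin 3 → R) : Fin 3 → R :=
  ![x 1 * y 2 - x 2 * y 1, x 2 * y 0 - x 0 * y 2, x 0 * y 1 - x 1 * y 0]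

/-- An integral row vector times a real matrix. -/
def zm (v : Fin 3 → ℤ) (M : Matrix (Fin 3) (Fin 3) ℝ) : Fin 3 → ℝ :=
  fun j => (v 0 : ℝ) * M 0 j + (v 1 : ℝ) * M 1 j + (v 2 : ℝ) * M 2 j

theorem abs_le_of_ip {x : Fin 3 → ℝ} {R : ℝ} (h : ip x x ≤ R ^ 2) (hR : 0 ≤ R) (i : Fin 3) :
    |x i| ≤ R := by
  apply abs_le_of_sq_le_sq _ hR
  unfold ip at h
  fin_cases i <;> simp <;> nlinarith [sq_nonneg (x 0), sq_nonneg (x 1), sq_nonneg (x 2)]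

theorem zm_finite (M : Matrix (Fin 3) (Fin 3) ℝ) (hM : M.det = 1) (R : ℝ) :
    {v : Fin 3 → ℤ | ip (zm v M) (zm v M) ≤ R}.Finite := by
  set m : ℝ := ∑ i, ∑ j, |M.adjugate i j| with hm
  have hmij : ∀ i j, |M.adjugate i j| ≤ m := by
    intro i j
    refine le_trans ?_ (Finset.single_le_sum (f := fun i => ∑ j, |M.adjugate i j|)
      (fun i _ => by positivity) (Finset.mem_univ i))
    exact Finset.single_le_sum (f := fun j => |M.adjugate i j|) (fun i _ => by positivity)
      (Finset.mem_univ j)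
  set B : ℤ := ⌈3 * ((|R| + 1) * m)⌉ with hB
  apply Set.Finite.subset (Set.Finite.pi' (fun _ : Fin 3 => Set.finite_Icc (-B) B))
  intro v hv i
  have hv' : ip (zm v M) (zm v M) ≤ (|R| + 1) ^ 2 := by
    have : R ≤ |R| := le_abs_self R
    have h2 : ip (zm v M) (zm v M) ≤ R := hv
    nlinarith [abs_nonneg R]
  have hb := fun l => abs_le_of_ip hv' (by positivity) l
  have h1 : (v i : ℝ) = zm v M 0 * M.adjugate 0 i + zm v M 1 * M.adjugate 1 i
      + zm v M 2 * M.adjugate 2 i := by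
    have hid : ∀ i : Fin 3, (v i : ℝ) = v 0 * (1 : Matrix (Fin 3) (Fin 3) ℝ) 0 i
        + v 1 * (1 : Matrix (Fin 3) (Fin 3) ℝ) 1 i + v 2 * (1 : Matrix (Fin 3) (Fin 3) ℝ) 2 i := by
      rw [Fin.forall_fin_succ, Fin.forall_fin_succ, Fin.forall_fin_succ]
      simp [Matrix.one_apply]
    have h2 := Matrix.mul_adjugate M
    rw [hM, one_smul] at h2
    have e : ∀ l, M l 0 * M.adjugate 0 i + M l 1 * M.adjugate 1 i + M l 2 * M.adjugate 2 i
        = (1 : Matrix (Fin 3) (Fin 3) ℝ) l i := by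
      intro l
      rw [← h2, Matrix.mul_apply, Fin.sum_univ_three]
    have e0 := e 0
    have e1 := e 1
    have e2 := e 2
    unfold zm
    rw [hid i]
    linear_combination -(v 0 : ℝ) * e0 - v 1 * e1 - v 2 * e2
  have h3 : |(v i : ℝ)| ≤ 3 * ((|R| + 1) * m) := by
    rw [h1]
    have t : ∀ l, |zm v M l * M.adjugate l i| ≤ (|R| + 1) * m := by
      intro l
      rw [abs_mul]
      exact mul_le_mul (hb l) (hmij l i) (abs_nonneg _) (by positivity)
    have t0 := t 0
    have t1 := t 1
    have t2 := t 2
    refine (abs_add_three _ _ _).trans ?_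
    linarith
  have h4 : |(v i : ℝ)| ≤ (B : ℝ) := h3.trans (Int.le_ceil _)
  rw [Set.mem_Icc, ← abs_le]
  exact_mod_cast h4

theorem zm_min {ι : Type*} (M : Matrix (Fin 3) (Fin 3) ℝ) (hM : M.det = 1) (T : Set ι)
    (hT : T.Nonempty) (φ : ι → Fin 3 → ℤ) :
    ∃ i ∈ T, ∀ j ∈ T, ip (zm (φ i) M) (zm (φ i) M) ≤ ip (zm (φ j) M) (zm (φ j) M) := by
  obtain ⟨i0, hi0⟩ := hT
  set R := ip (zm (φ i0) M) (zm (φ i0) M) with hR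
  have hfin : (φ '' T ∩ {v : Fin 3 → ℤ | ip (zm v M) (zm v M) ≤ R}).Finite :=
    (zm_finite M hM R).subset Set.inter_subset_right
  obtain ⟨v, ⟨⟨i, hi, rfl⟩, hv⟩, hmin⟩ := Set.exists_min_image _
    (fun v => ip (zm v M) (zm v M)) hfin ⟨φ i0, ⟨i0, hi0, rfl⟩, hR.ge⟩
  refine ⟨i, hi, fun j hj => ?_⟩
  by_cases hjR : ip (zm (φ j) M) (zm (φ j) M) ≤ R
  · exact hmin (φ j) ⟨⟨j, hj, rfl⟩, hjR⟩
  · exact (show ip (zm (φ i) M) (zm (φ i) M) ≤ R from hv).trans (not_le.mp hjR).le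

theorem cr_zm (u v : Fin 3 → ℤ) (M : Matrix (Fin 3) (Fin 3) ℝ) :
    zm (cr u v) M.adjugate.transpose = cr (zm u M) (zm v M) := by
  funext i
  rw [Matrix.adjugate_fin_three]
  fin_cases i <;> simp [zm, cr] <;> ring

theorem ip_cr (x y : Fin 3 → ℝ) :
    ip (cr x y) (cr x y) = ip x x * ip y y - ip x y ^ 2 := by
  simp [ip, cr]; ring

theorem gram_id (x y z : Fin 3 → ℝ) :
    (ip x x * ip y y - ip x y ^ 2) * (ip x x * ip z z - ip x z ^ 2)
      - (ip x x * ip y z - ip x y * ip x z) ^ 2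
    = ip x x * (ip (cr x y) z) ^ 2 := by
  simp [ip, cr]; ring

theorem two_round_le (E D : ℝ) (hD : 0 < D) : |2 * (E + (-(round (E / D)) : ℤ) * D)| ≤ D := by
  have h := abs_sub_round (E / D)
  have : 2 * (E + (-(round (E / D)) : ℤ) * D) = 2 * D * (E / D - round (E / D)) := by
    push_cast; field_simp; ring
  rw [this, abs_mul, abs_of_pos (by positivity : 0 < 2 * D)]
  nlinarith

theorem zm_mU0 (k k' k'' : ℤ) (γ : Matrix (Fin 3) (Fin 3) ℤ) (h : Matrix (Fin 3) (Fin 3) ℝ) :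
    zm ((mU k k' k'' * γ) 0) h = zm (γ 0) h := by
  funext j
  simp [zm, mU, Matrix.mul_apply, Fin.sum_univ_three]

theorem zm_mU1 (k k' k'' : ℤ) (γ : Matrix (Fin 3) (Fin 3) ℤ) (h : Matrix (Fin 3) (Fin 3) ℝ) :
    zm ((mU k k' k'' * γ) 1) h = fun j => zm (γ 1) h j + k * zm (γ 0) h j := by
  funext j
  simp [zm, mU, Matrix.mul_apply, Fin.sum_univ_three]; ring

theorem zm_mU2 (k k' k'' : ℤ) (γ : Matrix (Fin 3) (Fin 3) ℤ) (h : Matrix (Fin 3) (Fin 3) ℝ) :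
    zm ((mU k k' k'' * γ) 2) h =
      fun j => zm (γ 2) h j + k' * zm (γ 0) h j + k'' * zm (γ 1) h j := by
  funext j
  simp [zm, mU, Matrix.mul_apply, Fin.sum_univ_three]; ring

theorem row_mU0 (k k' k'' : ℤ) (γ : Matrix (Fin 3) (Fin 3) ℤ) : (mU k k' k'' * γ) 0 = γ 0 := by
  funext j
  rw [Matrix.mul_apply, Fin.sum_univ_three]
  simp [mU]

theorem row_mS0 (γ : Matrix (Fin 3) (Fin 3) ℤ) : (mS ℤ * γ) 0 = γ 0 := by
  funext j
  rw [Matrix.mul_apply, Fin.sum_univ_three]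
  simp [mS]

theorem row_mS1 (γ : Matrix (Fin 3) (Fin 3) ℤ) : (mS ℤ * γ) 1 = γ 2 := by
  funext j
  rw [Matrix.mul_apply, Fin.sum_univ_three]
  simp [mS]

/-- The swap of the first two coordinates (with a sign). -/
def mT : Matrix (Fin 3) (Fin 3) ℤ := !![0, 1, 0; -1, 0, 0; 0, 0, 1]

theorem det_mT : mT.det = 1 := by simp [mT, Matrix.det_fin_three]

theorem row_mT0 (γ : Matrix (Fin 3) (Fin 3) ℤ) : (mT * γ) 0 = γ 1 := by
  funext j
  rw [Matrix.mul_apply, Fin.sum_univ_three]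
  simp [mT]

theorem ip_pos_of_det {b : Matrix (Fin 3) (Fin 3) ℝ} (hb : b.det = 1) : 0 < ip (b 0) (b 0) := by
  by_contra h
  have h0 : ip (b 0) (b 0) ≤ 0 ^ 2 := by simpa using not_lt.mp h
  have h1 := fun i => abs_le_of_ip h0 le_rfl i
  have h2 : ∀ i, b 0 i = 0 := fun i => abs_eq_zero.mp (le_antisymm (h1 i) (abs_nonneg _))
  rw [Matrix.det_fin_three] at hb
  simp [h2] at hb

theorem det_eq_ip_cr (b : Matrix (Fin 3) (Fin 3) ℝ) : b.det = ip (cr (b 0) (b 1)) (b 2) := by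
  rw [Matrix.det_fin_three]
  simp [ip, cr]; ring

theorem sq4 {g a : ℝ} (h : |2 * g| ≤ a) : 4 * g ^ 2 ≤ a ^ 2 := by
  have := sq_le_sq' (abs_le.mp h).1 (abs_le.mp h).2
  linarith [show (2 * g) ^ 2 = 4 * g ^ 2 by ring]

theorem gram_num (a D g12 g22 g13 g33 e : ℝ) (ha0 : 0 < a) (hD0 : 0 < D)
    (q12 : 4 * g12 ^ 2 ≤ a ^ 2) (q13 : 4 * g13 ^ 2 ≤ a ^ 2) (qE : 4 * e ^ 2 ≤ D ^ 2)
    (hD' : a * g22 - g12 ^ 2 = D) (m1 : a ≤ g22) (m2 : D ≤ a * g33 - g13 ^ 2)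
    (hG : D * (a * g33 - g13 ^ 2) - e ^ 2 = a) :
    3 * a ^ 2 ≤ 4 * D ∧ 3 * D ^ 2 ≤ 4 * a ∧ a * g22 ≤ 4 / 3 * D ∧ g33 * D ≤ 2 := by
  have p1 : a * a ≤ a * g22 := by gcongr
  have p2 : D * D ≤ D * (a * g33 - g13 ^ 2) := by gcongr
  have i1 : 3 * a ^ 2 ≤ 4 * D := by nlinarith
  have i2 : 3 * D ^ 2 ≤ 4 * a := by nlinarith
  refine ⟨i1, i2, by linarith, ?_⟩
  have haD : a * D ≤ 16 / 9 := by
    have h1 : (3 * a ^ 2) * (3 * D ^ 2) ≤ (4 * D) * (4 * a) := by gcongr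
    have h2 : 0 < a * D := by positivity
    have h3 : (a * D) * (9 * (a * D)) ≤ (a * D) * 16 := by linarith
    have := le_of_mul_le_mul_left h3 h2
    linarith
  have h4 : D * (4 * g13 ^ 2) ≤ D * a ^ 2 := by gcongr
  have h5 : a * (a * D) ≤ a * (16 / 9) := by gcongr
  have h6 : a * (g33 * D) ≤ a * 2 := by nlinarith
  exact le_of_mul_le_mul_left h6 ha0

set_option maxHeartbeats 1000000 in
/-- A reduced basis: Gram matrix inequalities. -/
theorem gram_reduction (h : Matrix (Fin 3) (Fin 3) ℝ) (hh : h.det = 1) :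
    ∃ (γ : Matrix (Fin 3) (Fin 3) ℤ) (a D : ℝ), γ.det = 1 ∧ 0 < a ∧ 0 < D ∧
      3 * a ^ 2 ≤ 4 * D ∧ 3 * D ^ 2 ≤ 4 * a ∧
      ip ((γ.map (Int.cast : ℤ → ℝ) * h) 0) ((γ.map (Int.cast : ℤ → ℝ) * h) 0) = a ∧
      ip ((γ.map (Int.cast : ℤ → ℝ) * h) 1) ((γ.map (Int.cast : ℤ → ℝ) * h) 1) ≤ 4 / 3 * (D / a) ∧
      ip ((γ.map (Int.cast : ℤ → ℝ) * h) 2) ((γ.map (Int.cast : ℤ → ℝ) * h) 2) ≤ 2 / D := by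
  have hrow : ∀ (γ : Matrix (Fin 3) (Fin 3) ℤ) (i : Fin 3),
      (γ.map (Int.cast : ℤ → ℝ) * h) i = zm (γ i) h := by
    intro γ i
    funext j
    rw [Matrix.mul_apply, Fin.sum_univ_three]
    rfl
  have hdet : ∀ γ : Matrix (Fin 3) (Fin 3) ℤ, γ.det = 1 →
      (γ.map (Int.cast : ℤ → ℝ) * h).det = 1 := by
    intro γ hγ
    rw [Matrix.det_mul, hh, mul_one]
    have := (Int.castRingHom ℝ).map_det γ
    rw [hγ] at this
    simpa using this.symm
  have hadj : h.adjugate.transpose.det = 1 := by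
    rw [Matrix.det_transpose, Matrix.det_adjugate, hh, one_pow]
  obtain ⟨γ1, hγ1, hmin1⟩ := zm_min h hh {γ : Matrix (Fin 3) (Fin 3) ℤ | γ.det = 1}
    ⟨1, Matrix.det_one⟩ (fun γ => γ 0)
  obtain ⟨γ2, ⟨hγ2, hγ20⟩, hmin2⟩ := zm_min h.adjugate.transpose hadj
    {γ : Matrix (Fin 3) (Fin 3) ℤ | γ.det = 1 ∧ γ 0 = γ1 0} ⟨γ1, hγ1, rfl⟩
    (fun γ => cr (γ 0) (γ 1))
  -- the intermediate Gram data
  set x := zm (γ2 0) h with hx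
  set y := zm (γ2 1) h with hy
  set z := zm (γ2 2) h with hz
  set a := ip x x with ha
  set D := ip x x * ip y y - ip x y ^ 2 with hD
  have hdx : ip (cr x y) z = 1 := by
    rw [hx, hy, hz, ← hrow, ← hrow, ← hrow, ← det_eq_ip_cr]
    exact hdet _ hγ2
  have ha0 : 0 < a := by
    rw [ha, hx, ← hrow]
    exact ip_pos_of_det (hdet _ hγ2)
  have hD0 : 0 < D := by
    have h1 : 0 ≤ D := by
      rw [hD, ← ip_cr]
      unfold ip
      nlinarith [sq_nonneg (cr x y 0), sq_nonneg (cr x y 1), sq_nonneg (cr x y 2)]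
    rcases h1.lt_or_eq with h1 | h1
    · exact h1
    · exfalso
      have h2 := gram_id x y z
      rw [← hD, ← h1, hdx] at h2
      nlinarith [sq_nonneg (ip x x * ip y z - ip x y * ip x z)]
  -- shifts
  set k : ℤ := -(round (ip x y / a)) with hk
  set y' : Fin 3 → ℝ := fun i => y i + k * x i with hy'
  set E := ip x x * ip y' z - ip x y' * ip x z with hE
  set k'' : ℤ := -(round (E / D)) with hk''
  set z1 : Fin 3 → ℝ := fun i => z i + k'' * y' i with hz1
  set k1 : ℤ := -(round (ip x z1 / a)) with hk1
  set z' : Fin 3 → ℝ := fun i => z1 i + k1 * x i with hz'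
  set γ : Matrix (Fin 3) (Fin 3) ℤ := mU k (k'' * k + k1) k'' * γ2 with hγ
  have hγdet : γ.det = 1 := by rw [hγ, Matrix.det_mul, det_mU, hγ2, mul_one]
  have r0 : zm (γ 0) h = x := by rw [hγ, zm_mU0]
  have r1 : zm (γ 1) h = y' := by rw [hγ, zm_mU1]
  have r2 : zm (γ 2) h = z' := by
    rw [hγ, zm_mU2, hz', hz1, hy']
    funext j
    push_cast
    ring
  have g0 : γ 0 = γ1 0 := by
    rw [← hγ20, hγ, row_mU0]
  have hxy' : ip x y' = ip x y + k * a := by simp [ip, hy', ha]; ring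
  have b12 : |2 * ip x y'| ≤ a := by rw [hxy']; exact two_round_le _ _ ha0
  have hD' : ip x x * ip y' y' - ip x y' ^ 2 = D := by simp [ip, hy', hD]; ring
  have hE' : ip x x * ip y' z' - ip x y' * ip x z' = E + k'' * D := by
    rw [← hD', hE]; simp [ip, hz', hz1]; ring
  have bE : |2 * (ip x x * ip y' z' - ip x y' * ip x z')| ≤ D := by
    rw [hE']; exact two_round_le _ _ hD0
  have b13 : |2 * ip x z'| ≤ a := by
    have : ip x z' = ip x z1 + k1 * a := by simp [ip, hz', ha]; ring
    rw [this]; exact two_round_le _ _ ha0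
  -- minimality
  have m1 : a ≤ ip y' y' := by
    have h1 := hmin1 (mT * γ) (by
      show (mT * γ).det = 1
      rw [Matrix.det_mul, hγdet, det_mT, mul_one])
    beta_reduce at h1
    rw [row_mT0, r1, ← hγ20] at h1
    exact h1
  have m2 : D ≤ ip x x * ip z' z' - ip x z' ^ 2 := by
    have h1 := hmin2 (mS ℤ * γ) ⟨by rw [Matrix.det_mul, hγdet, det_mS, mul_one], by
      rw [← g0, row_mS0]⟩
    have h2 := row_mS0 γ
    have h3 := row_mS1 γ
    beta_reduce at h1
    rw [h2, h3, cr_zm, cr_zm, r0, r2, ip_cr, ip_cr] at h1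
    exact h1
  have hdx' : ip (cr x y') z' = 1 := by
    rw [← r0, ← r1, ← r2, ← hrow, ← hrow, ← hrow, ← det_eq_ip_cr]
    exact hdet _ hγdet
  have hG := gram_id x y' z'
  rw [hdx', hD'] at hG
  have num := gram_num a D (ip x y') (ip y' y') (ip x z') (ip z' z')
    (ip x x * ip y' z' - ip x y' * ip x z') ha0 hD0 (sq4 b12) (sq4 b13) (sq4 bE) hD' m1 m2
    (by linarith)
  obtain ⟨i1, i2, i3, i4⟩ := num
  refine ⟨γ, a, D, hγdet, ha0, hD0, i1, i2, ?_, ?_, ?_⟩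
  · rw [hrow, r0]
  · rw [hrow, r1, ← mul_div_assoc, le_div_iff₀ ha0]
    linarith
  · rw [hrow, r2, le_div_iff₀ hD0]
    exact i4

/-! ## Every integral form is equivalent to one in a weighted box -/

theorem forall3 {p : Fin 3 → Prop} (h0 : p 0) (h1 : p 1) (h2 : p 2) : ∀ l, p l := by
  intro l
  fin_cases l
  · exact h0
  · exact h1
  · exact h2

theorem cell_num (a D : ℝ) (ha : 0 < a) (hD : 0 < D) (h1 : 3 * a ^ 2 ≤ 4 * D)
    (h2 : 3 * D ^ 2 ≤ 4 * a) :
    ∃ i j : ℕ, a ≤ (10 * (1 / (((2 : ℝ) ^ i) ^ 2 * 2 ^ j))) ^ 2 ∧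
      4 / 3 * (D / a) ≤ (10 * ((2 : ℝ) ^ i / 2 ^ j)) ^ 2 ∧
      2 / D ≤ (10 * ((2 : ℝ) ^ i * (2 ^ j) ^ 2)) ^ 2 := by
  have hU : 1 ≤ 4 / 3 * D / a ^ 2 := by
    rw [le_div_iff₀ (by positivity)]; linarith
  have hV : 1 ≤ 4 / 3 * a / D ^ 2 := by
    rw [le_div_iff₀ (by positivity)]; linarith
  obtain ⟨i, hi1, hi2⟩ := exists_nat_pow_near hU (show (1 : ℝ) < 64 by norm_num)
  obtain ⟨j, hj1, hj2⟩ := exists_nat_pow_near hV (show (1 : ℝ) < 64 by norm_num)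
  refine ⟨i, j, ?_⟩
  have e : ∀ n : ℕ, (64 : ℝ) ^ n = ((2 : ℝ) ^ n) ^ 6 := by
    intro n; rw [← pow_mul, mul_comm, pow_mul]; norm_num
  rw [pow_succ (64 : ℝ) i, e] at hi2
  rw [pow_succ (64 : ℝ) j, e] at hj2
  rw [e] at hi1 hj1
  have hP0 : (0 : ℝ) < 2 ^ i := by positivity
  have hQ0 : (0 : ℝ) < 2 ^ j := by positivity
  generalize (2 : ℝ) ^ i = p at *
  generalize (2 : ℝ) ^ j = q at *
  clear e
  rw [le_div_iff₀ (by positivity)] at hi1 hj1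
  rw [div_lt_iff₀ (by positivity)] at hi2 hj2
  refine ⟨?_, ?_, ?_⟩
  · have k1 : (p ^ 6 * a ^ 2) ^ 2 * (q ^ 6 * D ^ 2) ≤ (4 / 3 * D) ^ 2 * (4 / 3 * a) := by gcongr
    have k2 : (a * p ^ 4 * q ^ 2) ^ 3 ≤ (4 / 3) ^ 3 := by
      have h3 : (a * D ^ 2) * (a * p ^ 4 * q ^ 2) ^ 3 ≤ (a * D ^ 2) * (4 / 3) ^ 3 := by
        calc _ = (p ^ 6 * a ^ 2) ^ 2 * (q ^ 6 * D ^ 2) := by ring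
          _ ≤ _ := k1
          _ = _ := by ring
      exact le_of_mul_le_mul_left h3 (by positivity)
    have k3 := le_of_pow_le_pow_left₀ (by norm_num) (by norm_num) k2
    rw [mul_one_div, div_pow, le_div_iff₀ (by positivity)]
    calc _ = a * p ^ 4 * q ^ 2 := by ring
      _ ≤ _ := by linarith
  · have k1 : (4 / 3 * D) * (q ^ 6 * D ^ 2) ≤ (p ^ 6 * 64 * a ^ 2) * (4 / 3 * a) := by
      gcongr
    have k2 : (D * q ^ 2) ^ 3 ≤ (4 * p ^ 2 * a) ^ 3 := by
      linarith
    have k3 := le_of_pow_le_pow_left₀ (by norm_num) (by positivity) k2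
    rw [← mul_div_assoc, ← mul_div_assoc, div_pow, div_le_div_iff₀ ha (by positivity)]
    have : 0 < p ^ 2 * a := by positivity
    linarith
  · have k1 : (4 / 3 * D) * (4 / 3 * a) ^ 2 ≤ (p ^ 6 * 64 * a ^ 2) * (q ^ 6 * 64 * D ^ 2) ^ 2 := by
      gcongr
    have k2 : 1 ^ 3 ≤ (48 * p ^ 2 * q ^ 4 * D) ^ 3 := by
      have h3 : (D * a ^ 2) * 1 ^ 3 ≤ (D * a ^ 2) * (48 * p ^ 2 * q ^ 4 * D) ^ 3 := by
        calc _ = ((4 / 3 * D) * (4 / 3 * a) ^ 2) * (27 / 64) := by ring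
          _ ≤ ((p ^ 6 * 64 * a ^ 2) * (q ^ 6 * 64 * D ^ 2) ^ 2) * (27 / 64) := by gcongr
          _ = _ := by ring
      exact le_of_mul_le_mul_left h3 (by positivity)
    have k3 := le_of_pow_le_pow_left₀ (by norm_num) (by positivity) k2
    rw [div_le_iff₀ hD]
    have : 0 < p ^ 2 * q ^ 4 * D := by positivity
    linarith

/-- The weights of the box. -/
noncomputable def wt (p q : ℝ) : Fin 10 → ℝ :=
  ![1 / (p ^ 2 * q), p / q, p * q ^ 2, 1 / (p * q), 1 / p, 1 / q, p, q, p * q, 1]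

theorem act_bound : ∃ C : ℝ, 0 < C ∧ ∀ (e : Matrix (Fin 3) (Fin 3) ℝ) (f : Fin 10 → ℝ),
    (∀ i j, |e i j| ≤ 10) → ‖f‖ ≤ 1 → ‖act e f‖ ≤ C := by
  have hcont : Continuous (fun x : (Fin 3 → Fin 3 → ℝ) × (Fin 10 → ℝ) => act x.1 x.2) := by
    apply continuous_pi
    have hev : ∀ l, Continuous (fun x : (Fin 3 → Fin 3 → ℝ) × (Fin 10 → ℝ) => ev x.2 (x.1 l)) := by
      intro l; unfold ev; fun_prop
    have hdv : ∀ l m, Continuous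
        (fun x : (Fin 3 → Fin 3 → ℝ) × (Fin 10 → ℝ) => dv x.2 (x.1 l) (x.1 m)) := by
      intro l m; unfold dv; fun_prop
    have htv : Continuous
        (fun x : (Fin 3 → Fin 3 → ℝ) × (Fin 10 → ℝ) => tv x.2 (x.1 0) (x.1 1) (x.1 2)) := by
      unfold tv; fun_prop
    intro k
    fin_cases k
    · exact hev 0
    · exact hev 1
    · exact hev 2
    · exact hdv 0 1
    · exact hdv 0 2
    · exact hdv 1 0
    · exact hdv 1 2
    · exact hdv 2 0
    · exact hdv 2 1
    · exact htv
  have hK : IsCompact ((Set.univ.pi fun _ : Fin 3 => Set.univ.pi fun _ : Fin 3 =>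
      Set.Icc (-10 : ℝ) 10) ×ˢ (Metric.closedBall (0 : Fin 10 → ℝ) 1)) :=
    (isCompact_univ_pi fun _ => isCompact_univ_pi fun _ => isCompact_Icc).prod
      (isCompact_closedBall _ _)
  obtain ⟨C, hC⟩ := hK.exists_bound_of_continuousOn hcont.continuousOn
  refine ⟨|C| + 1, by positivity, fun e f he hf => ?_⟩
  have := hC (e, f) ⟨fun i _ j _ => abs_le.mp (he i j), by simpa using hf⟩
  refine this.trans ?_
  linarith [le_abs_self C]

theorem box_reduction {P Q : MvPolynomial (Fin 10) ℚ} (D : InvData P Q) :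
    ∃ C : ℝ, 0 < C ∧ ∀ (c : Fin 10 → ℤ) (Y : ℝ), 0 < Y →
      |pv D.P0 (fun k => (c k : ℝ))| ≤ D.N * Y ^ 4 →
      |pv D.Q0 (fun k => (c k : ℝ))| ≤ D.N * Y ^ 6 →
      ∃ γ : Matrix (Fin 3) (Fin 3) ℤ, γ.det = 1 ∧ ∃ i j : ℕ, ∀ k,
        |((act γ c k : ℤ) : ℝ)| ≤ C * Y * wt (8 ^ i) (8 ^ j) k := by
  obtain ⟨C0, hC0, h0⟩ := real_reduction D
  obtain ⟨C1, hC1, h1⟩ := act_bound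
  refine ⟨C1 * C0, by positivity, fun c Y hY hP hQ => ?_⟩
  obtain ⟨g, hg, hgc⟩ := h0 _ Y hY hP hQ
  obtain ⟨γ, a, D', hγ, ha, hD, i1, i2, r0, r1, r2⟩ := gram_reduction g.adjugate (by
    rw [Matrix.det_adjugate, hg, one_pow])
  obtain ⟨i, j, n0, n1, n2⟩ := cell_num a D' ha hD i1 i2
  refine ⟨γ, hγ, i, j, ?_⟩
  set b := γ.map (Int.cast : ℤ → ℝ) * g.adjugate with hb
  set f := act g (fun k => (c k : ℝ)) with hf
  have e8 : ∀ n : ℕ, (8 : ℝ) ^ n = ((2 : ℝ) ^ n) ^ 3 := by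
    intro n; rw [← pow_mul, mul_comm, pow_mul]; norm_num
  rw [e8, e8]
  have hp0 : (0 : ℝ) < 2 ^ i := by positivity
  have hq0 : (0 : ℝ) < 2 ^ j := by positivity
  generalize (2 : ℝ) ^ i = p at *
  generalize (2 : ℝ) ^ j = q at *
  set t : Fin 3 → ℝ := ![1 / (p ^ 2 * q), p / q, p * q ^ 2] with ht
  have ht0 : ∀ l, 0 < t l := by
    apply forall3
    · show 0 < 1 / (p ^ 2 * q); positivity
    · show 0 < p / q; positivity
    · show 0 < p * q ^ 2; positivity
  have hbt : ∀ l m, |b l m| ≤ 10 * t l := by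
    apply forall3 <;> intro m
    · exact abs_le_of_ip (r0.le.trans n0) (by positivity) m
    · exact abs_le_of_ip (r1.trans n1) (by positivity) m
    · exact abs_le_of_ip (r2.trans n2) (by positivity) m
  set e : Matrix (Fin 3) (Fin 3) ℝ := Matrix.of fun l m => b l m / t l with he
  have he10 : ∀ l m, |e l m| ≤ 10 := by
    intro l m
    rw [he, Matrix.of_apply, abs_div, abs_of_pos (ht0 l), div_le_iff₀ (ht0 l)]
    exact hbt l m
  have hbe : b = mD (t 0) (t 1) (t 2) * e := by
    ext l m
    rw [Matrix.mul_apply, Fin.sum_univ_three]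
    revert l
    apply forall3
    · simp [mD, he]; field_simp [(ht0 0).ne']
    · simp [mD, he]; field_simp [(ht0 1).ne']
    · simp [mD, he]; field_simp [(ht0 2).ne']
  have hact : (fun k => ((act γ c k : ℤ) : ℝ)) = act b f := by
    rw [hb, ← act_mul, hf, act_mul g.adjugate, Matrix.adjugate_mul, hg, one_smul, act_one]
    funext k
    exact map_act (Int.castRingHom ℝ) c γ k
  have hbound : ∀ k, |act e f k| ≤ C1 * C0 * Y := by
    intro k
    have hCY : 0 < C0 * Y := by positivity
    have h3 := h1 e ((C0 * Y)⁻¹ • f) he10 (by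
      rw [norm_smul, norm_inv, Real.norm_of_nonneg hCY.le, inv_mul_le_iff₀ hCY, mul_one]
      exact hgc)
    rw [act_smul, norm_smul, norm_inv, Real.norm_of_nonneg hCY.le, inv_mul_le_iff₀ hCY] at h3
    refine ((norm_le_pi_norm (act e f) k).trans h3).trans ?_
    linarith
  intro k
  have hk := congrFun hact k
  beta_reduce at hk
  rw [hk, hbe, ← act_mul, act_mD]
  have key : ∀ (k : Fin 10) (w v : ℝ), 0 ≤ v → v = w → |act e f k * v| ≤ C1 * C0 * Y * w := by
    intro k w v hv hvw
    rw [abs_mul, abs_of_nonneg hv, ← hvw]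
    exact mul_le_mul_of_nonneg_right (hbound k) hv
  clear hact hk hbound he10 hbt
  have e0 : t 0 = 1 / (p ^ 2 * q) := rfl
  have e1 : t 1 = p / q := rfl
  have e2 : t 2 = p * q ^ 2 := rfl
  rw [e0, e1, e2]
  fin_cases k
  · exact key 0 _ _ (by positivity) (by simp [wt]; field_simp)
  · exact key 1 _ _ (by positivity) (by simp [wt]; field_simp)
  · exact key 2 _ _ (by positivity) (by simp [wt]; field_simp)
  · exact key 3 _ _ (by positivity) (by simp [wt]; field_simp)
  · exact key 4 _ _ (by positivity) (by simp [wt]; field_simp)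
  · exact key 5 _ _ (by positivity) (by simp [wt]; field_simp)
  · exact key 6 _ _ (by positivity) (by simp [wt]; field_simp)
  · exact key 7 _ _ (by positivity) (by simp [wt]; field_simp)
  · exact key 8 _ _ (by positivity) (by simp [wt]; field_simp)
  · exact key 9 _ _ (by positivity) (by simp [wt]; field_simp)

/-! ## Orbits and counting in cells -/

theorem mem_orbitZ {c c' : Fin 10 → ℤ} :
    c' ∈ orbitZ c ↔ ∃ γ : Matrix (Fin 3) (Fin 3) ℤ, γ.det = 1 ∧ act γ c = c' := by
  constructor
  · rintro ⟨γ, h⟩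
    rw [actGL_cubic] at h
    exact ⟨γ, γ.2, cubic_inj h⟩
  · rintro ⟨γ, hγ, rfl⟩
    exact ⟨⟨γ, hγ⟩, actGL_cubic _ _⟩

theorem orbitZ_act {γ : Matrix (Fin 3) (Fin 3) ℤ} (hγ : γ.det = 1) (c : Fin 10 → ℤ) :
    orbitZ (act γ c) = orbitZ c := by
  ext d
  rw [mem_orbitZ, mem_orbitZ]
  constructor
  · rintro ⟨g, hg, rfl⟩
    exact ⟨g * γ, by rw [Matrix.det_mul, hg, hγ, one_mul], (act_mul _ _ _).symm⟩
  · rintro ⟨g, hg, rfl⟩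
    refine ⟨g * γ.adjugate, by rw [Matrix.det_mul, hg, Matrix.det_adjugate, hγ]; simp, ?_⟩
    rw [act_mul, mul_assoc, Matrix.adjugate_mul, hγ, one_smul, mul_one]

theorem count_mul {κ : Type*} (S : Set (Set (Fin 10 → ℤ))) (R : Set (Fin 10 → ℤ))
    (hS : ∀ T ∈ S, ∃ c ∈ R, orbitZ c = T) (K : Finset κ) (hK : K.Nonempty)
    (u : κ → Matrix (Fin 3) (Fin 3) ℤ) (hu : ∀ k, (u k).det = 1) (F : Finset (Fin 10 → ℤ))
    (hF : ∀ c ∈ R, ∀ k ∈ K, act (u k) c ∈ F)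
    (hinj : ∀ c ∈ R, ∀ k k', act (u k) c = act (u k') c → k = k') :
    S.Finite ∧ S.ncard * K.card ≤ F.card := by
  classical
  choose! r hrR hr using hS
  have inj : Set.InjOn (fun x : Set (Fin 10 → ℤ) × κ => act (u x.2) (r x.1)) (S ×ˢ (K : Set κ)) := by
    rintro ⟨T, k⟩ ⟨hT, hk⟩ ⟨T', k'⟩ ⟨hT', hk'⟩ h
    simp only at h hT hT' hk hk'
    have hTT : T = T' := by
      rw [← hr T hT, ← hr T' hT', ← orbitZ_act (hu k) (r T), h, orbitZ_act (hu k')]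
    subst hTT
    rw [hinj _ (hrR T hT) k k' h]
  have maps : Set.MapsTo (fun x : Set (Fin 10 → ℤ) × κ => act (u x.2) (r x.1)) (S ×ˢ (K : Set κ))
      (F : Set (Fin 10 → ℤ)) := by
    rintro ⟨T, k⟩ ⟨hT, hk⟩
    exact hF _ (hrR T hT) k hk
  have fin : (S ×ˢ (K : Set κ)).Finite := Set.Finite.of_injOn maps inj F.finite_toSet
  refine ⟨?_, ?_⟩
  · exact (Set.Finite.of_prod_left fin (by simpa using hK))
  · have h1 := Set.ncard_le_ncard_of_injOn _ maps inj F.finite_toSet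
    rw [Set.ncard_prod, Set.ncard_coe_finset, Set.ncard_coe_finset] at h1
    exact h1

/-- Unipotent matrices of bounded size preserve boxes up to a constant. -/
theorem unip_box : ∃ C : ℝ, 1 ≤ C ∧ ∀ (p q Z : ℝ) (c : Fin 10 → ℝ) (k k' k'' : ℝ), 1 ≤ p → 1 ≤ q →
    0 < Z → (∀ m, |c m| ≤ Z * wt p q m) → |k| ≤ p → |k'| ≤ p * q → |k''| ≤ q →
    ∀ m, |act (mU k k' k'') c m| ≤ C * Z * wt p q m := by
  obtain ⟨C, hC, hb⟩ := act_bound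
  refine ⟨C + 1, by linarith, fun p q Z c k k' k'' hp hq hZ hc hk hk' hk'' => ?_⟩
  have p0 : 0 < p := by linarith
  have q0 : 0 < q := by linarith
  have w0 : ∀ m, 0 < wt p q m := by
    intro m
    fin_cases m <;> simp [wt] <;> positivity
  set x : Fin 10 → ℝ := fun m => c m / (Z * wt p q m) with hx
  have hx1 : ‖x‖ ≤ 1 := by
    rw [pi_norm_le_iff_of_nonneg zero_le_one]
    intro m
    have := w0 m
    rw [hx, Real.norm_eq_abs, abs_div, abs_of_pos (by positivity : 0 < Z * wt p q m),
      div_le_one (by positivity)]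
    exact hc m
  have hcx : ∀ m, c m = Z * wt p q m * x m := by
    intro m
    have := (w0 m).ne'
    rw [hx]
    field_simp
  have hE := hb (mU (k / p) (k' / (p * q)) (k'' / q)) x (by
    apply forall3 <;> apply forall3 <;> simp [mU]
    · rw [abs_div, abs_of_pos p0, div_le_iff₀ p0]; linarith
    · have : 0 < p * q := by positivity
      rw [abs_div, abs_mul, abs_of_pos p0, abs_of_pos q0, div_le_iff₀ this]; linarith
    · rw [abs_div, abs_of_pos q0, div_le_iff₀ q0]; linarith) hx1
  have key : ∀ m, act (mU k k' k'') c m =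
      Z * wt p q m * act (mU (k / p) (k' / (p * q)) (k'' / q)) x m := by
    have hc' : c = fun m => Z * wt p q m * x m := funext hcx
    intro m
    rw [hc', act_mU, act_mU]
    clear hc' hcx hE hx1 hc
    clear_value x
    fin_cases m <;> simp [wt] <;> field_simp <;> ring
  intro m
  have hw := w0 m
  rw [key, abs_mul, abs_of_pos (by positivity : 0 < Z * wt p q m)]
  have h2 : |act (mU (k / p) (k' / (p * q)) (k'' / q)) x m| ≤ C := (norm_le_pi_norm _ m).trans hE
  have h3 : 0 < Z * wt p q m := by positivity
  nlinarith

/-- Integral points of a box. -/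
noncomputable def bx (b : Fin 10 → ℝ) : Finset (Fin 10 → ℤ) :=
  Fintype.piFinset fun k => Finset.Icc (-(⌊b k⌋₊ : ℤ)) ⌊b k⌋₊

theorem mem_bx {b : Fin 10 → ℝ} {c : Fin 10 → ℤ} (h : ∀ k, |(c k : ℝ)| ≤ b k) : c ∈ bx b := by
  rw [bx, Fintype.mem_piFinset]
  intro k
  rw [Finset.mem_Icc, ← abs_le]
  have h1 : ((c k).natAbs : ℝ) ≤ b k := by
    have := h k
    rwa [← Int.cast_abs, Int.abs_eq_natAbs, Int.cast_natCast] at this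
  have h2 := Nat.le_floor h1
  rw [Int.abs_eq_natAbs]
  exact_mod_cast h2

theorem card_bx {b e : Fin 10 → ℝ} (h : ∀ k, (b k = 0 ∧ e k = 1) ∨ (1 ≤ b k ∧ e k = 3 * b k)) :
    ((bx b).card : ℝ) ≤ ∏ k, e k := by
  rw [bx, Fintype.card_piFinset]
  push_cast
  apply Finset.prod_le_prod
  · intro k _; positivity
  · intro k _
    rw [Int.card_Icc]
    have e1 : ((⌊b k⌋₊ : ℤ) + 1 - -(⌊b k⌋₊ : ℤ)).toNat = 2 * ⌊b k⌋₊ + 1 := by omega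
    rw [e1]
    push_cast
    rcases h k with ⟨h0, h1⟩ | ⟨h0, h1⟩
    · rw [h0, h1]; simp
    · rw [h1]
      have := Nat.floor_le (by linarith : 0 ≤ b k)
      linarith

/-- The integral points of the weighted box. -/
def cellR (i j : ℕ) (Z : ℝ) : Set (Fin 10 → ℤ) :=
  {c | ∀ k, |(c k : ℝ)| ≤ Z * wt (8 ^ i) (8 ^ j) k}

theorem cell_unip : ∃ C : ℝ, 1 ≤ C ∧ ∀ (i j : ℕ) (Z : ℝ) (c : Fin 10 → ℤ) (k k' k'' : ℕ), 0 < Z →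
    c ∈ cellR i j Z → k < 8 ^ i → k' < 8 ^ i * 8 ^ j → k'' < 8 ^ j →
    act (mU (k : ℤ) k' k'') c ∈ cellR i j (C * Z) := by
  obtain ⟨C, hC, h⟩ := unip_box
  refine ⟨C, hC, fun i j Z c k k' k'' hZ hc hk hk' hk'' m => ?_⟩
  have := h (8 ^ i) (8 ^ j) Z (fun k => (c k : ℝ)) k k' k'' (one_le_pow₀ (by norm_num))
    (one_le_pow₀ (by norm_num)) hZ hc (by rw [Nat.abs_cast]; exact_mod_cast hk.le)
    (by rw [Nat.abs_cast]; exact_mod_cast hk'.le) (by rw [Nat.abs_cast]; exact_mod_cast hk''.le) m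
  convert this using 2
  have h2 := map_act (Int.castRingHom ℝ) c (mU (k : ℤ) k' k'') m
  refine h2.trans ?_
  congr 2
  ext a b
  fin_cases a <;> fin_cases b <;> simp [mU]

theorem one_le_of_ne {n : ℤ} (hn : n ≠ 0) {b : ℝ} (h : |(n : ℝ)| ≤ b) : 1 ≤ b := by
  have : (1 : ℤ) ≤ |n| := Int.one_le_abs hn
  have h2 : (1 : ℝ) ≤ |(n : ℝ)| := by exact_mod_cast this
  linarith

theorem cell_c0 : ∃ C : ℝ, 1 ≤ C ∧ ∀ (i j : ℕ) (Z : ℝ) (S : Set (Set (Fin 10 → ℤ))), 0 < Z →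
    (∀ T ∈ S, ∃ c ∈ {c | c ∈ cellR i j Z ∧ c 0 ≠ 0}, orbitZ c = T) →
    S.Finite ∧ (S.ncard : ℝ) * 8 ^ (2 * i + j) ≤ (C * Z) ^ 10 := by
  obtain ⟨C, hC, h⟩ := cell_unip
  refine ⟨3 * C, by linarith, fun i j Z S hZ hS => ?_⟩
  rcases S.eq_empty_or_nonempty with rfl | ⟨T0, hT0⟩
  · simp; positivity
  obtain ⟨c0, ⟨hc0, hc00⟩, -⟩ := hS T0 hT0
  have hw0 : 1 ≤ C * Z * wt (8 ^ i) (8 ^ j) 0 := by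
    refine (one_le_of_ne hc00 (hc0 0)).trans ?_
    have : 0 ≤ wt (8 ^ i) (8 ^ j) 0 := by simp [wt]
    gcongr
    nlinarith
  have hm := count_mul S _ hS (Finset.range (8 ^ i) ×ˢ Finset.range (8 ^ i * 8 ^ j)) (by
    simp) (fun k => mU (k.1 : ℤ) k.2 (0 : ℕ)) (fun k => det_mU _ _ _)
    (bx (fun k => C * Z * wt (8 ^ i) (8 ^ j) k)) (by
      rintro c ⟨hc, -⟩ ⟨k, k'⟩ hk
      rw [Finset.mem_product, Finset.mem_range, Finset.mem_range] at hk
      exact mem_bx (h i j Z c k k' 0 hZ hc hk.1 hk.2 (by positivity))) (by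
      rintro c ⟨-, hc⟩ ⟨k, k'⟩ ⟨l, l'⟩ he
      have e3 := congrFun he 3
      have e4 := congrFun he 4
      simp [act_mU, hc] at e3 e4
      simp [e3, e4])
  refine ⟨hm.1, ?_⟩
  have hm2 : ((S.ncard * (Finset.range (8 ^ i) ×ˢ Finset.range (8 ^ i * 8 ^ j)).card : ℕ) : ℝ) ≤ _ :=
    (Nat.cast_le.mpr hm.2).trans (card_bx (e := fun k => 3 * (C * Z * wt (8 ^ i) (8 ^ j) k)) (by
      intro k
      refine Or.inr ⟨hw0.trans ?_, rfl⟩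
      have hp : (1 : ℝ) ≤ 8 ^ i := one_le_pow₀ (by norm_num)
      have hq : (1 : ℝ) ≤ 8 ^ j := one_le_pow₀ (by norm_num)
      have hle : wt (8 ^ i) (8 ^ j) 0 ≤ wt (8 ^ i) (8 ^ j) k := by
        generalize (8 : ℝ) ^ i = p at *
        generalize (8 : ℝ) ^ j = q at *
        have : 0 < p := by linarith
        have : 0 < q := by linarith
        have h1 : 1 ≤ p ^ 2 := one_le_pow₀ hp
        have h2 : 1 ≤ q ^ 2 := one_le_pow₀ hq
        have h3 : 1 ≤ p ^ 3 := one_le_pow₀ hp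
        have h4 : 1 ≤ q ^ 3 := one_le_pow₀ hq
        have h5 : 1 ≤ p * q := by nlinarith
        have h6 : 1 ≤ p ^ 2 * q := by nlinarith
        have h7 : 1 ≤ p * q ^ 2 := by nlinarith
        have h8 : 1 / (p ^ 2 * q) ≤ 1 := by rw [div_le_one (by positivity)]; exact h6
        fin_cases k
        · exact le_rfl
        · show 1 / (p ^ 2 * q) ≤ p / q
          rw [div_le_div_iff₀ (by positivity) (by positivity)]
          nlinarith
        · exact h8.trans h7
        · show 1 / (p ^ 2 * q) ≤ 1 / (p * q)
          gcongr; nlinarith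
        · show 1 / (p ^ 2 * q) ≤ 1 / p
          gcongr; nlinarith
        · show 1 / (p ^ 2 * q) ≤ 1 / q
          gcongr; nlinarith
        · exact h8.trans hp
        · exact h8.trans hq
        · exact h8.trans h5
        · exact h8
      gcongr))
  rw [Finset.card_product, Finset.card_range, Finset.card_range] at hm2
  push_cast at hm2
  have hprod : ∏ k, 3 * (C * Z * wt (8 ^ i) (8 ^ j) k) = (3 * C * Z) ^ 10 := by
    have hp : (0 : ℝ) < 8 ^ i := by positivity
    have hq : (0 : ℝ) < 8 ^ j := by positivity
    generalize (8 : ℝ) ^ i = p at *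
    generalize (8 : ℝ) ^ j = q at *
    simp [Fin.prod_univ_succ, wt]
    field_simp
  rw [hprod] at hm2
  refine le_trans (le_of_eq ?_) hm2
  rw [pow_add, two_mul, pow_add]
  ring

theorem cell_c3 : ∃ C : ℝ, 1 ≤ C ∧ ∀ (i j : ℕ) (Z : ℝ) (S : Set (Set (Fin 10 → ℤ))), 0 < Z →
    (∀ T ∈ S, ∃ c ∈ {c | c ∈ cellR i j Z ∧ c 0 = 0 ∧ c 3 ≠ 0}, orbitZ c = T) →
    S.Finite ∧ (S.ncard : ℝ) ≤ (C * Z) ^ 9 := by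
  obtain ⟨C, hC, h⟩ := cell_unip
  refine ⟨3 * C, by linarith, fun i j Z S hZ hS => ?_⟩
  rcases S.eq_empty_or_nonempty with rfl | ⟨T0, hT0⟩
  · simp; positivity
  obtain ⟨c0, ⟨hc0, -, hc03⟩, -⟩ := hS T0 hT0
  have hw0 : 1 ≤ C * Z * wt (8 ^ i) (8 ^ j) 3 := by
    refine (one_le_of_ne hc03 (hc0 3)).trans ?_
    have : 0 ≤ wt (8 ^ i) (8 ^ j) 3 := by simp [wt]
    gcongr
    nlinarith
  have hm := count_mul S _ hS (Finset.range (8 ^ i) ×ˢ Finset.range (8 ^ i * 8 ^ j)) (by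
    simp) (fun k => mU (k.1 : ℤ) k.2 (0 : ℕ)) (fun k => det_mU _ _ _)
    (bx (fun k => if k = 0 then 0 else C * Z * wt (8 ^ i) (8 ^ j) k)) (by
      rintro c ⟨hc, hc00, -⟩ ⟨k, k'⟩ hk
      rw [Finset.mem_product, Finset.mem_range, Finset.mem_range] at hk
      apply mem_bx
      intro m
      split_ifs with hm
      · subst hm
        simp [act_mU, hc00]
      · exact h i j Z c k k' 0 hZ hc hk.1 hk.2 (by positivity) m) (by
      rintro c ⟨-, hc0, hc⟩ ⟨k, k'⟩ ⟨l, l'⟩ he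
      have e5 := congrFun he 5
      have e9 := congrFun he 9
      simp [act_mU, hc, hc0] at e5
      simp [act_mU, hc, hc0, e5] at e9
      simp [e5, e9])
  refine ⟨hm.1, ?_⟩
  have hp : (1 : ℝ) ≤ 8 ^ i := one_le_pow₀ (by norm_num)
  have hq : (1 : ℝ) ≤ 8 ^ j := one_le_pow₀ (by norm_num)
  have hm2 : ((S.ncard * (Finset.range (8 ^ i) ×ˢ Finset.range (8 ^ i * 8 ^ j)).card : ℕ) : ℝ) ≤ _ :=
    (Nat.cast_le.mpr hm.2).trans (card_bx
      (e := fun k => if k = 0 then 1 else 3 * (C * Z * wt (8 ^ i) (8 ^ j) k)) (by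
      intro k
      split_ifs with hk
      · simp
      refine Or.inr ⟨hw0.trans ?_, rfl⟩
      have hle : wt (8 ^ i) (8 ^ j) 3 ≤ wt (8 ^ i) (8 ^ j) k := by
        generalize (8 : ℝ) ^ i = p at *
        generalize (8 : ℝ) ^ j = q at *
        have : 0 < p := by linarith
        have : 0 < q := by linarith
        have h1 : 1 ≤ p ^ 2 := one_le_pow₀ hp
        have h2 : 1 ≤ q ^ 2 := one_le_pow₀ hq
        have h5 : 1 ≤ p * q := by nlinarith
        have h7 : 1 ≤ p * q ^ 2 := by nlinarith
        have h8 : 1 / (p * q) ≤ 1 := by rw [div_le_one (by positivity)]; exact h5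
        fin_cases k
        · exact absurd rfl hk
        · show 1 / (p * q) ≤ p / q
          rw [div_le_div_iff₀ (by positivity) (by positivity)]
          nlinarith
        · exact h8.trans h7
        · exact le_rfl
        · show 1 / (p * q) ≤ 1 / p
          gcongr; nlinarith
        · show 1 / (p * q) ≤ 1 / q
          gcongr; nlinarith
        · exact h8.trans hp
        · exact h8.trans hq
        · exact h8.trans h5
        · exact h8
      gcongr))
  rw [Finset.card_product, Finset.card_range, Finset.card_range] at hm2
  push_cast at hm2
  have hprod : ∏ k, (if k = 0 then 1 else 3 * (C * Z * wt (8 ^ i) (8 ^ j) k))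
      = (3 * C * Z) ^ 9 * (8 ^ i * (8 ^ i * 8 ^ j)) := by
    have hp : (0 : ℝ) < 8 ^ i := by positivity
    have hq : (0 : ℝ) < 8 ^ j := by positivity
    generalize (8 : ℝ) ^ i = p at *
    generalize (8 : ℝ) ^ j = q at *
    simp [Fin.prod_univ_succ, wt, Fin.succ_ne_zero]
    field_simp
  rw [hprod] at hm2
  exact le_of_mul_le_mul_right hm2 (by positivity)

theorem cell_c5 : ∃ C : ℝ, 1 ≤ C ∧ ∀ (i j : ℕ) (Z : ℝ) (S : Set (Set (Fin 10 → ℤ))), 0 < Z →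
    (∀ T ∈ S, ∃ c ∈ {c | c ∈ cellR i j Z ∧ c 0 = 0 ∧ c 3 = 0 ∧ c 4 ≠ 0 ∧ c 5 ≠ 0}, orbitZ c = T) →
    S.Finite ∧ (S.ncard : ℝ) ≤ (C * Z) ^ 9 := by
  obtain ⟨C, hC, h⟩ := cell_unip
  refine ⟨3 * C, by linarith, fun i j Z S hZ hS => ?_⟩
  rcases S.eq_empty_or_nonempty with rfl | ⟨T0, hT0⟩
  · simp; positivity
  obtain ⟨c0, ⟨hc0, -, -, hc04, hc05⟩, -⟩ := hS T0 hT0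
  have hp : (1 : ℝ) ≤ 8 ^ i := one_le_pow₀ (by norm_num)
  have hq : (1 : ℝ) ≤ 8 ^ j := one_le_pow₀ (by norm_num)
  have hw4 : 8 ^ i ≤ C * Z := by
    have h1 := one_le_of_ne hc04 (hc0 4)
    have h2 : wt (8 ^ i) (8 ^ j) 4 = 1 / 8 ^ i := rfl
    rw [h2, mul_one_div, le_div_iff₀ (by positivity), one_mul] at h1
    nlinarith
  have hw5 : 8 ^ j ≤ C * Z := by
    have h1 := one_le_of_ne hc05 (hc0 5)
    have h2 : wt (8 ^ i) (8 ^ j) 5 = 1 / 8 ^ j := rfl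
    rw [h2, mul_one_div, le_div_iff₀ (by positivity), one_mul] at h1
    nlinarith
  have hm := count_mul S _ hS
    (Finset.range (8 ^ i) ×ˢ (Finset.range (8 ^ i * 8 ^ j) ×ˢ Finset.range (8 ^ j))) (by
    simp) (fun k => mU (k.1 : ℤ) k.2.1 k.2.2) (fun k => det_mU _ _ _)
    (bx (fun k => if k = 0 ∨ k = 3 then 0 else C * Z * wt (8 ^ i) (8 ^ j) k)) (by
      rintro c ⟨hc, hc00, hc03, -⟩ ⟨k, k', k''⟩ hk
      rw [Finset.mem_product, Finset.mem_product, Finset.mem_range, Finset.mem_range,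
        Finset.mem_range] at hk
      apply mem_bx
      intro m
      split_ifs with hm
      · rcases hm with rfl | rfl <;> simp [act_mU, hc00, hc03]
      · exact h i j Z c k k' k'' hZ hc hk.1 hk.2.1 hk.2.2 m) (by
      rintro c ⟨-, hc0, hc3, hc4, hc5⟩ ⟨k, k', k''⟩ ⟨l, l', l''⟩ he
      have e1 := congrFun he 1
      have e9 := congrFun he 9
      have e7 := congrFun he 7
      simp [act_mU, hc5, hc0, hc3] at e1
      simp [act_mU, hc5, hc0, hc3, e1] at e9
      simp [act_mU, hc5, hc4, hc0, hc3, e1, e9] at e7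
      simp [e1, e9, e7])
  refine ⟨hm.1, ?_⟩
  have hm2 : ((S.ncard * (Finset.range (8 ^ i) ×ˢ (Finset.range (8 ^ i * 8 ^ j) ×ˢ
      Finset.range (8 ^ j))).card : ℕ) : ℝ) ≤ _ :=
    (Nat.cast_le.mpr hm.2).trans (card_bx
      (e := fun k => if k = 0 ∨ k = 3 then 1 else 3 * (C * Z * wt (8 ^ i) (8 ^ j) k)) (by
      intro k
      split_ifs with hk
      · simp
      refine Or.inr ⟨?_, rfl⟩
      generalize (8 : ℝ) ^ i = p at *
      generalize (8 : ℝ) ^ j = q at *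
      have p0 : 0 < p := by linarith
      have q0 : 0 < q := by linarith
      have hCZ : 1 ≤ C * Z := hp.trans hw4
      have h2 : 1 ≤ q ^ 2 := one_le_pow₀ hq
      have h5 : 1 ≤ p * q := by nlinarith
      have h7 : 1 ≤ p * q ^ 2 := by nlinarith
      have h8 : ∀ w : ℝ, 1 ≤ w → 1 ≤ C * Z * w := fun w hw => by nlinarith
      fin_cases k
      · simp at hk
      · show 1 ≤ C * Z * (p / q)
        rw [← mul_div_assoc, le_div_iff₀ q0]
        nlinarith
      · exact h8 _ h7
      · simp at hk
      · show 1 ≤ C * Z * (1 / p)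
        rw [mul_one_div, le_div_iff₀ p0]
        linarith
      · show 1 ≤ C * Z * (1 / q)
        rw [mul_one_div, le_div_iff₀ q0]
        linarith
      · exact h8 _ hp
      · exact h8 _ hq
      · exact h8 _ h5
      · exact h8 _ le_rfl))
  rw [Finset.card_product, Finset.card_product, Finset.card_range, Finset.card_range,
    Finset.card_range] at hm2
  push_cast at hm2
  have hprod : ∏ k, (if k = 0 ∨ k = 3 then 1 else 3 * (C * Z * wt (8 ^ i) (8 ^ j) k))
      = ((3 * C * Z) ^ 8 * 8 ^ i) * (8 ^ i * ((8 ^ i * 8 ^ j) * 8 ^ j)) := by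
    have hp : (0 : ℝ) < 8 ^ i := by positivity
    have hq : (0 : ℝ) < 8 ^ j := by positivity
    generalize (8 : ℝ) ^ i = p at *
    generalize (8 : ℝ) ^ j = q at *
    rw [Fin.prod_univ_castSucc, Fin.prod_univ_castSucc, Fin.prod_univ_eight]
    simp [wt, Fin.ext_iff]
    field_simp
  rw [hprod] at hm2
  have h9 := le_of_mul_le_mul_right hm2 (by positivity)
  refine h9.trans ?_
  rw [pow_succ (3 * C * Z) 8]
  gcongr
  nlinarith

/-! ## The local density at a prime -/

section
variable {K : Type*} [Field K]

/-- The curves `y² = x³ + Ax + B` with a rational flex tangent line `y = m x + n`. -/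
def TorS (K : Type*) [Field K] : Set (K × K) :=
  {x | ∃ m n : K, x.1 = m ^ 4 / 3 + 2 * m * n ∧ x.2 = n ^ 2 - m ^ 6 / 27}

theorem torS_of (h3 : (3 : K) ≠ 0) {A B x y m : K} (hxy : y ^ 2 = x ^ 3 + A * x + B)
    (h1 : m ^ 2 = 3 * x) (h2 : 3 * x ^ 2 + A = 2 * y * m) : (A, B) ∈ TorS K := by
  have h27 : (27 : K) ≠ 0 := by
    have : (27 : K) = 3 ^ 3 := by norm_num
    rw [this]; exact pow_ne_zero _ h3
  refine ⟨m, y - m * x, ?_, ?_⟩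
  · have hx : x = m ^ 2 / 3 := by rw [h1]; field_simp
    subst hx
    have : A = 2 * y * m - 3 * (m ^ 2 / 3) ^ 2 := by linear_combination h2
    simp only
    rw [this]
    field_simp
    ring
  · have hx : x = m ^ 2 / 3 := by rw [h1]; field_simp
    subst hx
    have hA : A = 2 * y * m - 3 * (m ^ 2 / 3) ^ 2 := by linear_combination h2
    have hB : B = y ^ 2 - (m ^ 2 / 3) ^ 3 - A * (m ^ 2 / 3) := by linear_combination -hxy
    simp only
    rw [hB, hA]
    have e27 : (27 : K) = 3 ^ 3 := by norm_num
    rw [e27]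
    field_simp
    ring

theorem torS_scale {A B t : K} (ht : t ≠ 0) (h : (t ^ 4 * A, t ^ 6 * B) ∈ TorS K) :
    (A, B) ∈ TorS K := by
  obtain ⟨m, n, h1, h2⟩ := h
  refine ⟨m / t, n / t ^ 3, ?_, ?_⟩
  · have : A = (m ^ 4 / 3 + 2 * m * n) / t ^ 4 := by
      rw [eq_div_iff (pow_ne_zero _ ht), ← h1]; ring
    simp only
    rw [this]; field_simp
  · have : B = (n ^ 2 - m ^ 6 / 27) / t ^ 6 := by
      rw [eq_div_iff (pow_ne_zero _ ht), ← h2]; ring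
    simp only
    rw [this]; field_simp

/-- A unipotent matrix. -/
def nM (u v w : K) : Matrix (Fin 3) (Fin 3) K := !![1, 0, w; u, 1, v; 0, 0, 1]

/-- A matrix fixing the flex line at infinity. -/
def bM (τ s1 s2 s3 : K) : Matrix (Fin 3) (Fin 3) K := !![1, s2, 0; 0, τ, 0; s1, s3, 1 / τ]

theorem det_nM (u v w : K) : (nM u v w).det = 1 := by
  simp [nM, Matrix.det_fin_three]

theorem det_bM (τ s1 s2 s3 : K) (hτ : τ ≠ 0) : (bM τ s1 s2 s3).det = 1 := by
  simp [bM, Matrix.det_fin_three, hτ]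

theorem nM_mul (u v w u' v' w' : K) :
    nM u v w * nM u' v' w' = nM (u + u') (v + v' + u * w') (w + w') := by
  ext i j
  fin_cases i <;> fin_cases j <;> simp [nM, Matrix.mul_apply, Fin.sum_univ_three] <;> ring

theorem nM_zero : nM (0 : K) 0 0 = 1 := by
  ext i j
  fin_cases i <;> fin_cases j <;> simp [nM]

/-- The family of forms with flex line at infinity. -/
noncomputable def wf (α τ s1 s2 s3 A B : K) : Fin 10 → K := act (bM τ s1 s2 s3) (α • wcoeffs A B)

theorem wf_eq (α τ s1 s2 s3 A B : K) (hτ : τ ≠ 0) : wf α τ s1 s2 s3 A B =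
    ![α, 0, α * (s1 ^ 3 + A * s1 / τ ^ 2 + B / τ ^ 3 - s3 ^ 2 / τ), 0, α * (3 * s1 - s2 ^ 2 / τ), 0,
      -(α * τ), α * (3 * s1 ^ 2 + A / τ ^ 2 - 2 * s2 * s3 / τ), -(2 * α * s3), -(2 * α * s2)] := by
  funext i
  fin_cases i <;> simp [wf, act, ev, dv, tv, bM, wcoeffs] <;> field_simp <;> ring_nf <;> simp

theorem wf_inj (h2 : (2 : K) ≠ 0) (h3 : (3 : K) ≠ 0) {α τ s1 s2 s3 A B α' τ' s1' s2' s3' A' B' : K}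
    (hα : α ≠ 0) (hτ : τ ≠ 0) (hτ' : τ' ≠ 0)
    (h : wf α τ s1 s2 s3 A B = wf α' τ' s1' s2' s3' A' B') :
    α = α' ∧ τ = τ' ∧ s1 = s1' ∧ s2 = s2' ∧ s3 = s3' ∧ A = A' ∧ B = B' := by
  rw [wf_eq _ _ _ _ _ _ _ hτ, wf_eq _ _ _ _ _ _ _ hτ'] at h
  have e0 : α = α' := congrFun h 0
  subst e0
  have e6 := congrFun h 6
  simp [hα] at e6
  subst e6
  have e9 := congrFun h 9
  simp [hα, h2] at e9
  subst e9
  have e8 := congrFun h 8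
  simp [hα, h2] at e8
  subst e8
  have e4 := congrFun h 4
  simp [hα, h3] at e4
  subst e4
  have e7 := congrFun h 7
  simp [hα, hτ] at e7
  subst e7
  have e2 := congrFun h 2
  simp [hα, hτ] at e2
  subst e2
  simp

theorem flex_key (h3 : (3 : K) ≠ 0) {α τ s1 s2 s3 A B u v w : K} (hα : α ≠ 0) (hτ : τ ≠ 0)
    (hS : (A, B) ∉ TorS K)
    (h1 : act (nM u v w) (wf α τ s1 s2 s3 A B) 1 = 0)
    (h5 : act (nM u v w) (wf α τ s1 s2 s3 A B) 5 = 0)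
    (h3' : act (nM u v w) (wf α τ s1 s2 s3 A B) 3 = 0) : u = 0 ∧ v = 0 ∧ w = 0 := by
  set X1 := u + s1 * v with hX1
  set Y1 := τ + s2 * u + s3 * v with hY1
  set Z1 := v / τ with hZ1
  set X0 := 1 + s1 * w with hX0
  set Y0 := s2 + s3 * w with hY0
  set Z0 := w / τ with hZ0
  have E1 : X1 ^ 3 + A * X1 * Z1 ^ 2 + B * Z1 ^ 3 - Y1 ^ 2 * Z1 = 0 := by
    apply (mul_eq_zero.mp (_ : α * _ = 0)).resolve_left hα
    rw [← h1, wf, act_mul]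
    simp [act, ev, nM, bM, wcoeffs, hX1, hY1, hZ1, Matrix.mul_apply, Fin.sum_univ_three]
    ring
  have E5 : (3 * X1 ^ 2 + A * Z1 ^ 2) * X0 - 2 * Y1 * Z1 * Y0
      + (2 * A * X1 * Z1 + 3 * B * Z1 ^ 2 - Y1 ^ 2) * Z0 = 0 := by
    apply (mul_eq_zero.mp (_ : α * _ = 0)).resolve_left hα
    rw [← h5, wf, act_mul]
    simp [act, dv, nM, bM, wcoeffs, hX1, hY1, hZ1, hX0, hY0, hZ0, Matrix.mul_apply,
      Fin.sum_univ_three]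
    ring
  have E3 : (3 * X0 ^ 2 + A * Z0 ^ 2) * X1 - 2 * Y0 * Z0 * Y1
      + (2 * A * X0 * Z0 + 3 * B * Z0 ^ 2 - Y0 ^ 2) * Z1 = 0 := by
    apply (mul_eq_zero.mp (_ : α * _ = 0)).resolve_left hα
    rw [← h3', wf, act_mul]
    simp [act, dv, nM, bM, wcoeffs, hX1, hY1, hZ1, hX0, hY0, hZ0, Matrix.mul_apply,
      Fin.sum_univ_three]
    ring
  by_cases hv : v = 0
  · subst hv
    have z1 : Z1 = 0 := by rw [hZ1]; simp
    have hu : u = 0 := by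
      rw [z1] at E1
      have : X1 ^ 3 = 0 := by linear_combination E1
      have := pow_eq_zero_iff (n := 3) (by norm_num) |>.mp this
      rw [hX1] at this
      simpa using this
    subst hu
    refine ⟨rfl, rfl, ?_⟩
    rw [z1] at E5
    have x1 : X1 = 0 := by rw [hX1]; ring
    have y1 : Y1 = τ := by rw [hY1]; ring
    rw [x1, y1, hZ0] at E5
    field_simp at E5
    simpa [hτ] using E5
  · exfalso
    have hz1 : Z1 ≠ 0 := div_ne_zero hv hτ
    set x := X1 / Z1 with hx
    set y := Y1 / Z1 with hy
    set ξ := X0 - x * Z0 with hξ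
    set η := Y0 - y * Z0 with hη
    have eX : X1 = x * Z1 := by rw [hx]; field_simp
    have eY : Y1 = y * Z1 := by rw [hy]; field_simp
    have eX0 : X0 = ξ + x * Z0 := by rw [hξ]; ring
    have eY0 : Y0 = η + y * Z0 := by rw [hη]; ring
    have F1 : y ^ 2 = x ^ 3 + A * x + B := by
      have : Z1 ^ 3 * (y ^ 2 - (x ^ 3 + A * x + B)) = 0 := by
        rw [eX, eY] at E1; linear_combination -E1
      exact sub_eq_zero.mp ((mul_eq_zero.mp this).resolve_left (pow_ne_zero _ hz1))
    have F5 : (3 * x ^ 2 + A) * ξ = 2 * y * η := by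
      have : Z1 ^ 2 * ((3 * x ^ 2 + A) * ξ - 2 * y * η) = 0 := by
        rw [eX, eY, eX0, eY0] at E5
        linear_combination E5 + 3 * Z1 ^ 2 * Z0 * F1
      exact sub_eq_zero.mp ((mul_eq_zero.mp this).resolve_left (pow_ne_zero _ hz1))
    have F3 : 3 * x * ξ ^ 2 = η ^ 2 := by
      have : Z1 * (3 * x * ξ ^ 2 - η ^ 2) = 0 := by
        rw [eX, eY, eX0, eY0] at E3
        linear_combination E3 + 3 * Z0 ^ 2 * Z1 * F1 - 2 * Z0 * Z1 * F5
      exact sub_eq_zero.mp ((mul_eq_zero.mp this).resolve_left hz1)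
    by_cases hξ0 : ξ = 0
    · have hη0 : η = 0 := by
        rw [hξ0] at F3
        have : η ^ 2 = 0 := by linear_combination -F3
        exact pow_eq_zero_iff (n := 2) (by norm_num) |>.mp this
      -- `P0 = t P1`
      have t1 : X0 * Z1 = X1 * Z0 := by rw [eX0, eX, hξ0]; ring
      have t2 : Y0 * Z1 = Y1 * Z0 := by rw [eY0, eY, hη0]; ring
      rw [hX0, hX1, hZ0, hZ1] at t1
      rw [hY0, hY1, hZ0, hZ1] at t2
      field_simp at t1 t2
      have t3 : v = u * w := by linear_combination t1
      have t4 : τ * w = 0 := by linear_combination -t2 + s2 * t3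
      have hw : w = 0 := (mul_eq_zero.mp t4).resolve_left hτ
      exact hv (by rw [t3, hw, mul_zero])
    · apply hS
      apply torS_of h3 (m := η / ξ) F1
      · rw [div_pow, ← F3]; field_simp
      · field_simp; linear_combination F5

/-- The parametrization of forms with exactly one flex-type line. -/
theorem psi_inj (h2 : (2 : K) ≠ 0) (h3 : (3 : K) ≠ 0)
    {α τ s1 s2 s3 A B α' τ' s1' s2' s3' A' B' u v w u' v' w' : K}
    (hα : α ≠ 0) (hτ : τ ≠ 0) (hτ' : τ' ≠ 0) (hS : (A, B) ∉ TorS K)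
    (h : act (nM u v w) (wf α τ s1 s2 s3 A B) = act (nM u' v' w') (wf α' τ' s1' s2' s3' A' B')) :
    (u = u' ∧ v = v' ∧ w = w') ∧
    (α = α' ∧ τ = τ' ∧ s1 = s1' ∧ s2 = s2' ∧ s3 = s3' ∧ A = A' ∧ B = B') := by
  have e : act (nM (-u' + u) ((-v' + u' * w') + v + -u' * w) (-w' + w)) (wf α τ s1 s2 s3 A B)
      = wf α' τ' s1' s2' s3' A' B' := by
    rw [← nM_mul, ← act_mul, h, act_mul, nM_mul]
    have : nM (-u' + u') (-v' + u' * w' + v' + -u' * w') (-w' + w') = 1 := by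
      rw [← nM_zero]; congr 1 <;> ring
    rw [this, act_one]
  have z := wf_eq α' τ' s1' s2' s3' A' B' hτ'
  obtain ⟨q1, q2, q3⟩ := flex_key h3 hα hτ hS (by rw [e, z]; rfl) (by rw [e, z]; rfl)
    (by rw [e, z]; rfl)
  have uu : u = u' := by linear_combination q1
  have ww : w = w' := by linear_combination q3
  have vv : v = v' := by
    subst uu ww; linear_combination q2
  refine ⟨⟨uu, vv, ww⟩, ?_⟩
  rw [q1, q2, q3, nM_zero, act_one] at e
  exact wf_inj h2 h3 hα hτ hτ' e

end

theorem card_torS (p : ℕ) [Fact p.Prime] (hp : 5 ≤ p) :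
    ∃ S : Finset (ZMod p × ZMod p), (∀ x, x ∈ S ↔ x ∈ TorS (ZMod p)) ∧ 2 * S.card ≤ p ^ 2 + 1 := by
  classical
  let f : ZMod p × ZMod p → ZMod p × ZMod p := fun x =>
    (x.1 ^ 4 / 3 + 2 * x.1 * x.2, x.2 ^ 2 - x.1 ^ 6 / 27)
  refine ⟨Finset.univ.image f, ?_, ?_⟩
  · rintro ⟨A, B⟩
    rw [Finset.mem_image]
    constructor
    · rintro ⟨⟨m, n⟩, -, h⟩
      exact ⟨m, n, (congrArg Prod.fst h).symm, (congrArg Prod.snd h).symm⟩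
    · rintro ⟨m, n, h1, h2⟩
      exact ⟨(m, n), Finset.mem_univ _, Prod.ext h1.symm h2.symm⟩
  · have hf : ∀ x, f (-x) = f x := by
      rintro ⟨m, n⟩
      simp only [f, Prod.neg_mk]
      congr 1 <;> ring
    have h2 : (2 : ZMod p) ≠ 0 := by
      intro h
      have : ((2 : ℕ) : ZMod p) = 0 := by exact_mod_cast h
      rw [ZMod.natCast_eq_zero_iff] at this
      have := Nat.le_of_dvd (by norm_num) this
      omega
    have key := Finset.mul_card_image_le_card_of_maps_to (f := f)
      (s := (Finset.univ.erase 0).filter (fun x => f x ≠ f 0))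
      (t := (Finset.univ.image f).erase (f 0)) (by
        intro a ha
        rw [Finset.mem_filter] at ha
        exact Finset.mem_erase.mpr ⟨ha.2, Finset.mem_image_of_mem _ (Finset.mem_univ _)⟩) 2 (by
        intro b hb
        rw [Finset.mem_erase, Finset.mem_image] at hb
        obtain ⟨hb0, x, -, rfl⟩ := hb
        have hx0 : x ≠ 0 := fun h => hb0 (by rw [h])
        have hne : x ≠ -x := by
          intro h
          apply hx0
          have e : x + x = 0 := by nth_rewrite 1 [h]; simp
          have e1 := congrArg Prod.fst e
          have e2 := congrArg Prod.snd e
          simp only [Prod.fst_add, Prod.snd_add, Prod.fst_zero, Prod.snd_zero, ← two_mul] at e1 e2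
          exact Prod.ext ((mul_eq_zero.mp e1).resolve_left h2) ((mul_eq_zero.mp e2).resolve_left h2)
        have hsub : ({x, -x} : Finset (ZMod p × ZMod p)) ⊆
            ((Finset.univ.erase 0).filter (fun x => f x ≠ f 0)).filter (fun a => f a = f x) := by
          intro a ha
          rw [Finset.mem_insert, Finset.mem_singleton] at ha
          rcases ha with rfl | rfl
          · simp [hx0, hb0]
          · simp [hx0, hb0, hf]
        have := Finset.card_le_card hsub
        rwa [Finset.card_pair hne] at this)
    have h1 : ((Finset.univ.erase 0).filter (fun x => f x ≠ f 0)).card ≤ p ^ 2 - 1 := by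
      refine (Finset.card_filter_le _ _).trans ?_
      rw [Finset.card_erase_of_mem (Finset.mem_univ _), Finset.card_univ, Fintype.card_prod,
        ZMod.card, sq]
    rw [Finset.card_erase_of_mem (Finset.mem_image_of_mem _ (Finset.mem_univ _))] at key
    have : 1 ≤ p ^ 2 := Nat.one_le_pow _ _ (by omega)
    omega

/-- The forms modulo `p` whose invariants are those of a curve with a 3-torsion point. -/
def BadP {P Q : MvPolynomial (Fin 10) ℚ} (D : InvData P Q) (p : ℕ) : Set (Fin 10 → ZMod p) :=
  {c | ∃ m n : ZMod p, pv D.P0 c = D.N * (-m ^ 4 - 6 * m * n) ∧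
    pv D.Q0 c = D.N * (m ^ 6 - 27 * n ^ 2)}

theorem badP_bound {P Q : MvPolynomial (Fin 10) ℚ} (D : InvData P Q) (p : ℕ) [Fact p.Prime]
    (hp : 5 ≤ p) (hN : (D.N : ZMod p) ≠ 0) : 4 * (BadP D p).ncard ≤ 3 * p ^ 10 := by
  classical
  have hcast : ∀ n : ℕ, 0 < n → n < p → ((n : ℕ) : ZMod p) ≠ 0 := by
    intro n h0 h1 h
    rw [ZMod.natCast_eq_zero_iff] at h
    have := Nat.le_of_dvd h0 h
    omega
  have h2 : (2 : ZMod p) ≠ 0 := by exact_mod_cast hcast 2 (by norm_num) (by omega)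
  have h3 : (3 : ZMod p) ≠ 0 := by exact_mod_cast hcast 3 (by norm_num) (by omega)
  obtain ⟨S, hS, hScard⟩ := card_torS p hp
  let Dom := (ZMod p × ZMod p × ZMod p) × ((ZMod p)ˣ × (ZMod p)ˣ) × (ZMod p × ZMod p × ZMod p) ×
    {x : ZMod p × ZMod p // x ∉ S}
  let Ψ : Dom → (Fin 10 → ZMod p) := fun x =>
    act (nM x.1.1 x.1.2.1 x.1.2.2) (wf (x.2.1.1 : ZMod p) x.2.1.2 x.2.2.1.1 x.2.2.1.2.1 x.2.2.1.2.2
      x.2.2.2.1.1 x.2.2.2.1.2)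
  have hΨinj : Function.Injective Ψ := by
    rintro ⟨⟨u, v, w⟩, ⟨α, τ⟩, ⟨s1, s2, s3⟩, ⟨⟨A, B⟩, hAB⟩⟩
      ⟨⟨u', v', w'⟩, ⟨α', τ'⟩, ⟨s1', s2', s3'⟩, ⟨⟨A', B'⟩, hAB'⟩⟩ h
    obtain ⟨⟨q1, q2, q3⟩, r1, r2, r3, r4, r5, r6, r7⟩ :=
      psi_inj h2 h3 α.ne_zero τ.ne_zero τ'.ne_zero (fun hh => hAB ((hS _).mpr hh)) h
    have r1' : α = α' := Units.ext r1
    have r2' : τ = τ' := Units.ext r2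
    subst q1 q2 q3 r1' r2' r3 r4 r5 r6 r7
    rfl
  have hΨmem : ∀ x, Ψ x ∈ (BadP D p)ᶜ := by
    rintro ⟨⟨u, v, w⟩, ⟨α, τ⟩, ⟨s1, s2, s3⟩, ⟨⟨A, B⟩, hAB⟩⟩ ⟨m, n, e1, e2⟩
    simp only [Ψ] at e1 e2
    rw [wf, D.P_act, D.P_act, det_nM, det_bM _ _ _ _ τ.ne_zero, D.P_smul, D.P_w] at e1
    rw [wf, D.Q_act, D.Q_act, det_nM, det_bM _ _ _ _ τ.ne_zero, D.Q_smul, D.Q_w] at e2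
    apply hAB
    rw [hS]
    apply torS_scale α.ne_zero
    refine ⟨m, n, ?_, ?_⟩
    · have : (D.N : ZMod p) * (3 * ((α : ZMod p) ^ 4 * A - (m ^ 4 / 3 + 2 * m * n))) = 0 := by
        have e : (m ^ 4 / 3) * 3 = m ^ 4 := by field_simp
        linear_combination -e1 - D.N * e
      exact sub_eq_zero.mp ((mul_eq_zero.mp ((mul_eq_zero.mp this).resolve_left hN)).resolve_left h3)
    · have h27 : (27 : ZMod p) ≠ 0 := by
        have : (27 : ZMod p) = 3 ^ 3 := by norm_num
        rw [this]; exact pow_ne_zero _ h3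
      have : (D.N : ZMod p) * (27 * ((α : ZMod p) ^ 6 * B - (n ^ 2 - m ^ 6 / 27))) = 0 := by
        have e : (m ^ 6 / 27) * 27 = m ^ 6 := by field_simp
        linear_combination -e2 + D.N * e
      exact sub_eq_zero.mp ((mul_eq_zero.mp ((mul_eq_zero.mp this).resolve_left hN)).resolve_left h27)
  have hcompl : (BadP D p).ncard + ((BadP D p)ᶜ).ncard = p ^ 10 := by
    rw [Set.ncard_add_ncard_compl]
    simp [Nat.card_eq_fintype_card, ZMod.card]
  have hDom : Fintype.card Dom ≤ ((BadP D p)ᶜ).ncard := by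
    rw [← Nat.card_eq_fintype_card, ← Set.ncard_univ, ]
    exact Set.ncard_le_ncard_of_injOn Ψ (fun x _ => hΨmem x) hΨinj.injOn (Set.toFinite _)
  have hDomc : Fintype.card Dom = p ^ 6 * (p - 1) ^ 2 * (p ^ 2 - S.card) := by
    simp only [Dom, Fintype.card_prod, ZMod.card, ZMod.card_units]
    have : Fintype.card {x : ZMod p × ZMod p // x ∉ S} = p ^ 2 - S.card := by
      rw [Fintype.card_subtype_compl, Fintype.card_coe, Fintype.card_prod, ZMod.card, sq]
    rw [this]
    ring
  rw [hDomc] at hDom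
  obtain ⟨k, rfl⟩ : ∃ k, p = k + 5 := ⟨p - 5, by omega⟩
  have hk1 : k + 5 - 1 = k + 4 := by omega
  rw [hk1] at hDom
  have hT : (k + 5) ^ 2 ≤ 2 * ((k + 5) ^ 2 - S.card) + 1 := by omega
  generalize (k + 5) ^ 2 - S.card = T at *
  have h5 : (k + 5) ^ 4 ≤ 4 * ((k + 4) ^ 2 * T) := by
    have : 2 * ((k + 4) ^ 2 * ((k + 5) ^ 2 - 1)) ≤ 4 * ((k + 4) ^ 2 * T) := by
      have : (k + 5) ^ 2 - 1 ≤ 2 * T := by omega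
      calc _ ≤ 2 * ((k + 4) ^ 2 * (2 * T)) := by gcongr
        _ = _ := by ring
    refine le_trans ?_ this
    have e : (k + 5) ^ 2 - 1 = k ^ 2 + 10 * k + 24 := by
      have : (k + 5) ^ 2 = k ^ 2 + 10 * k + 25 := by ring
      omega
    rw [e]
    nlinarith [sq_nonneg k, Nat.zero_le (k ^ 3), Nat.zero_le (k ^ 4), Nat.zero_le (k^2)]
  have h6 : (k + 5) ^ 10 ≤ 4 * ((k + 5) ^ 6 * (k + 4) ^ 2 * T) := by
    calc (k + 5) ^ 10 = (k + 5) ^ 6 * (k + 5) ^ 4 := by ring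
      _ ≤ (k + 5) ^ 6 * (4 * ((k + 4) ^ 2 * T)) := by gcongr
      _ = _ := by ring
  omega

theorem tors_gen (A B : ℚ) (W : WeierstrassCurve ℚ) (h1 : W.a₁ = 0) (h2 : W.a₂ = 0)
    (h3 : W.a₃ = 0) (h4 : W.a₄ = A) (h6 : W.a₆ = B)
    (p : W.toAffine.Point) (h : p + p + p = 0) (hp : p ≠ 0) : (A, B) ∈ TorS ℚ := by
  have e1 : p + p = -p := eq_neg_of_add_eq_zero_left h
  rcases p with _ | ⟨x, y, hns⟩
  · exact absurd rfl hp
  have hy : y ≠ W.toAffine.negY x y := by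
    intro hy
    have := WeierstrassCurve.Affine.Point.add_self_of_Y_eq (h₁ := hns) hy
    rw [e1] at this
    exact hp (neg_eq_zero.mp this)
  have e2 := WeierstrassCurve.Affine.Point.add_self_of_Y_ne (h₁ := hns) hy
  have hsl := WeierstrassCurve.Affine.slope_of_Y_ne (W := W.toAffine) (x₁ := x) rfl hy
  rw [e1, WeierstrassCurve.Affine.Point.neg_some] at e2
  have e3 : x = W.toAffine.addX x x (W.toAffine.slope x x y y) :=
    ((WeierstrassCurve.Affine.Point.some.injEq ..).mp e2).1
  have heq := (WeierstrassCurve.Affine.equation_iff (W := W.toAffine) x y).mp hns.1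
  clear e1 e2 h hp
  generalize W.toAffine.slope x x y y = m at *
  simp only [WeierstrassCurve.Affine.addX, WeierstrassCurve.Affine.negY, h1, h2, h3, h4, h6]
    at e3 heq hsl hy
  have hy0 : y ≠ 0 := by
    intro h0; apply hy; rw [h0]; simp
  refine torS_of (K := ℚ) (x := x) (y := y) (m := m) (by norm_num) (by linarith) (by linarith) ?_
  have hd : y - (-y - 0 * x - 0) ≠ 0 := by
    intro h0; apply hy0; linarith
  rw [eq_div_iff hd] at hsl
  linarith

theorem tors_param (P Q : MvPolynomial (Fin 10) ℚ) (c : Fin 10 → ℤ)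
    (p : (Ecurve P Q c).toAffine.Point) (h3 : 3 • p = 0) (hp : p ≠ 0) :
    ∃ m n : ℚ, Iinv P c = -m ^ 4 - 6 * m * n ∧ Jinv Q c = m ^ 6 - 27 * n ^ 2 := by
  obtain ⟨m', n, h1, h2⟩ := tors_gen (-(Iinv P c / 3)) (-(Jinv Q c / 27)) (Ecurve P Q c)
    rfl rfl rfl rfl rfl p (by rw [← h3, succ_nsmul, two_nsmul]) hp
  refine ⟨m', n, ?_, ?_⟩
  · simp only at h1; linarith
  · simp only at h2; linarith

theorem param_badP {P Q : MvPolynomial (Fin 10) ℚ} (D : InvData P Q) (c : Fin 10 → ℤ) (m n : ℚ)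
    (hI : Iinv P c = -m ^ 4 - 6 * m * n) (hJ : Jinv Q c = m ^ 6 - 27 * n ^ 2)
    (p : ℕ) [hpf : Fact p.Prime] (hp : 5 ≤ p) (hN : (D.N : ZMod p) ≠ 0) :
    (fun k => (c k : ZMod p)) ∈ BadP D p := by
  set a : ℤ := pv D.P0 c with ha
  set b : ℤ := pv D.Q0 c with hb
  have haq : (a : ℚ) = D.N * (-m ^ 4 - 6 * m * n) := by
    rw [← hI]
    have := map_pv (Int.castRingHom ℚ) D.P0 c
    simp only [eq_intCast] at this
    rw [ha, this, D.hP ℚ]; rfl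
  have hbq : (b : ℚ) = D.N * (m ^ 6 - 27 * n ^ 2) := by
    rw [← hJ]
    have := map_pv (Int.castRingHom ℚ) D.Q0 c
    simp only [eq_intCast] at this
    rw [hb, this, D.hQ ℚ]; rfl
  have haQ : (a : ℚ_[p]) = D.N * (-(m : ℚ_[p]) ^ 4 - 6 * m * n) := by
    have := congrArg (fun t : ℚ => (t : ℚ_[p])) haq
    push_cast at this; exact this
  have hbQ : (b : ℚ_[p]) = D.N * ((m : ℚ_[p]) ^ 6 - 27 * n ^ 2) := by
    have := congrArg (fun t : ℚ => (t : ℚ_[p])) hbq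
    push_cast at this; exact this
  set M : ℚ_[p] := (m : ℚ_[p])
  set n' : ℚ_[p] := (n : ℚ_[p])
  have hNn : ‖(D.N : ℚ_[p])‖ = 1 := by
    rw [Padic.norm_natCast_eq_one_iff]
    rw [Ne, ZMod.natCast_eq_zero_iff] at hN
    exact (hpf.out.coprime_iff_not_dvd).mpr hN
  have h27 : ‖(27 : ℚ_[p])‖ = 1 := by
    have : (27 : ℚ_[p]) = ((27 : ℕ) : ℚ_[p]) := by norm_num
    rw [this, Padic.norm_natCast_eq_one_iff]
    rw [show 27 = 3 ^ 3 by norm_num]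
    apply Nat.Coprime.pow_right
    rw [Nat.coprime_primes hpf.out Nat.prime_three]
    omega
  have han : ‖(a : ℚ_[p])‖ ≤ 1 := Padic.norm_int_le_one a
  have hbn : ‖(b : ℚ_[p])‖ ≤ 1 := Padic.norm_int_le_one b
  have k4 : ‖(4 : ℚ_[p])‖ ≤ 1 := by exact_mod_cast Padic.norm_int_le_one (p := p) 4
  have k6 : ‖(6 : ℚ_[p])‖ ≤ 1 := by exact_mod_cast Padic.norm_int_le_one (p := p) 6
  have k3 : ‖(3 : ℚ_[p])‖ ≤ 1 := by exact_mod_cast Padic.norm_int_le_one (p := p) 3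
  have hM : ‖M‖ ≤ 1 := by
    by_contra hM
    push Not at hM
    have e : (D.N : ℚ_[p]) ^ 2 * M ^ 8 = 6 * D.N * a * M ^ 4 + 4 * D.N * b * M ^ 2 + 3 * a ^ 2 := by
      rw [haQ, hbQ]; ring
    have e1 := congrArg norm e
    have l1 : ‖6 * (D.N : ℚ_[p]) * a * M ^ 4‖ ≤ ‖M‖ ^ 4 := by
      rw [norm_mul, norm_mul, norm_mul, hNn, norm_pow]
      have : ‖(6 : ℚ_[p])‖ * 1 * ‖(a : ℚ_[p])‖ ≤ 1 := by
        rw [mul_one]; exact mul_le_one₀ k6 (norm_nonneg _) han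
      nlinarith [pow_pos (zero_lt_one.trans hM) 4]
    have l2 : ‖4 * (D.N : ℚ_[p]) * b * M ^ 2‖ ≤ ‖M‖ ^ 4 := by
      rw [norm_mul, norm_mul, norm_mul, hNn, norm_pow]
      have : ‖(4 : ℚ_[p])‖ * 1 * ‖(b : ℚ_[p])‖ ≤ 1 := by
        rw [mul_one]; exact mul_le_one₀ k4 (norm_nonneg _) hbn
      have h24 : ‖M‖ ^ 2 ≤ ‖M‖ ^ 4 := pow_le_pow_right₀ hM.le (by norm_num)
      nlinarith [pow_pos (zero_lt_one.trans hM) 2]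
    have l3 : ‖3 * (a : ℚ_[p]) ^ 2‖ ≤ ‖M‖ ^ 4 := by
      rw [norm_mul, norm_pow]
      have : ‖(3 : ℚ_[p])‖ * ‖(a : ℚ_[p])‖ ^ 2 ≤ 1 :=
        mul_le_one₀ k3 (by positivity) (pow_le_one₀ (norm_nonneg _) han)
      exact this.trans (one_le_pow₀ hM.le)
    have l4 : ‖(D.N : ℚ_[p]) ^ 2 * M ^ 8‖ ≤ ‖M‖ ^ 4 := by
      rw [e]
      refine (Padic.nonarchimedean _ _).trans (max_le ((Padic.nonarchimedean _ _).trans (max_le l1 l2)) l3)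
    rw [norm_mul, norm_pow, norm_pow, hNn, one_pow, one_mul] at l4
    exact absurd l4 (not_le.mpr (pow_lt_pow_right₀ hM (by norm_num)))
  have hn : ‖n'‖ ≤ 1 := by
    have e : (D.N : ℚ_[p]) * 27 * n' ^ 2 = D.N * M ^ 6 - b := by rw [hbQ]; ring
    have l : ‖(D.N : ℚ_[p]) * 27 * n' ^ 2‖ ≤ 1 := by
      rw [e, sub_eq_add_neg]
      refine (Padic.nonarchimedean _ _).trans (max_le ?_ ?_)
      · rw [norm_mul, hNn, one_mul, norm_pow]; exact pow_le_one₀ (norm_nonneg _) hM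
      · rw [norm_neg]; exact hbn
    rw [norm_mul, norm_mul, hNn, h27, norm_pow, one_mul, one_mul] at l
    exact (pow_le_one_iff_of_nonneg (norm_nonneg _) two_ne_zero).mp l
  obtain ⟨M0, hM0⟩ : ∃ t : ℤ_[p], (t : ℚ_[p]) = M := ⟨⟨M, hM⟩, rfl⟩
  obtain ⟨n0, hn0⟩ : ∃ t : ℤ_[p], (t : ℚ_[p]) = n' := ⟨⟨n', hn⟩, rfl⟩
  have fa : (a : ℤ_[p]) = D.N * (-M0 ^ 4 - 6 * M0 * n0) := by
    apply Subtype.ext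
    push_cast
    rw [hM0, hn0]
    exact haQ
  have fb : (b : ℤ_[p]) = D.N * (M0 ^ 6 - 27 * n0 ^ 2) := by
    apply Subtype.ext
    push_cast
    rw [hM0, hn0]
    exact hbQ
  refine ⟨PadicInt.toZMod M0, PadicInt.toZMod n0, ?_, ?_⟩
  · have := congrArg (PadicInt.toZMod (p := p)) fa
    have e := map_pv (Int.castRingHom (ZMod p)) D.P0 c
    simp only [eq_intCast] at e
    rw [← e, ← ha]
    simpa [map_ofNat (PadicInt.toZMod (p := p)) 6] using this
  · have := congrArg (PadicInt.toZMod (p := p)) fb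
    have e := map_pv (Int.castRingHom (ZMod p)) D.Q0 c
    simp only [eq_intCast] at e
    rw [← e, ← hb]
    simpa [map_ofNat (PadicInt.toZMod (p := p)) 27] using this

/-- Integral forms that are bad modulo every suitable prime. -/
def BadAll {P Q : MvPolynomial (Fin 10) ℚ} (D : InvData P Q) : Set (Fin 10 → ℤ) :=
  {c | ∀ p : ℕ, p.Prime → 5 ≤ p → (D.N : ZMod p) ≠ 0 → (fun k => (c k : ZMod p)) ∈ BadP D p}

theorem sieve_res {P Q : MvPolynomial (Fin 10) ℚ} (D : InvData P Q) (k : ℕ) :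
    ∃ q : ℕ, 0 < q ∧ ∃ R : Set (Fin 10 → ZMod q), R.ncard * 4 ^ k ≤ 3 ^ k * q ^ 10 ∧
      ∀ c ∈ BadAll D, (fun k => (c k : ZMod q)) ∈ R := by
  induction k with
  | zero =>
    refine ⟨1, one_pos, Set.univ, ?_, fun _ _ => Set.mem_univ _⟩
    rw [Set.ncard_univ, Nat.card_eq_fintype_card]
    simp [Fintype.card_pi]
  | succ k ih =>
    obtain ⟨q, hq, R, hR, hc⟩ := ih
    obtain ⟨p, hpl, hpp⟩ := Nat.exists_infinite_primes (q + D.N + 5)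
    have : Fact p.Prime := ⟨hpp⟩
    have : NeZero q := ⟨hq.ne'⟩
    have hpN : (D.N : ZMod p) ≠ 0 := by
      rw [Ne, ZMod.natCast_eq_zero_iff]
      intro h
      have := Nat.le_of_dvd D.hN h
      omega
    have hb := badP_bound D p (by omega) hpN
    have hco : q.Coprime p := by
      rw [Nat.coprime_comm, hpp.coprime_iff_not_dvd]
      intro h
      have := Nat.le_of_dvd hq h
      omega
    let e := ZMod.chineseRemainder hco
    let f : (Fin 10 → ZMod (q * p)) → (Fin 10 → ZMod q) × (Fin 10 → ZMod p) :=
      fun x => (fun k => (e (x k)).1, fun k => (e (x k)).2)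
    have hf : Function.Injective f := by
      intro x y h
      funext k
      apply e.injective
      have h1 := congrFun (congrArg Prod.fst h) k
      have h2 := congrFun (congrArg Prod.snd h) k
      exact Prod.ext h1 h2
    refine ⟨q * p, Nat.mul_pos hq hpp.pos, f ⁻¹' (R ×ˢ BadP D p), ?_, ?_⟩
    · have h1 : (f ⁻¹' (R ×ˢ BadP D p)).ncard ≤ R.ncard * (BadP D p).ncard := by
        rw [← Set.ncard_prod]
        refine Set.ncard_le_ncard_of_injOn f (fun a ha => ha) hf.injOn (Set.toFinite _)
      calc _ ≤ (R.ncard * (BadP D p).ncard) * 4 ^ (k + 1) := Nat.mul_le_mul_right _ h1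
        _ = (R.ncard * 4 ^ k) * (4 * (BadP D p).ncard) := by ring
        _ ≤ (3 ^ k * q ^ 10) * (3 * p ^ 10) := Nat.mul_le_mul hR hb
        _ = _ := by ring
    · intro c hcb
      have h1 : f (fun k => (c k : ZMod (q * p))) =
          (fun k => (c k : ZMod q), fun k => (c k : ZMod p)) := by
        simp [f]
      rw [Set.mem_preimage, h1]
      exact ⟨hc c hcb, hcb p hpp (by omega) hpN⟩

theorem sieve_box {P Q : MvPolynomial (Fin 10) ℚ} (D : InvData P Q) (δ : ℝ) (hδ : 0 < δ) :
    ∃ q : ℝ, 0 < q ∧ ∀ (B : ℕ) (S : Finset (Fin 10 → ℤ)), (∀ c ∈ S, c ∈ BadAll D) →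
      (∀ c ∈ S, ∀ k, |c k| ≤ B) → (S.card : ℝ) ≤ δ * (2 * B + q) ^ 10 := by
  obtain ⟨k, hk⟩ := exists_pow_lt_of_lt_one hδ (show (3 / 4 : ℝ) < 1 by norm_num)
  obtain ⟨q, hq, R, hR, hc⟩ := sieve_res D k
  have : NeZero q := ⟨hq.ne'⟩
  classical
  refine ⟨q, by exact_mod_cast hq, fun B S hS hB => ?_⟩
  have hRf : R.Finite := Set.toFinite _
  have hqz : (0 : ℤ) < q := by exact_mod_cast hq
  have key : S.card ≤ (hRf.toFinset ×ˢ
      (Fintype.piFinset fun _ : Fin 10 => Finset.range (2 * B / q + 1))).card := by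
    refine Finset.card_le_card_of_injOn
      (fun c => (fun k => (c k : ZMod q), fun k => ((c k + B) / q).toNat)) ?_ ?_
    · intro c hcS
      have hcS' : c ∈ S := hcS
      simp only [Finset.coe_product, Set.mem_prod, Finset.mem_coe, Set.Finite.mem_toFinset,
        Fintype.mem_piFinset, Finset.mem_range]
      refine ⟨hc c (hS c hcS'), fun k => ?_⟩
      have h1 := abs_le.mp (hB c hcS' k)
      have h2 : (c k + B) / q ≤ (2 * B : ℤ) / q := Int.ediv_le_ediv hqz (by linarith)
      have h3 : ((2 * B / q : ℕ) : ℤ) = (2 * B : ℤ) / q := by push_cast; rfl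
      have h4 : ((c k + B) / q).toNat ≤ 2 * B / q := by
        rw [Int.toNat_le, h3]; exact h2
      exact Nat.lt_succ_of_le h4
    · intro c hcS d hdS h
      have hcS' : c ∈ S := hcS
      have hdS' : d ∈ S := hdS
      funext k
      have h1 : (c k : ZMod q) = d k := congrFun (congrArg Prod.fst h) k
      have h2 : ((c k + B) / q).toNat = ((d k + B) / q).toNat := congrFun (congrArg Prod.snd h) k
      have h3 := abs_le.mp (hB c hcS' k)
      have h4 := abs_le.mp (hB d hdS' k)
      have h5 : (c k + B) / q = (d k + B) / q := by
        have a1 : 0 ≤ (c k + B) / q := Int.ediv_nonneg (by linarith) hqz.le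
        have a2 : 0 ≤ (d k + B) / q := Int.ediv_nonneg (by linarith) hqz.le
        omega
      have h6 : (c k + B) % q = (d k + B) % q := by
        have : c k ≡ d k [ZMOD q] := (ZMod.intCast_eq_intCast_iff _ _ _).mp h1
        exact this.add_right _
      have := Int.mul_ediv_add_emod (c k + B) q
      have := Int.mul_ediv_add_emod (d k + B) q
      rw [h5, h6] at *
      linarith
  rw [Finset.card_product, Fintype.card_piFinset] at key
  simp only [Finset.card_range, Finset.prod_const, Finset.card_univ, Fintype.card_fin] at key
  rw [← Set.ncard_eq_toFinset_card R hRf] at key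
  have hR' : (R.ncard : ℝ) ≤ δ * q ^ 10 := by
    have h1 : (R.ncard : ℝ) * 4 ^ k ≤ 3 ^ k * q ^ 10 := by exact_mod_cast hR
    have h2 : (R.ncard : ℝ) ≤ (3 / 4) ^ k * q ^ 10 := by
      rw [div_pow, div_mul_eq_mul_div, le_div_iff₀ (by positivity)]
      exact h1
    refine h2.trans ?_
    gcongr
  have hq' : (0 : ℝ) < q := by exact_mod_cast hq
  have h7 : ((2 * B / q + 1 : ℕ) : ℝ) * q ≤ 2 * B + q := by
    have := Nat.div_mul_le_self (2 * B) q
    have h8 : ((2 * B / q : ℕ) : ℝ) * q ≤ 2 * B := by exact_mod_cast this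
    push_cast at h8 ⊢
    linarith
  calc (S.card : ℝ) ≤ (R.ncard : ℝ) * ((2 * B / q + 1 : ℕ) : ℝ) ^ 10 := by exact_mod_cast key
    _ ≤ δ * q ^ 10 * ((2 * B / q + 1 : ℕ) : ℝ) ^ 10 := by gcongr
    _ = δ * (((2 * B / q + 1 : ℕ) : ℝ) * q) ^ 10 := by ring
    _ ≤ _ := by gcongr

theorem eval_cubic {R : Type*} [CommRing R] (c : Fin 10 → R) (v : Fin 3 → R) :
    eval v (cubic c) = ev c v := by
  rw [cubic_eq_ev, map_ev]
  simp

theorem strong_c45 {c : Fin 10 → ℤ} (hs : StronglyIrred c) {γ : Matrix (Fin 3) (Fin 3) ℤ}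
    (hγ : γ.det = 1) (h0 : act γ c 0 = 0) (h3 : act γ c 3 = 0) :
    act γ c 4 ≠ 0 ∧ act γ c 5 ≠ 0 := by
  by_contra hcon
  have h45 : act γ c 4 = 0 ∨ act γ c 5 = 0 := by
    by_contra h; push Not at h; exact hcon h
  apply hs
  have hh : hc (act γ c) 0 = 0 := by
    have : hc (act γ c) 0 = 24 * act γ c 0 * act γ c 5 * act γ c 7 - 6 * act γ c 0 * act γ c 9 * act γ c 9
      - 8 * act γ c 3 * act γ c 3 * act γ c 7 + 8 * act γ c 3 * act γ c 4 * act γ c 9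
      - 8 * act γ c 4 * act γ c 4 * act γ c 5 := rfl
    rw [this, h0, h3]
    rcases h45 with h | h <;> rw [h] <;> ring
  have k1 : ev c (fun j => γ 0 j) = 0 := by
    have := ev_act γ c ![1, 0, 0]
    have e : ev (act γ c) ![1, 0, 0] = act γ c 0 := by simp [ev]
    rw [e, h0] at this
    rw [this]
    congr 1; funext j; simp [Fin.sum_univ_succ]
  have k2 : ev (hc c) (fun j => γ 0 j) = 0 := by
    have h1 := hc_act γ c
    rw [hγ, one_pow, one_smul] at h1
    have := ev_act γ (hc c) ![1, 0, 0]
    have e : ev (act γ (hc c)) ![1, 0, 0] = act γ (hc c) 0 := by simp [ev]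
    rw [e, ← h1, hh] at this
    rw [this]
    congr 1; funext j; simp [Fin.sum_univ_succ]
  refine ⟨fun j => (γ 0 j : ℚ), ?_, ?_, ?_⟩
  · intro h
    have : ∀ j, γ 0 j = 0 := fun j => by
      have := congrFun h j
      simpa using this
    rw [Matrix.det_eq_zero_of_row_eq_zero 0 this] at hγ
    exact zero_ne_one hγ
  · rw [eval_cubic]
    have := map_ev (Int.castRingHom ℚ) c (fun j => γ 0 j)
    rw [k1] at this
    simpa using this.symm
  · rw [hess_cubic, eval_cubic]
    have := map_ev (Int.castRingHom ℚ) (hc c) (fun j => γ 0 j)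
    rw [k2] at this
    simp only [map_hc] at this
    simpa using this.symm

theorem bad_rep {P Q : MvPolynomial (Fin 10) ℚ} (D : InvData P Q) {c : Fin 10 → ℤ}
    (hs : StronglyIrred c) (ht : ¬ TotallyIrred P Q c) (hd : Δinv P Q c ≠ 0)
    {γ : Matrix (Fin 3) (Fin 3) ℤ} (hγ : γ.det = 1) : act γ c ∈ BadAll D := by
  have h : ∃ p : (Ecurve P Q c).toAffine.Point, 3 • p = 0 ∧ p ≠ 0 := by
    by_contra h
    push Not at h
    exact ht ⟨hs, hd, h⟩
  obtain ⟨pt, h3, h0⟩ := h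
  obtain ⟨m, n, hI, hJ⟩ := tors_param P Q c pt h3 h0
  intro p hp h5 hN
  have : Fact p.Prime := ⟨hp⟩
  obtain ⟨m', n', h1, h2⟩ := param_badP D c m n hI hJ p h5 hN
  have a1 := D.P_act ℤ γ c
  have a2 := D.Q_act ℤ γ c
  rw [hγ, one_pow, one_mul] at a1 a2
  have b1 := map_pv (Int.castRingHom (ZMod p)) D.P0 (act γ c)
  have b2 := map_pv (Int.castRingHom (ZMod p)) D.Q0 (act γ c)
  rw [a1, map_pv] at b1
  rw [a2, map_pv] at b2
  simp only [eq_intCast] at b1 b2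
  exact ⟨m', n', b1 ▸ h1, b2 ▸ h2⟩

theorem height_rep {P Q : MvPolynomial (Fin 10) ℚ} (D : InvData P Q) (c : Fin 10 → ℤ) (X Y : ℝ)
    (hY : 0 < Y) (hXY : 4 * X ≤ Y ^ 12) (hX : 0 ≤ X) (h : (Hinv P Q c : ℝ) < X) :
    |pv D.P0 (fun k => (c k : ℝ))| ≤ D.N * Y ^ 4 ∧ |pv D.Q0 (fun k => (c k : ℝ))| ≤ D.N * Y ^ 6 := by
  have eI : pv D.P0 (fun k => (c k : ℝ)) = D.N * (Iinv P c : ℝ) := by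
    have h1 := map_pv (Rat.castHom ℝ) D.P0 (fun k => (c k : ℚ))
    rw [D.hP ℚ] at h1
    simp only [map_mul, map_natCast, eq_ratCast, Rat.cast_intCast] at h1
    exact h1.symm
  have eJ : pv D.Q0 (fun k => (c k : ℝ)) = D.N * (Jinv Q c : ℝ) := by
    have h1 := map_pv (Rat.castHom ℝ) D.Q0 (fun k => (c k : ℚ))
    rw [D.hQ ℚ] at h1
    simp only [map_mul, map_natCast, eq_ratCast, Rat.cast_intCast] at h1
    exact h1.symm
  have hH : (Hinv P Q c : ℝ) = max (|(Iinv P c : ℝ)| ^ 3) ((Jinv Q c : ℝ) ^ 2 / 4) := by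
    unfold Hinv; push_cast; rfl
  rw [hH, max_lt_iff] at h
  rw [eI, eJ, abs_mul, abs_mul, abs_of_nonneg (Nat.cast_nonneg D.N : (0:ℝ) ≤ D.N)]
  constructor
  · gcongr
    refine le_of_pow_le_pow_left₀ (n := 3) (by norm_num) (by positivity) ?_
    have : (Y ^ 4) ^ 3 = Y ^ 12 := by ring
    rw [this]; linarith
  · gcongr
    refine abs_le_of_sq_le_sq ?_ (by positivity)
    have : (Y ^ 6) ^ 2 = Y ^ 12 := by ring
    rw [this]; linarith

/-- The set of classes counted by `Mcount`. -/
def MSet (P Q : MvPolynomial (Fin 10) ℚ) (X : ℝ) : Set (Set (Fin 10 → ℤ)) :=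
  {T : Set (Fin 10 → ℤ) | ∃ c : Fin 10 → ℤ, StronglyIrred c ∧
    ¬ TotallyIrred P Q c ∧ Δinv P Q c ≠ 0 ∧ (Hinv P Q c : ℝ) < X ∧ T = orbitZ c}

theorem full_rep {P Q : MvPolynomial (Fin 10) ℚ} (D : InvData P Q) :
    ∃ C : ℝ, 0 < C ∧ ∀ X Y : ℝ, 0 < Y → 4 * X ≤ Y ^ 12 → 0 ≤ X → ∀ T ∈ MSet P Q X,
      ∃ c, orbitZ c = T ∧ c ∈ BadAll D ∧ (c 0 = 0 → c 3 = 0 → c 4 ≠ 0 ∧ c 5 ≠ 0) ∧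
        ∃ i j, c ∈ cellR i j (C * Y) := by
  obtain ⟨C, hC, h⟩ := box_reduction D
  refine ⟨C, hC, fun X Y hY hXY hX T hT => ?_⟩
  obtain ⟨c, hs, ht, hd, hh, rfl⟩ := hT
  obtain ⟨h1, h2⟩ := height_rep D c X Y hY hXY hX hh
  obtain ⟨γ, hγ, i, j, hb⟩ := h c Y hY h1 h2
  exact ⟨act γ c, orbitZ_act hγ c, bad_rep D hs ht hd hγ, strong_c45 hs hγ, i, j, hb⟩

theorem ncard_family {α ι : Type*} (S : Set α) (I : Finset ι) (F : ι → Set α)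
    (hS : ∀ x ∈ S, ∃ i ∈ I, x ∈ F i) (hF : ∀ i ∈ I, (F i).Finite) (b : ι → ℝ)
    (hb : ∀ i ∈ I, ((F i).ncard : ℝ) ≤ b i) : S.Finite ∧ (S.ncard : ℝ) ≤ ∑ i ∈ I, b i := by
  have hsub : S ⊆ ⋃ i ∈ I, F i := by
    intro x hx
    obtain ⟨i, hi, hxi⟩ := hS x hx
    exact Set.mem_biUnion hi hxi
  have hfin : (⋃ i ∈ I, F i).Finite := Set.Finite.biUnion I.finite_toSet hF
  refine ⟨hfin.subset hsub, ?_⟩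
  have h1 : S.ncard ≤ ∑ i ∈ I, (F i).ncard :=
    (Set.ncard_le_ncard hsub hfin).trans (Finset.set_ncard_biUnion_le I F)
  calc (S.ncard : ℝ) ≤ ∑ i ∈ I, ((F i).ncard : ℝ) := by exact_mod_cast h1
    _ ≤ _ := Finset.sum_le_sum hb

theorem geom_quarter (n : ℕ) : ∑ i ∈ Finset.range n, (1 / 4 : ℝ) ^ i ≤ 4 / 3 := by
  have h := (summable_geometric_of_lt_one (r := (1 / 4 : ℝ)) (by norm_num) (by norm_num)).sum_le_tsum
    (Finset.range n) (fun i _ => by positivity)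
  rw [tsum_geometric_of_lt_one (by norm_num) (by norm_num)] at h
  norm_num at h ⊢
  exact h

theorem lt_of_pow8 {i : ℕ} {Z : ℝ} (h : (8 : ℝ) ^ i ≤ Z) : i < ⌊Z⌋₊ + 1 := by
  have h1 : (8 : ℕ) ^ i ≤ ⌊Z⌋₊ := Nat.le_floor (by push_cast; exact h)
  have h2 : i < 8 ^ i := Nat.lt_pow_self (by norm_num)
  omega

theorem cube_le_pow8 (i : ℕ) : (i + 1) ^ 3 ≤ 8 ^ i := by
  have : i + 1 ≤ 2 ^ i := Nat.lt_two_pow_self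
  calc (i + 1) ^ 3 ≤ (2 ^ i) ^ 3 := Nat.pow_le_pow_left this 3
    _ = 8 ^ i := by rw [← pow_mul, mul_comm, pow_mul]; norm_num

theorem lt_of_pow8' {i : ℕ} {W : ℝ} (hW : 0 ≤ W) (h : (8 : ℝ) ^ i ≤ W ^ 3) : i < ⌊W⌋₊ := by
  have h1 : ((i : ℝ) + 1) ^ 3 ≤ 8 ^ i := by exact_mod_cast cube_le_pow8 i
  have h2 : (i : ℝ) + 1 ≤ W := le_of_pow_le_pow_left₀ (n := 3) (by norm_num) hW (h1.trans h)
  exact Nat.le_floor (by push_cast; exact h2)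

theorem part_B : ∃ K : ℝ, 0 < K ∧ ∀ (T0 : ℕ) (Z : ℝ), 0 < Z → ∀ S : Set (Set (Fin 10 → ℤ)),
    (∀ T ∈ S, ∃ i j c, (T0 < i ∨ T0 < j) ∧ c ∈ cellR i j Z ∧ c 0 ≠ 0 ∧ orbitZ c = T) →
    S.Finite ∧ (S.ncard : ℝ) ≤ K * (1 / 2) ^ T0 * Z ^ 10 := by
  obtain ⟨C, hC, h⟩ := cell_c0
  refine ⟨2 * C ^ 10, by positivity, fun T0 Z hZ S hS => ?_⟩
  classical
  let n := ⌊Z⌋₊ + 1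
  let F : ℕ × ℕ → Set (Set (Fin 10 → ℤ)) := fun x =>
    {T | (T0 < x.1 ∨ T0 < x.2) ∧ ∃ c ∈ {c | c ∈ cellR x.1 x.2 Z ∧ c 0 ≠ 0}, orbitZ c = T}
  have hF := fun x : ℕ × ℕ => h x.1 x.2 Z (F x) hZ (fun T hT => hT.2)
  have main := ncard_family S (Finset.range n ×ˢ Finset.range n) F ?_ (fun x _ => (hF x).1)
    (fun x => (C * Z) ^ 10 * (1 / 2) ^ T0 * ((1 / 4) ^ x.1 * (1 / 4) ^ x.2)) ?_
  · refine ⟨main.1, main.2.trans ?_⟩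
    rw [← Finset.mul_sum, Finset.sum_product]
    simp only [← Finset.mul_sum]
    rw [← Finset.sum_mul]
    have g := geom_quarter n
    have g0 : 0 ≤ ∑ i ∈ Finset.range n, (1 / 4 : ℝ) ^ i := by positivity
    have g2 : (∑ i ∈ Finset.range n, (1 / 4 : ℝ) ^ i) * (∑ i ∈ Finset.range n, (1 / 4 : ℝ) ^ i) ≤ 2 := by
      nlinarith
    calc _ ≤ (C * Z) ^ 10 * (1 / 2) ^ T0 * 2 := by gcongr
      _ = _ := by ring
  · intro T hT
    obtain ⟨i, j, c, hij, hc, hc0, hT⟩ := hS T hT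
    have h1 := one_le_of_ne hc0 (hc 0)
    have h2 : wt (8 ^ i) (8 ^ j) 0 = 1 / (((8 : ℝ) ^ i) ^ 2 * 8 ^ j) := rfl
    rw [h2, mul_one_div, one_le_div (by positivity)] at h1
    have i1 : (1 : ℝ) ≤ 8 ^ i := one_le_pow₀ (by norm_num)
    have j1 : (1 : ℝ) ≤ 8 ^ j := one_le_pow₀ (by norm_num)
    refine ⟨(i, j), ?_, hij, c, ⟨hc, hc0⟩, hT⟩
    rw [Finset.mem_product, Finset.mem_range, Finset.mem_range]
    have i2 : (8 : ℝ) ^ i ≤ (8 ^ i) ^ 2 := by nlinarith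
    exact ⟨lt_of_pow8 (by nlinarith), lt_of_pow8 (by nlinarith)⟩
  · rintro ⟨i, j⟩ -
    by_cases hij : T0 < i ∨ T0 < j
    · have h2 := (hF (i, j)).2
      simp only at h2 ⊢
      have h3 : (2 : ℝ) ^ T0 * (4 ^ i * 4 ^ j) ≤ 8 ^ (2 * i + j) := by
        have e4 : (4 : ℝ) = 2 ^ 2 := by norm_num
        have e8 : (8 : ℝ) = 2 ^ 3 := by norm_num
        rw [e4, e8, ← pow_mul, ← pow_mul, ← pow_mul, ← pow_add, ← pow_add]
        exact pow_le_pow_right₀ (by norm_num) (by omega)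
      have h4 : ((F (i, j)).ncard : ℝ) * (2 ^ T0 * (4 ^ i * 4 ^ j)) ≤ (C * Z) ^ 10 :=
        le_trans (by gcongr) h2
      rw [← le_div_iff₀ (by positivity)] at h4
      refine h4.trans (le_of_eq ?_)
      simp only [one_div, inv_pow]
      field_simp
    · have : F (i, j) = ∅ := by
        ext T
        simp only [F, Set.mem_ofPred_eq, Set.mem_empty_iff_false, iff_false]
        exact fun h => hij h.1
      rw [this]
      simp only [Set.ncard_empty, Nat.cast_zero]
      positivity

theorem part_C : ∃ K : ℝ, 0 < K ∧ ∀ (W : ℝ), 0 < W → ∀ S : Set (Set (Fin 10 → ℤ)),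
    (∀ T ∈ S, ∃ i j c, c ∈ cellR i j (W ^ 3) ∧ c 0 = 0 ∧ (c 3 = 0 → c 4 ≠ 0 ∧ c 5 ≠ 0) ∧
      orbitZ c = T) →
    S.Finite ∧ (S.ncard : ℝ) ≤ K * W ^ 29 := by
  obtain ⟨C, hC, h⟩ := cell_c3
  obtain ⟨C', hC', h'⟩ := cell_c5
  refine ⟨C ^ 9 + C' ^ 9, by positivity, fun W hW S hS => ?_⟩
  classical
  have hZ : 0 < W ^ 3 := by positivity
  let n := ⌊W⌋₊
  let F1 : ℕ × ℕ → Set (Set (Fin 10 → ℤ)) := fun x =>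
    {T | ∃ c ∈ {c | c ∈ cellR x.1 x.2 (W ^ 3) ∧ c 0 = 0 ∧ c 3 ≠ 0}, orbitZ c = T}
  let F2 : ℕ × ℕ → Set (Set (Fin 10 → ℤ)) := fun x =>
    {T | ∃ c ∈ {c | c ∈ cellR x.1 x.2 (W ^ 3) ∧ c 0 = 0 ∧ c 3 = 0 ∧ c 4 ≠ 0 ∧ c 5 ≠ 0}, orbitZ c = T}
  have hF1 := fun x : ℕ × ℕ => h x.1 x.2 (W ^ 3) (F1 x) hZ (fun T hT => hT)
  have hF2 := fun x : ℕ × ℕ => h' x.1 x.2 (W ^ 3) (F2 x) hZ (fun T hT => hT)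
  have main := ncard_family S (Finset.range n ×ˢ Finset.range n) (fun x => F1 x ∪ F2 x) ?_
    (fun x _ => (hF1 x).1.union (hF2 x).1)
    (fun x => (C ^ 9 + C' ^ 9) * W ^ 27) ?_
  · refine ⟨main.1, main.2.trans ?_⟩
    rw [Finset.sum_const, Finset.card_product, Finset.card_range, nsmul_eq_mul]
    have hn : (n : ℝ) ≤ W := Nat.floor_le hW.le
    push_cast
    calc (n : ℝ) * n * ((C ^ 9 + C' ^ 9) * W ^ 27) ≤ W * W * ((C ^ 9 + C' ^ 9) * W ^ 27) := by gcongr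
      _ = _ := by ring
  · intro T hT
    obtain ⟨i, j, c, hc, hc0, h45, hT⟩ := hS T hT
    have i1 : (1 : ℝ) ≤ 8 ^ i := one_le_pow₀ (by norm_num)
    have j1 : (1 : ℝ) ≤ 8 ^ j := one_le_pow₀ (by norm_num)
    refine ⟨(i, j), ?_, ?_⟩
    · rw [Finset.mem_product, Finset.mem_range, Finset.mem_range]
      by_cases h3 : c 3 = 0
      · have h1 := one_le_of_ne (h45 h3).1 (hc 4)
        have h2 : wt (8 ^ i) (8 ^ j) 4 = 1 / ((8 : ℝ) ^ i) := rfl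
        rw [h2, mul_one_div, one_le_div (by positivity)] at h1
        have h1' := one_le_of_ne (h45 h3).2 (hc 5)
        have h2' : wt (8 ^ i) (8 ^ j) 5 = 1 / ((8 : ℝ) ^ j) := rfl
        rw [h2', mul_one_div, one_le_div (by positivity)] at h1'
        exact ⟨lt_of_pow8' hW.le h1, lt_of_pow8' hW.le h1'⟩
      · have h1 := one_le_of_ne h3 (hc 3)
        have h2 : wt (8 ^ i) (8 ^ j) 3 = 1 / ((8 : ℝ) ^ i * 8 ^ j) := rfl
        rw [h2, mul_one_div, one_le_div (by positivity)] at h1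
        exact ⟨lt_of_pow8' hW.le (by nlinarith), lt_of_pow8' hW.le (by nlinarith)⟩
    · by_cases h3 : c 3 = 0
      · exact Or.inr ⟨c, ⟨hc, hc0, h3, h45 h3⟩, hT⟩
      · exact Or.inl ⟨c, ⟨hc, hc0, h3⟩, hT⟩
  · intro x _
    have h1 := (hF1 x).2
    have h2 := (hF2 x).2
    have h3 : ((F1 x ∪ F2 x).ncard : ℝ) ≤ (F1 x).ncard + (F2 x).ncard := by
      exact_mod_cast Set.ncard_union_le _ _
    calc _ ≤ _ := h3
      _ ≤ (C * W ^ 3) ^ 9 + (C' * W ^ 3) ^ 9 := add_le_add h1 h2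
      _ = _ := by ring

theorem part_A {P Q : MvPolynomial (Fin 10) ℚ} (D : InvData P Q) (δ : ℝ) (hδ : 0 < δ) :
    ∃ q : ℝ, 0 < q ∧ ∀ (T0 : ℕ) (Z : ℝ), 0 < Z → ∀ S : Set (Set (Fin 10 → ℤ)),
      (∀ T ∈ S, ∃ i j c, i ≤ T0 ∧ j ≤ T0 ∧ c ∈ cellR i j Z ∧ c ∈ BadAll D ∧ orbitZ c = T) →
      S.Finite ∧ (S.ncard : ℝ) ≤ δ * (2 * (Z * 8 ^ (3 * T0)) + q) ^ 10 := by
  obtain ⟨q, hq, h⟩ := sieve_box D δ hδ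
  refine ⟨q, hq, fun T0 Z hZ S hS => ?_⟩
  classical
  set B := ⌊Z * 8 ^ (3 * T0)⌋₊ with hB
  let U : Finset (Fin 10 → ℤ) := (Fintype.piFinset fun _ => Finset.Icc (-(B : ℤ)) B).filter
    (fun c => c ∈ BadAll D)
  have hU := h B U (fun c hc => (Finset.mem_filter.mp hc).2) (fun c hc k => by
    have := Fintype.mem_piFinset.mp (Finset.mem_filter.mp hc).1 k
    rw [Finset.mem_Icc] at this
    exact abs_le.mpr this)
  have hsub : S ⊆ (U.image orbitZ : Finset _) := by
    intro T hT
    obtain ⟨i, j, c, hi, hj, hc, hb, rfl⟩ := hS T hT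
    rw [Finset.mem_coe]
    refine Finset.mem_image_of_mem _ (Finset.mem_filter.mpr ⟨?_, hb⟩)
    rw [Fintype.mem_piFinset]
    intro k
    rw [Finset.mem_Icc, ← abs_le]
    have i1 : (1 : ℝ) ≤ 8 ^ i := one_le_pow₀ (by norm_num)
    have j1 : (1 : ℝ) ≤ 8 ^ j := one_le_pow₀ (by norm_num)
    have i2 : (8 : ℝ) ^ i ≤ 8 ^ T0 := pow_le_pow_right₀ (by norm_num) hi
    have j2 : (8 : ℝ) ^ j ≤ 8 ^ T0 := pow_le_pow_right₀ (by norm_num) hj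
    have hw : wt (8 ^ i) (8 ^ j) k ≤ 8 ^ (3 * T0) := by
      rw [mul_comm 3 T0, pow_mul]
      generalize (8 : ℝ) ^ i = p at *
      generalize (8 : ℝ) ^ j = s at *
      generalize (8 : ℝ) ^ T0 = t at *
      have t1 : 1 ≤ t := i1.trans i2
      have ht : 1 ≤ t ^ 3 := one_le_pow₀ t1
      have ht1 : t ≤ t ^ 3 := le_self_pow₀ t1 (by norm_num)
      have ht2 : t * t ≤ t ^ 3 := by nlinarith
      have hps : p * s ≤ t * t := by gcongr
      have hpss : p * s ^ 2 ≤ t ^ 3 := by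
        calc p * s ^ 2 ≤ t * t ^ 2 := by gcongr
          _ = t ^ 3 := by ring
      have hinv : ∀ x : ℝ, 1 ≤ x → 1 / x ≤ t ^ 3 := fun x hx =>
        le_trans (by rw [div_le_one (by linarith)]; exact hx) ht
      have hp2 : 1 ≤ p ^ 2 := one_le_pow₀ i1
      fin_cases k
      · exact hinv (p ^ 2 * s) (one_le_mul_of_one_le_of_one_le hp2 j1)
      · exact (div_le_self (by linarith) j1).trans (i2.trans ht1)
      · exact hpss
      · exact hinv (p * s) (one_le_mul_of_one_le_of_one_le i1 j1)
      · exact hinv _ i1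
      · exact hinv _ j1
      · exact i2.trans ht1
      · exact j2.trans ht1
      · exact hps.trans ht2
      · exact ht
    have h1 : |(c k : ℝ)| ≤ Z * 8 ^ (3 * T0) := (hc k).trans (by gcongr)
    have h2 : ((c k).natAbs : ℝ) ≤ Z * 8 ^ (3 * T0) := by
      rw [Nat.cast_natAbs]; push_cast; exact h1
    have h3 : (c k).natAbs ≤ B := Nat.le_floor h2
    rw [Int.abs_eq_natAbs]
    exact_mod_cast h3
  refine ⟨(Finset.finite_toSet _).subset hsub, ?_⟩
  have h1 : S.ncard ≤ U.card := by
    refine (Set.ncard_le_ncard hsub (Finset.finite_toSet _)).trans ?_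
    rw [Set.ncard_coe_finset]
    exact Finset.card_image_le
  have hBl : (B : ℝ) ≤ Z * 8 ^ (3 * T0) := Nat.floor_le (by positivity)
  calc (S.ncard : ℝ) ≤ U.card := by exact_mod_cast h1
    _ ≤ _ := hU
    _ ≤ _ := by gcongr

theorem count_main {P Q : MvPolynomial (Fin 10) ℚ} (D : InvData P Q) :
    ∃ C K : ℝ, 0 < C ∧ 0 < K ∧ ∀ δ : ℝ, 0 < δ → ∃ q : ℝ, 0 < q ∧ ∀ (T0 : ℕ) (X W : ℝ), 0 ≤ X →
      0 < W → 4 * X ≤ (W ^ 3 / C) ^ 12 →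
      (Mcount P Q X : ℝ) ≤ K * (1 / 2) ^ T0 * W ^ 30 + K * W ^ 29
        + δ * (2 * (W ^ 3 * 8 ^ (3 * T0)) + q) ^ 10 := by
  obtain ⟨C, hC, hrep⟩ := full_rep D
  obtain ⟨KB, hKB, hB⟩ := part_B
  obtain ⟨KC, hKC, hCC⟩ := part_C
  refine ⟨C, KB + KC, hC, by positivity, fun δ hδ => ?_⟩
  obtain ⟨q, hq, hA⟩ := part_A D δ hδ
  refine ⟨q, hq, fun T0 X W hX hW hXW => ?_⟩
  have hZ : 0 < W ^ 3 := by positivity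
  have rep := hrep X (W ^ 3 / C) (by positivity) hXW hX
  have eZ : C * (W ^ 3 / C) = W ^ 3 := by field_simp
  rw [eZ] at rep
  let SA : Set (Set (Fin 10 → ℤ)) := {T | ∃ i j c, i ≤ T0 ∧ j ≤ T0 ∧ c ∈ cellR i j (W ^ 3) ∧
    c ∈ BadAll D ∧ orbitZ c = T}
  let SB : Set (Set (Fin 10 → ℤ)) := {T | ∃ i j c, (T0 < i ∨ T0 < j) ∧ c ∈ cellR i j (W ^ 3) ∧
    c 0 ≠ 0 ∧ orbitZ c = T}
  let SC : Set (Set (Fin 10 → ℤ)) := {T | ∃ i j c, c ∈ cellR i j (W ^ 3) ∧ c 0 = 0 ∧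
    (c 3 = 0 → c 4 ≠ 0 ∧ c 5 ≠ 0) ∧ orbitZ c = T}
  obtain ⟨fA, nA⟩ := hA T0 (W ^ 3) hZ SA (fun T hT => hT)
  obtain ⟨fB, nB⟩ := hB T0 (W ^ 3) hZ SB (fun T hT => hT)
  obtain ⟨fC, nC⟩ := hCC W hW SC (fun T hT => hT)
  have hsub : MSet P Q X ⊆ SA ∪ SB ∪ SC := by
    intro T hT
    obtain ⟨c, hcT, hb, h45, i, j, hc⟩ := rep T hT
    by_cases h0 : c 0 = 0
    · exact Or.inr ⟨i, j, c, hc, h0, h45 h0, hcT⟩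
    · left
      by_cases hij : T0 < i ∨ T0 < j
      · exact Or.inr ⟨i, j, c, hij, hc, h0, hcT⟩
      · push Not at hij
        exact Or.inl ⟨i, j, c, hij.1, hij.2, hc, hb, hcT⟩
  have h1 : Mcount P Q X ≤ SA.ncard + SB.ncard + SC.ncard := by
    have e : Mcount P Q X = (MSet P Q X).ncard := rfl
    rw [e]
    refine (Set.ncard_le_ncard hsub ((fA.union fB).union fC)).trans ?_
    refine (Set.ncard_union_le _ _).trans ?_
    exact Nat.add_le_add_right (Set.ncard_union_le _ _) _
  have h2 : (Mcount P Q X : ℝ) ≤ SA.ncard + SB.ncard + SC.ncard := by exact_mod_cast h1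
  have e30 : (W ^ 3) ^ 10 = W ^ 30 := by ring
  rw [e30] at nB
  have p1 : KB * (1 / 2) ^ T0 * W ^ 30 ≤ (KB + KC) * (1 / 2) ^ T0 * W ^ 30 := by
    gcongr; linarith
  have p2 : KC * W ^ 29 ≤ (KB + KC) * W ^ 29 := by
    gcongr; linarith
  linarith

/-- `lim_{X→∞} M(X)/X^{5/6} = 0`: the number of classes of strongly irreducible but not
totally irreducible integral ternary cubic forms of bounded height is negligible. -/
theorem stmt15 (P Q : MvPolynomial (Fin 10) ℚ) (hPQ : IsInvariantPair ℚ P Q) :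
    Filter.Tendsto (fun X : ℝ => (Mcount P Q X : ℝ) / X ^ ((5 : ℝ)/6)) Filter.atTop
      (nhds 0) := by
  obtain ⟨D⟩ := exists_invData hPQ
  obtain ⟨C, K, hC, hK, hmain⟩ := count_main D
  rw [Metric.tendsto_atTop]
  intro ε hε
  obtain ⟨ε', hε', hεε⟩ : ∃ ε' : ℝ, 0 < ε' ∧ (2 * C) ^ 10 * (3 * ε') < ε :=
    ⟨ε / (4 * (2 * C) ^ 10), by positivity, by field_simp; norm_num⟩
  obtain ⟨T0, hT0⟩ := exists_pow_lt_of_lt_one (show 0 < ε' / K by positivity)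
    (show (1 / 2 : ℝ) < 1 by norm_num)
  have hT0' : K * (1 / 2) ^ T0 ≤ ε' := by
    rw [lt_div_iff₀ hK] at hT0; linarith
  set A : ℝ := 2 * 8 ^ (3 * T0) + 1 with hA
  have hA0 : 0 < A := by positivity
  obtain ⟨q, hq, hM⟩ := hmain (ε' / A ^ 10) (by positivity)
  set W0 : ℝ := 1 + q + K / ε' with hW0
  have hW01 : 1 ≤ W0 := by
    have : 0 < K / ε' := by positivity
    linarith
  refine ⟨(W0 ^ 3 / (2 * C)) ^ 12, fun X hX => ?_⟩
  have hXpos : 0 < X := lt_of_lt_of_le (by positivity) hX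
  set Y : ℝ := X ^ ((1 : ℝ) / 12) with hY
  have hYpos : 0 < Y := Real.rpow_pos_of_pos hXpos _
  have hY12 : Y ^ 12 = X := by
    rw [hY, ← Real.rpow_natCast, ← Real.rpow_mul hXpos.le]; norm_num
  have hY10 : X ^ ((5 : ℝ) / 6) = Y ^ 10 := by
    rw [hY, ← Real.rpow_natCast, ← Real.rpow_mul hXpos.le]; norm_num
  set W : ℝ := (2 * C * Y) ^ ((1 : ℝ) / 3) with hW
  have hWpos : 0 < W := Real.rpow_pos_of_pos (by positivity) _
  have hW3 : W ^ 3 = 2 * C * Y := by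
    rw [hW, ← Real.rpow_natCast, ← Real.rpow_mul (by positivity)]; norm_num
  have hWW : W0 ≤ W := by
    have h1 : W0 ^ 3 / (2 * C) ≤ Y := by
      refine le_of_pow_le_pow_left₀ (n := 12) (by norm_num) hYpos.le ?_
      rw [hY12]; exact hX
    refine le_of_pow_le_pow_left₀ (n := 3) (by norm_num) hWpos.le ?_
    rw [hW3]
    rw [div_le_iff₀ (by positivity)] at h1
    linarith
  have hb := hM T0 X W hXpos.le hWpos (by
    rw [hW3, show 2 * C * Y / C = 2 * Y by field_simp, mul_pow, hY12]
    norm_num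
    linarith)
  have hKε : 0 < K / ε' := by positivity
  have hW1 : 1 ≤ W := hW01.trans hWW
  have b1 : K * (1 / 2) ^ T0 * W ^ 30 ≤ ε' * W ^ 30 := by gcongr
  have b2 : K * W ^ 29 ≤ ε' * W ^ 30 := by
    have : K / ε' ≤ W := by linarith
    rw [div_le_iff₀ hε'] at this
    calc K * W ^ 29 ≤ (W * ε') * W ^ 29 := by gcongr
      _ = _ := by ring
  have b3 : ε' / A ^ 10 * (2 * (W ^ 3 * 8 ^ (3 * T0)) + q) ^ 10 ≤ ε' * W ^ 30 := by
    have hqW : q ≤ W ^ 3 := by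
      have : W ≤ W ^ 3 := le_self_pow₀ hW1 (by norm_num)
      linarith
    have h1 : 2 * (W ^ 3 * 8 ^ (3 * T0)) + q ≤ A * W ^ 3 := by
      rw [hA]; nlinarith
    calc _ ≤ ε' / A ^ 10 * (A * W ^ 3) ^ 10 := by gcongr
      _ = _ := by field_simp
  have hb' : (Mcount P Q X : ℝ) ≤ 3 * ε' * W ^ 30 := by linarith
  have hW30 : W ^ 30 = (2 * C) ^ 10 * Y ^ 10 := by
    rw [show W ^ 30 = (W ^ 3) ^ 10 by ring, hW3]; ring
  rw [hY10, Real.dist_eq, sub_zero, abs_of_nonneg (by positivity), div_lt_iff₀ (by positivity)]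
  rw [hW30] at hb'
  calc (Mcount P Q X : ℝ) ≤ ((2 * C) ^ 10 * (3 * ε')) * Y ^ 10 := by linarith
    _ < ε * Y ^ 10 := by gcongr
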